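/- arXiv:2412.02123 — 2 statements merged into one kernel-verified Lean document; each statement's English description precedes it below -/
import Mathlib

section
/- Let K = K(n,m,Λ) be a Bedford–McMullen carpet (n > m ≥ 2) that is not contained in any affine line of ℝ². If f is a similitude on ℝ² with positive similarity ratio such that f(K) ⊆ K, then f is not oblique; that is, at least one of the two coordinates of the vector f(1,0) − f(0,0) is zero. -/
open scoped BigOperators

/-- The Bedford–McMullen carpet `K(n,m,Λ)`: the set of points
`(Σ_k i_k n^{-k}, Σ_k j_k m^{-k})` with `(i_k, j_k) ∈ Λ` for all `k ≥ 1`. -/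
def BMCarpet (n m : ℕ) (Λ : Finset (ℕ × ℕ)) : Set (ℝ × ℝ) :=
  { p | ∃ d : ℕ → ℕ × ℕ, (∀ k, d k ∈ Λ) ∧
      p.1 = ∑' k : ℕ, ((d k).1 : ℝ) / (n : ℝ) ^ (k + 1) ∧
      p.2 = ∑' k : ℕ, ((d k).2 : ℝ) / (m : ℝ) ^ (k + 1) }

/-- `f` is a similitude of the Euclidean plane with ratio `l`. -/
def IsSimilitude (f : ℝ × ℝ → ℝ × ℝ) (l : ℝ) : Prop :=
  ∀ x y : ℝ × ℝ,
    Real.sqrt (((f x).1 - (f y).1) ^ 2 + ((f x).2 - (f y).2) ^ 2)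
      = l * Real.sqrt ((x.1 - y.1) ^ 2 + (x.2 - y.2) ^ 2)

/-- `f` is oblique: both coordinates of `f (1,0) - f (0,0)` are nonzero. -/
def Oblique (f : ℝ × ℝ → ℝ × ℝ) : Prop :=
  (f (1, 0)).1 - (f (0, 0)).1 ≠ 0 ∧ (f (1, 0)).2 - (f (0, 0)).2 ≠ 0

/-- `K` is contained in some affine line of the plane. -/
def OnALine (K : Set (ℝ × ℝ)) : Prop :=
  ∃ a b c : ℝ, (a ≠ 0 ∨ b ≠ 0) ∧ ∀ p ∈ K, a * p.1 + b * p.2 = c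

/-- The real number `∑ e_k b^{-(k+1)}` with base `b` and real digits `e_k`. -/
noncomputable def bval (b : ℕ) (e : ℕ → ℝ) : ℝ := ∑' k : ℕ, e k / (b : ℝ) ^ (k + 1)

lemma hasSum_geometric_digits {b : ℕ} (hb : 2 ≤ b) (M : ℝ) :
    HasSum (fun k : ℕ => M / (b : ℝ) ^ (k + 1)) (M / (b - 1)) := by
  have hb' : (2 : ℝ) ≤ b := by exact_mod_cast hb
  have h := (hasSum_geometric_of_lt_one (r := (b : ℝ)⁻¹) (by positivity)
    (inv_lt_one_of_one_lt₀ (by linarith))).mul_left (M / b)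
  have e₁ : (fun k : ℕ => M / (b : ℝ) ^ (k + 1)) = fun k : ℕ => M / b * (b : ℝ)⁻¹ ^ k := by
    ext k
    rw [inv_pow, pow_succ]
    field_simp
  have e₂ : M / ((b : ℝ) - 1) = M / b * (1 - (b : ℝ)⁻¹)⁻¹ := by
    have h₁ : (b : ℝ) - 1 ≠ 0 := by linarith
    have h₂ : (b : ℝ) ≠ 0 := by linarith
    rw [show 1 - (b : ℝ)⁻¹ = (b - 1) / b by field_simp]
    field_simp
  rw [e₁, e₂]
  exact h

lemma norm_digit_le {b : ℕ} {e : ℕ → ℝ} {M : ℝ} (he : ∀ k, |e k| ≤ M) (k : ℕ) :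
    ‖e k / (b : ℝ) ^ (k + 1)‖ ≤ M / (b : ℝ) ^ (k + 1) := by
  rw [norm_div, norm_pow, Real.norm_natCast, Real.norm_eq_abs]
  gcongr
  exact he k

lemma summable_digits {b : ℕ} (hb : 2 ≤ b) {e : ℕ → ℝ} {M : ℝ} (he : ∀ k, |e k| ≤ M) :
    Summable fun k : ℕ => e k / (b : ℝ) ^ (k + 1) :=
  Summable.of_norm_bounded (hasSum_geometric_digits hb M).summable (norm_digit_le he)

lemma abs_bval_le {b : ℕ} (hb : 2 ≤ b) {e : ℕ → ℝ} {M : ℝ} (he : ∀ k, |e k| ≤ M) :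
    |bval b e| ≤ M / (b - 1) :=
  tsum_of_norm_bounded (hasSum_geometric_digits hb M) (norm_digit_le he)

lemma bval_eq_sum_add {b : ℕ} (hb : 2 ≤ b) {e : ℕ → ℝ} {M : ℝ} (he : ∀ k, |e k| ≤ M) (T : ℕ) :
    bval b e = ∑ k ∈ Finset.range T, e k / (b : ℝ) ^ (k + 1)
      + bval b (fun k => e (k + T)) / (b : ℝ) ^ T := by
  have hb' : (2 : ℝ) ≤ b := by exact_mod_cast hb
  rw [bval, ← (summable_digits hb he).sum_add_tsum_nat_add T, bval, ← tsum_div_const]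
  congr 2
  ext k
  rw [div_div, ← pow_add]
  congr 2
  ring

lemma bval_add {b : ℕ} (hb : 2 ≤ b) {e e' : ℕ → ℝ} {M M' : ℝ} (he : ∀ k, |e k| ≤ M)
    (he' : ∀ k, |e' k| ≤ M') :
    bval b (fun k => e k + e' k) = bval b e + bval b e' := by
  rw [bval, bval, bval, ← (summable_digits hb he).tsum_add (summable_digits hb he')]
  simp only [add_div]

lemma bval_const_mul (b : ℕ) (e : ℕ → ℝ) (a : ℝ) :
    bval b (fun k => a * e k) = a * bval b e := by
  rw [bval, bval, ← tsum_mul_left]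
  simp only [mul_div_assoc]

/-- Two expansions with the same first `T` digits are close. -/
lemma abs_bval_sub_le {b : ℕ} (hb : 2 ≤ b) {e e' : ℕ → ℝ} {M : ℝ} (he : ∀ k, |e k| ≤ M)
    (he' : ∀ k, |e' k| ≤ M) {T : ℕ} (h : ∀ k < T, e k = e' k) :
    |bval b e - bval b e'| ≤ 2 * M / (b : ℝ) ^ T := by
  have hb' : (2 : ℝ) ≤ b := by exact_mod_cast hb
  have hM : 0 ≤ M := (abs_nonneg _).trans (he 0)
  have key : ∀ e : ℕ → ℝ, (∀ k, |e k| ≤ M) → |bval b (fun k => e (k + T))| ≤ M := fun e he =>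
    (abs_bval_le hb fun k => he (k + T)).trans (div_le_self hM (by linarith))
  rw [bval_eq_sum_add hb he T, bval_eq_sum_add hb he' T,
    Finset.sum_congr rfl fun k hk => by rw [h k (Finset.mem_range.1 hk)],
    add_sub_add_left_eq_sub, ← sub_div, abs_div, abs_of_pos (by positivity : (0 : ℝ) < b ^ T)]
  gcongr
  linarith [abs_sub (bval b fun k => e (k + T)) (bval b fun k => e' (k + T)), key e he, key e' he']

/-- The sequence starting with `T` copies of `a` and continuing with `e`. -/
def padded (T : ℕ) (a : ℝ) (e : ℕ → ℝ) (k : ℕ) : ℝ := if k < T then a else e (k - T)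

lemma padded_mem {T : ℕ} {a : ℝ} {e : ℕ → ℝ} {V : Finset ℝ} (ha : a ∈ V) (he : ∀ k, e k ∈ V)
    (k : ℕ) : padded T a e k ∈ V := by
  rw [padded]
  split_ifs
  exacts [ha, he _]

lemma exists_abs_le_of_finset (V : Finset ℝ) : ∃ M : ℝ, ∀ v ∈ V, |v| ≤ M := by
  refine ⟨∑ v ∈ V, |v|, fun v hv => ?_⟩
  exact Finset.single_le_sum (f := fun v : ℝ => |v|) (fun _ _ => abs_nonneg _) hv

lemma bval_padded {b : ℕ} (hb : 2 ≤ b) {V : Finset ℝ} {a : ℝ} {e : ℕ → ℝ} (ha : a ∈ V)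
    (he : ∀ k, e k ∈ V) (T : ℕ) :
    bval b (padded T a e) = ∑ k ∈ Finset.range T, a / (b : ℝ) ^ (k + 1) + bval b e / (b : ℝ) ^ T := by
  obtain ⟨M, hM⟩ := exists_abs_le_of_finset V
  rw [bval_eq_sum_add hb (fun k => hM _ (padded_mem (T := T) ha he k)) T]
  congr 1
  · refine Finset.sum_congr rfl fun k hk => ?_
    rw [padded, if_pos (Finset.mem_range.1 hk)]
  · simp [padded]

/-- The natural number whose base `b` digits are `d 0, …, d (T - 1)`, most significant first. -/
def prefixNat (b : ℕ) (d : ℕ → ℕ) : ℕ → ℕ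
  | 0 => 0
  | T + 1 => b * prefixNat b d T + d T

lemma prefixNat_div {b : ℕ} {d : ℕ → ℕ} (hd : ∀ k, d k < b) (T s : ℕ) :
    prefixNat b d (T + s) / b ^ s = prefixNat b d T := by
  have hb : 0 < b := (Nat.zero_le _).trans_lt (hd 0)
  induction s with
  | zero => simp
  | succ s ih =>
    rw [← add_assoc, prefixNat, pow_succ', ← Nat.div_div_eq_div_mul, Nat.mul_add_div hb,
      Nat.div_eq_of_lt (hd _), add_zero, ih]

lemma digit_eq_of_prefixNat {b : ℕ} {d : ℕ → ℕ} (hd : ∀ k, d k < b) {k L : ℕ} (hk : k < L) :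
    d k = prefixNat b d L / b ^ (L - 1 - k) % b := by
  have h := prefixNat_div hd (k + 1) (L - 1 - k)
  rw [show k + 1 + (L - 1 - k) = L by omega] at h
  rw [h, prefixNat, Nat.mul_add_mod, Nat.mod_eq_of_lt (hd k)]

lemma abs_natCast_le_of_lt {b : ℕ} {d : ℕ → ℕ} (hd : ∀ k, d k < b) (k : ℕ) :
    |(d k : ℝ)| ≤ (b : ℝ) - 1 := by
  have : (d k : ℝ) + 1 ≤ b := by exact_mod_cast hd k
  rw [abs_of_nonneg (by positivity)]
  linarith

lemma bval_nat_mem_Icc {b : ℕ} (hb : 2 ≤ b) {d : ℕ → ℕ} (hd : ∀ k, d k < b) :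
    0 ≤ bval b (fun k => (d k : ℝ)) ∧ bval b (fun k => (d k : ℝ)) ≤ 1 := by
  have hb' : (2 : ℝ) ≤ b := by exact_mod_cast hb
  refine ⟨tsum_nonneg fun k => by positivity, ?_⟩
  have h := abs_bval_le hb (abs_natCast_le_of_lt hd)
  rw [div_self (by linarith)] at h
  exact (le_abs_self _).trans h

lemma pow_mul_bval_nat {b : ℕ} (hb : 2 ≤ b) {d : ℕ → ℕ} (hd : ∀ k, d k < b) (T : ℕ) :
    (b : ℝ) ^ T * bval b (fun k => (d k : ℝ)) =
      prefixNat b d T + bval b (fun k => (d (k + T) : ℝ)) := by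
  have hb' : (2 : ℝ) ≤ b := by exact_mod_cast hb
  induction T with
  | zero => simp [prefixNat]
  | succ T ih =>
    have h := bval_eq_sum_add hb (abs_natCast_le_of_lt fun k => hd (k + T)) 1
    simp only [Finset.sum_range_one, zero_add, pow_one, add_assoc, add_comm 1 T] at h
    rw [pow_succ', mul_assoc, ih, h, prefixNat]
    push_cast
    field_simp
    ring

/-- If `b ^ (T + 1) * x` lies strictly between consecutive integers `b * z + i` and `b * z + i + 1`,
then the digit of `x` at position `T` is `i`. -/
lemma digit_eq_of_half {b : ℕ} (hb : 2 ≤ b) {d : ℕ → ℕ} (hd : ∀ k, d k < b) {i : ℕ} (hi : i < b)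
    {T : ℕ} {z : ℤ} (h₁ : (b * z + i : ℝ) < (b : ℝ) ^ (T + 1) * bval b (fun k => (d k : ℝ)))
    (h₂ : (b : ℝ) ^ (T + 1) * bval b (fun k => (d k : ℝ)) < b * z + i + 1) : d T = i := by
  rw [pow_mul_bval_nat hb hd] at h₁ h₂
  obtain ⟨h0, h1⟩ := bval_nat_mem_Icc hb fun k => hd (k + (T + 1))
  have e₁ : (b * z + i : ℤ) < prefixNat b d (T + 1) + 1 := by
    have : (b * z + i : ℝ) < prefixNat b d (T + 1) + 1 := by linarith
    exact_mod_cast this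
  have e₂ : (prefixNat b d (T + 1) : ℤ) < b * z + i + 1 := by
    have : (prefixNat b d (T + 1) : ℝ) < b * z + i + 1 := by linarith
    exact_mod_cast this
  have e : (b * prefixNat b d T + d T : ℤ) = b * z + i := by
    have : (prefixNat b d (T + 1) : ℤ) = b * z + i := by omega
    rw [← this, prefixNat]
    push_cast
    ring
  have := congrArg (· % (b : ℤ)) e
  simp only [Int.mul_add_emod_self_left] at this
  rw [Int.emod_eq_of_lt (by positivity) (by exact_mod_cast hd T),
    Int.emod_eq_of_lt (by positivity) (by exact_mod_cast hi)] at this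
  exact_mod_cast this

/-- The numbers with a base `n` expansion `i` such that `(i k, c k) ∈ Λ` for all `k`. -/
def fibre (n : ℕ) (Λ : Finset (ℕ × ℕ)) (c : ℕ → ℕ) : Set ℝ :=
  {x | ∃ i : ℕ → ℕ, (∀ k, (i k, c k) ∈ Λ) ∧ x = bval n (fun k => (i k : ℝ))}

lemma continuous_bval {b : ℕ} (hb : 2 ≤ b) {F : Type*} [TopologicalSpace F] [DiscreteTopology F]
    {φ : F → ℝ} {M : ℝ} (hφ : ∀ a, |φ a| ≤ M) :
    Continuous fun s : ℕ → F => bval b (fun k => φ (s k)) := by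
  refine continuous_tsum (fun k => ?_) (hasSum_geometric_digits hb M).summable fun k s =>
    norm_digit_le (fun k => hφ (s k)) k
  exact ((continuous_of_discreteTopology (f := φ)).comp (continuous_apply k)).div_const _

lemma fst_lt {n m : ℕ} {Λ : Finset (ℕ × ℕ)} (hΛ : Λ ⊆ Finset.range n ×ˢ Finset.range m)
    {a : ℕ × ℕ} (ha : a ∈ Λ) : a.1 < n :=
  Finset.mem_range.1 (Finset.mem_product.1 (hΛ ha)).1

lemma snd_lt {n m : ℕ} {Λ : Finset (ℕ × ℕ)} (hΛ : Λ ⊆ Finset.range n ×ˢ Finset.range m)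
    {a : ℕ × ℕ} (ha : a ∈ Λ) : a.2 < m :=
  Finset.mem_range.1 (Finset.mem_product.1 (hΛ ha)).2

lemma isClosed_fibre {n m : ℕ} {Λ : Finset (ℕ × ℕ)} (hn : 2 ≤ n)
    (hΛ : Λ ⊆ Finset.range n ×ˢ Finset.range m) (c : ℕ → ℕ) : IsClosed (fibre n Λ c) := by
  have hcont := continuous_bval hn (F := Fin n) (φ := fun a => ((a : ℕ) : ℝ)) (M := n)
    (fun a => by rw [abs_of_nonneg (by positivity)]; exact_mod_cast a.2.le)
  have hcl : IsClosed {i : ℕ → Fin n | ∀ k, ((i k : ℕ), c k) ∈ Λ} := by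
    rw [Set.ofPred_forall]
    refine isClosed_iInter fun k => ?_
    exact IsClosed.preimage (continuous_apply (A := fun _ : ℕ => Fin n) k)
      (isClosed_discrete {a : Fin n | ((a : ℕ), c k) ∈ Λ})
  convert (hcl.isCompact.image hcont).isClosed using 1
  ext x
  constructor
  · rintro ⟨i, hi, rfl⟩
    exact ⟨fun k => ⟨i k, fst_lt hΛ (hi k)⟩, hi, rfl⟩
  · rintro ⟨i, hi, rfl⟩
    exact ⟨fun k => i k, hi, rfl⟩

lemma Ultrafilter.exists_eventually_eq {α : Type*} (U : Ultrafilter ℕ) {t : Set α} (ht : t.Finite)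
    {u : ℕ → α} (hu : ∀ᶠ L in (U : Filter ℕ), u L ∈ t) :
    ∃ v ∈ t, ∀ᶠ L in (U : Filter ℕ), u L = v := by
  refine (Ultrafilter.eventually_exists_mem_iff ht).1 ?_
  filter_upwards [hu] with L hL using ⟨u L, hL, rfl⟩

lemma Ultrafilter.exists_tendsto_of_mem_Icc (U : Ultrafilter ℕ) {a b : ℝ} {u : ℕ → ℝ}
    (hu : ∀ L, u L ∈ Set.Icc a b) :
    ∃ v ∈ Set.Icc a b, Filter.Tendsto u U (nhds v) := by
  obtain ⟨v, hv, hle⟩ := isCompact_Icc.ultrafilter_le_nhds (U.map u)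
    (Filter.le_principal_iff.2 (Filter.Eventually.of_forall hu : ∀ᶠ L in (U : Filter ℕ), _))
  exact ⟨v, hv, hle⟩

lemma tendsto_bval_of_eventually_eq {b : ℕ} (hb : 2 ≤ b) {l : Filter ℕ} {d : ℕ → ℕ → ℕ}
    {i : ℕ → ℕ} (hd : ∀ L k, d L k < b) (hi : ∀ k, i k < b) (h : ∀ k, ∀ᶠ L in l, d L k = i k) :
    Filter.Tendsto (fun L => bval b (fun k => (d L k : ℝ))) l
      (nhds (bval b (fun k => (i k : ℝ)))) := by
  have hF := continuous_bval hb (F := Fin b) (φ := fun a => ((a : ℕ) : ℝ)) (M := b)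
    (fun a => by rw [abs_of_nonneg (by positivity)]; exact_mod_cast a.2.le)
  have hT : Filter.Tendsto (fun L k => (⟨d L k, hd L k⟩ : Fin b)) l
      (nhds fun k => (⟨i k, hi k⟩ : Fin b)) := by
    refine tendsto_pi_nhds.2 fun k => ?_
    refine tendsto_const_nhds.congr' ?_
    filter_upwards [h k] with L hL
    exact Fin.ext hL.symm
  exact (hF.tendsto _).comp hT

/-- Rescaling limit: if points of the carpet have coordinates `A L + g s / m ^ L` and `B L` up to
errors of order `n ^ (-L)` and `m ^ (-L)` respectively, then an affine image of `g` is covered by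
integer translates of countably many fibres. -/
lemma exists_codes {n m : ℕ} {Λ : Finset (ℕ × ℕ)} (hm : 2 ≤ m) (hnm : m < n)
    (hΛ : Λ ⊆ Finset.range n ×ˢ Finset.range m) {S : Type*} {D : ℕ → S → ℕ → ℕ × ℕ}
    (hD : ∀ L s k, D L s k ∈ Λ) {g : S → ℝ} {A B : ℕ → ℝ} {M : ℝ} (hM : 0 ≤ M)
    (hg : ∀ s, |g s| ≤ M)
    (hx : ∀ L s, |bval n (fun k => ((D L s k).1 : ℝ)) - (A L + g s / (m : ℝ) ^ L)| ≤
      M / (n : ℝ) ^ L)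
    (hy : ∀ L s, |bval m (fun k => ((D L s k).2 : ℝ)) - B L| ≤ M / (m : ℝ) ^ L) :
    ∃ (c : ℤ → ℕ → ℕ) (σ C : ℝ), σ ≠ 0 ∧ ∀ s, ∃ r z : ℤ, C + σ * g s - z ∈ fibre n Λ (c r) := by
  have hn : 2 ≤ n := hm.trans hnm.le
  have hmR : (2 : ℝ) ≤ m := by exact_mod_cast hm
  have hnR : (2 : ℝ) ≤ n := by exact_mod_cast hn
  have hmn : (m : ℝ) < n := by exact_mod_cast hnm
  let U : Ultrafilter ℕ := Filter.hyperfilter ℕ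
  have hU : (U : Filter ℕ) ≤ Filter.atTop := Nat.hyperfilter_le_atTop
  let p : ℕ → ℕ := fun L => Nat.log n (m ^ L)
  have hp₁ : ∀ L, (n : ℝ) ^ p L ≤ (m : ℝ) ^ L := fun L => by
    exact_mod_cast Nat.pow_log_le_self n (pow_ne_zero L (by omega))
  have hp₂ : ∀ L, (m : ℝ) ^ L < (n : ℝ) ^ (p L + 1) := fun L => by
    exact_mod_cast Nat.lt_pow_succ_log_self (by omega) (m ^ L)
  have hp₃ : ∀ K, ∀ᶠ L in (U : Filter ℕ), p L + K < L := fun K => by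
    have h := (tendsto_pow_atTop_atTop_of_one_lt
      (show (1 : ℝ) < n / m by rw [one_lt_div (by linarith)]; exact hmn)).eventually_gt_atTop
        ((n : ℝ) ^ K)
    filter_upwards [hU h, hU (Filter.eventually_ge_atTop K)] with L hL hK
    have hlt : m ^ L < n ^ (L - K) := by
      rw [div_pow, lt_div_iff₀ (by positivity)] at hL
      have hL' : n ^ K * m ^ L < n ^ K * n ^ (L - K) := by
        rw [← pow_add, Nat.add_sub_cancel' hK]
        exact_mod_cast hL
      exact lt_of_mul_lt_mul_left hL' (Nat.zero_le _)
    have : p L < L - K := Nat.log_lt_of_lt_pow (pow_ne_zero L (by omega)) hlt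
    omega
  obtain ⟨σ, hσ, hσt⟩ := Ultrafilter.exists_tendsto_of_mem_Icc U (a := 1 / n) (b := 1)
    (u := fun L => (n : ℝ) ^ p L / (m : ℝ) ^ L) fun L => by
      refine ⟨?_, div_le_one_of_le₀ (hp₁ L) (by positivity)⟩
      rw [div_le_div_iff₀ (by linarith) (by positivity), one_mul, ← pow_succ]
      exact (hp₂ L).le
  obtain ⟨C, -, hCt⟩ := Ultrafilter.exists_tendsto_of_mem_Icc U (a := 0) (b := 1)
    (u := fun L => Int.fract ((n : ℝ) ^ p L * A L)) fun L =>
      ⟨Int.fract_nonneg _, (Int.fract_lt_one _).le⟩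
  let R : ℤ := ⌈2 * M + 2⌉
  have hR : 2 * M + 2 ≤ R := Int.le_ceil _
  have hmem : ∀ q : ℤ, |(q : ℝ)| ≤ 2 * M + 2 → q ∈ Set.Icc (-R) R := fun q hq => by
    have := abs_le.1 (hq.trans hR)
    exact ⟨by exact_mod_cast this.1, by exact_mod_cast this.2⟩
  have hDn : ∀ L s k, (D L s k).1 < n := fun L s k => fst_lt hΛ (hD L s k)
  have hDm : ∀ L s k, (D L s k).2 < m := fun L s k => snd_lt hΛ (hD L s k)
  -- the integer part of the rescaled vertical coordinate determines the first `L` row digits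
  let J : ℕ → ℤ → ℕ → ℕ := fun L r k =>
    (⌊(m : ℝ) ^ L * B L⌋ + r).toNat / m ^ (L - 1 - (k + p L)) % m
  have hJ : ∀ r k, ∃ v ∈ Set.Iio m, ∀ᶠ L in (U : Filter ℕ), J L r k = v := fun r k =>
    Ultrafilter.exists_eventually_eq U (Set.finite_Iio m)
      (Filter.Eventually.of_forall fun L => Nat.mod_lt _ (by omega))
  choose c _ hc using hJ
  refine ⟨c, σ, C, ne_of_gt (lt_of_lt_of_le (by positivity) hσ.1), fun s => ?_⟩
  have hr : ∃ r ∈ Set.Icc (-R) R, ∀ᶠ L in (U : Filter ℕ),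
      (prefixNat m (fun k => (D L s k).2) L : ℤ) - ⌊(m : ℝ) ^ L * B L⌋ = r := by
    refine Ultrafilter.exists_eventually_eq U (Set.finite_Icc _ _) (Filter.Eventually.of_forall fun L => ?_)
    refine hmem _ ?_
    have h₁ := pow_mul_bval_nat hm (hDm L s) L
    have h₂ := bval_nat_mem_Icc hm fun k => hDm L s (k + L)
    have h₃ : |(m : ℝ) ^ L * bval m (fun k => ((D L s k).2 : ℝ)) - (m : ℝ) ^ L * B L| ≤ M := by
      rw [← mul_sub, abs_mul, abs_of_pos (by positivity : (0 : ℝ) < (m : ℝ) ^ L)]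
      have := hy L s
      rwa [le_div_iff₀' (by positivity)] at this
    have h₄ := Int.floor_le ((m : ℝ) ^ L * B L)
    have h₅ := Int.lt_floor_add_one ((m : ℝ) ^ L * B L)
    rw [abs_le] at h₃ ⊢
    push_cast
    constructor <;> linarith [h₂.1, h₂.2, h₃.1, h₃.2]
  have hx' : ∀ L, |(prefixNat n (fun k => (D L s k).1) (p L) : ℝ)
      + bval n (fun k => ((D L s (k + p L)).1 : ℝ))
      - ((n : ℝ) ^ p L * A L + (n : ℝ) ^ p L / (m : ℝ) ^ L * g s)| ≤ M * ((m : ℝ) / n) ^ L := by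
    intro L
    rw [← pow_mul_bval_nat hn (hDn L s), mul_comm_div, div_pow,
      show ((n : ℝ) ^ p L * A L + (n : ℝ) ^ p L * (g s / (m : ℝ) ^ L))
        = (n : ℝ) ^ p L * (A L + g s / (m : ℝ) ^ L) by ring, ← mul_sub, abs_mul,
      abs_of_pos (by positivity : (0 : ℝ) < (n : ℝ) ^ p L)]
    calc _ ≤ (m : ℝ) ^ L * (M / (n : ℝ) ^ L) :=
          mul_le_mul (hp₁ L) (hx L s) (abs_nonneg _) (by positivity)
      _ = _ := by ring
  have hz : ∃ z ∈ Set.Icc (-R) R, ∀ᶠ L in (U : Filter ℕ),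
      (prefixNat n (fun k => (D L s k).1) (p L) : ℤ) - ⌊(n : ℝ) ^ p L * A L⌋ = z := by
    refine Ultrafilter.exists_eventually_eq U (Set.finite_Icc _ _) (Filter.Eventually.of_forall fun L => ?_)
    refine hmem _ ?_
    have h₂ := bval_nat_mem_Icc hn fun k => hDn L s (k + p L)
    have h₃ : |(n : ℝ) ^ p L / (m : ℝ) ^ L * g s| ≤ M := by
      rw [abs_mul, abs_of_nonneg (by positivity)]
      calc _ ≤ 1 * M := mul_le_mul (div_le_one_of_le₀ (hp₁ L) (by positivity)) (hg s)
            (abs_nonneg _) zero_le_one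
        _ = M := one_mul M
    have h₆ : M * ((m : ℝ) / n) ^ L ≤ M :=
      mul_le_of_le_one_right hM (pow_le_one₀ (by positivity)
        (div_le_one_of_le₀ hmn.le (by positivity)))
    have h₁ := (hx' L).trans h₆
    have h₄ := Int.floor_le ((n : ℝ) ^ p L * A L)
    have h₅ := Int.lt_floor_add_one ((n : ℝ) ^ p L * A L)
    rw [abs_le] at h₁ h₃ ⊢
    push_cast
    constructor <;> linarith [h₂.1, h₂.2, h₃.1, h₃.2, h₁.1, h₁.2]
  have hi : ∀ k, ∃ v ∈ Set.Iio n, ∀ᶠ L in (U : Filter ℕ), (D L s (k + p L)).1 = v := fun k =>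
    Ultrafilter.exists_eventually_eq U (Set.finite_Iio n) (Filter.Eventually.of_forall fun L => hDn L s _)
  obtain ⟨r, -, hr⟩ := hr
  obtain ⟨z, -, hz⟩ := hz
  choose i hin hi using hi
  refine ⟨r, z, i, fun k => ?_, ?_⟩
  · obtain ⟨L, h₁, h₂, h₃, h₄⟩ := (hr.and ((hi k).and ((hc r k).and (hp₃ k)))).exists
    have hrow : (D L s (k + p L)).2 = c r k := by
      rw [← h₃, digit_eq_of_prefixNat (hDm L s) (show k + p L < L by omega)]
      simp only [J]
      rw [show ⌊(m : ℝ) ^ L * B L⌋ + r = (prefixNat m (fun k => (D L s k).2) L : ℤ) by omega,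
        Int.toNat_natCast]
    rw [← h₂, ← hrow]
    exact hD L s _
  · have hlim := tendsto_bval_of_eventually_eq hn (l := U) (d := fun L k => (D L s (k + p L)).1)
      (fun L k => hDn L s _) hin hi
    have hdecay : Filter.Tendsto (fun L : ℕ => M * ((m : ℝ) / n) ^ L) U (nhds 0) := by
      have := (tendsto_pow_atTop_nhds_zero_of_lt_one (r := (m : ℝ) / n) (by positivity)
        ((div_lt_one (by linarith)).2 hmn)).const_mul M
      rw [mul_zero] at this
      exact this.mono_left hU
    have herr := squeeze_zero_norm (fun L => by rw [Real.norm_eq_abs]; exact hx' L) hdecay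
    have hsub := (((tendsto_const_nhds (x := (z : ℝ)) (f := (U : Filter ℕ))).add hlim).sub
      (hCt.add (hσt.mul_const (g s))))
    have h0 := tendsto_nhds_unique (hsub.congr' ?_) herr
    · linarith
    · filter_upwards [hz] with L hL
      rw [← hL, ← Int.self_sub_floor]
      push_cast
      ring

/-- Some translate of the set of all `bval m e` with digits `e` from `V` lies in a fibre. -/
def Embeds (n m : ℕ) (Λ : Finset (ℕ × ℕ)) (V : Finset ℝ) : Prop :=
  ∃ (c : ℕ → ℕ) (t : ℝ), ∀ e : ℕ → ℝ, (∀ k, e k ∈ V) → t + bval m e ∈ fibre n Λ c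

lemma exists_cylinder_subset {F : Type*} [TopologicalSpace F] {s₀ : ℕ → F} {Z : Set (ℕ → F)}
    (h : s₀ ∈ interior Z) : ∃ T, ∀ s : ℕ → F, (∀ k < T, s k = s₀ k) → s ∈ Z := by
  obtain ⟨I, u, hu, hsub⟩ := isOpen_pi_iff.1 isOpen_interior s₀ h
  refine ⟨I.sup id + 1, fun s hs => interior_subset (hsub fun k hk => ?_)⟩
  rw [hs k (Nat.lt_succ_of_le (Finset.le_sup (f := id) hk))]
  exact (hu k hk).2

lemma mem_carpet_of_digits {n m : ℕ} {Λ : Finset (ℕ × ℕ)} {d : ℕ → ℕ × ℕ} (hd : ∀ k, d k ∈ Λ) :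
    (bval n (fun k => ((d k).1 : ℝ)), bval m (fun k => ((d k).2 : ℝ))) ∈ BMCarpet n m Λ :=
  ⟨d, hd, rfl, rfl⟩

/-- If the carpet is mapped into itself by an affine map, then a fibre containing expansions with
digits in `V` yields a fibre containing a sum of these with a scaled copy of the row set. -/
lemma exists_sum_embedding {n m : ℕ} {Λ : Finset (ℕ × ℕ)} (hm : 2 ≤ m) (hnm : m < n)
    (hΛ : Λ ⊆ Finset.range n ×ˢ Finset.range m) {α β γ δ t₁ t₂ : ℝ}
    (hsub : ∀ x y : ℝ, (x, y) ∈ BMCarpet n m Λ →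
      (α * x + β * y + t₁, γ * x + δ * y + t₂) ∈ BMCarpet n m Λ)
    {a₀ a₁ : ℕ × ℕ} (ha₀ : a₀ ∈ Λ) (ha₁ : a₁ ∈ Λ) {V : Finset ℝ} (hV : V.Nonempty)
    (hE : Embeds n m Λ V) :
    ∃ (c : ℕ → ℕ) (C σ : ℝ), σ ≠ 0 ∧ ∀ e ε : ℕ → ℝ, (∀ k, e k ∈ V) →
      (∀ k, ε k ∈ ({0, 1} : Finset ℝ)) →
      C + σ * (α * bval m e + β * ((a₁.2 : ℝ) - a₀.2) * bval m ε) ∈ fibre n Λ c := by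
  have hn : 2 ≤ n := hm.trans hnm.le
  have hmR : (2 : ℝ) ≤ m := by exact_mod_cast hm
  have hnR : (2 : ℝ) ≤ n := by exact_mod_cast hn
  have hmn : (m : ℝ) ≤ n := by exact_mod_cast hnm.le
  obtain ⟨v₀, hv₀⟩ := hV
  obtain ⟨c, t, hc⟩ := hE
  obtain ⟨MV, hMV⟩ := exists_abs_le_of_finset V
  have hMV0 : 0 ≤ MV := (abs_nonneg _).trans (hMV v₀ hv₀)
  have hone : ∀ w ∈ ({0, 1} : Finset ℝ), |w| ≤ 1 := by
    intro w hw
    rcases Finset.mem_insert.1 hw with rfl | hw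
    · simp
    · rw [Finset.mem_singleton.1 hw]; simp
  let S := ℕ → V × ({0, 1} : Finset ℝ)
  let e : S → ℕ → ℝ := fun s k => ((s k).1 : ℝ)
  let ε : S → ℕ → ℝ := fun s k => ((s k).2 : ℝ)
  have he : ∀ s k, e s k ∈ V := fun s k => (s k).1.2
  have hε : ∀ s k, ε s k ∈ ({0, 1} : Finset ℝ) := fun s k => (s k).2.2
  have hbound : ∀ {w : ℕ → ℝ} {M : ℝ}, 0 ≤ M → (∀ k, |w k| ≤ M) → |bval m w| ≤ M :=
    fun hM hw => (abs_bval_le hm hw).trans (div_le_self hM (by linarith))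
  have hbe : ∀ s, |bval m (e s)| ≤ MV := fun s => hbound hMV0 fun k => hMV _ (he s k)
  have hbε : ∀ s, |bval m (ε s)| ≤ 1 := fun s => hbound zero_le_one fun k => hone _ (hε s k)
  choose i hi hix using fun (L : ℕ) (s : S) => hc (padded L v₀ (e s)) (padded_mem hv₀ (he s))
  let P : ℕ → S → ℕ → ℕ × ℕ := fun L s k =>
    if k < L then (i L s k, c k) else if ε s (k - L) = 1 then a₁ else a₀
  have hP : ∀ L s k, P L s k ∈ Λ := by
    intro L s k
    simp only [P]
    split_ifs
    exacts [hi L s k, ha₁, ha₀]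
  let a : ℕ → ℝ := fun L => t + ∑ k ∈ Finset.range L, v₀ / (m : ℝ) ^ (k + 1)
  let b : ℕ → ℝ := fun L => ∑ k ∈ Finset.range L, (c k : ℝ) / (m : ℝ) ^ (k + 1)
  let w₀ : ℝ := bval m (fun _ => (a₀.2 : ℝ))
  have hxP : ∀ L s, |bval n (fun k => ((P L s k).1 : ℝ)) - (a L + bval m (e s) / (m : ℝ) ^ L)| ≤
      2 * n / (n : ℝ) ^ L := by
    intro L s
    rw [show a L + bval m (e s) / (m : ℝ) ^ L = bval n (fun k => (i L s k : ℝ)) by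
      rw [← hix L s, bval_padded hm hv₀ (he s)]; simp only [a]; ring]
    refine abs_bval_sub_le hn (fun k => ?_) (fun k => ?_) fun k hk => ?_
    · exact (abs_natCast_le_of_lt (fun k => fst_lt hΛ (hP L s k)) k).trans (by linarith)
    · exact (abs_natCast_le_of_lt (fun k => fst_lt hΛ (hi L s k)) k).trans (by linarith)
    · simp only [P, if_pos hk]
  have hyP : ∀ L s, bval m (fun k => ((P L s k).2 : ℝ)) =
      b L + (w₀ + ((a₁.2 : ℝ) - a₀.2) * bval m (ε s)) / (m : ℝ) ^ L := by
    intro L s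
    rw [bval_eq_sum_add hm (abs_natCast_le_of_lt fun k => snd_lt hΛ (hP L s k)) L]
    congr 1
    · refine Finset.sum_congr rfl fun k hk => ?_
      simp only [P, if_pos (Finset.mem_range.1 hk)]
    · congr 1
      rw [← bval_const_mul, ← bval_add (M := |(a₀.2 : ℝ)|) (M' := |(a₁.2 : ℝ) - a₀.2|) hm
        (fun _ => le_rfl) (fun k => by
          rw [abs_mul]; exact mul_le_of_le_one_right (abs_nonneg _) (hone _ (hε s k)))]
      congr 1
      ext k
      simp only [P, if_neg (show ¬ k + L < L by omega), Nat.add_sub_cancel]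
      rcases Finset.mem_insert.1 (hε s k) with h | h
      · simp [h]
      · simp [Finset.mem_singleton.1 h]
  choose D hD hDx hDy using fun L s => hsub _ _ (mem_carpet_of_digits (n := n) (m := m) (hP L s))
  let h : S → ℝ := fun s => α * bval m (e s) + β * ((a₁.2 : ℝ) - a₀.2) * bval m (ε s)
  let d : ℝ := (a₁.2 : ℝ) - a₀.2
  let M : ℝ := |α| * (2 * n + MV) + |β * d| + |γ| * (2 * n + MV) + |δ| * (|w₀| + |d|)
  have hdβ : 0 ≤ |β * d| := abs_nonneg _
  have h1 : 0 ≤ |α| * (2 * n + MV) := by positivity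
  have h2 : 0 ≤ |γ| * (2 * n + MV) := by positivity
  have h3 : 0 ≤ |δ| * (|w₀| + |d|) := by positivity
  have hM : 0 ≤ M := by positivity
  let A : ℕ → ℝ := fun L => α * a L + β * (b L + w₀ / (m : ℝ) ^ L) + t₁
  let B : ℕ → ℝ := fun L => γ * a L + δ * b L + t₂
  have hgM : ∀ s, |h s| ≤ M := by
    intro s
    have h₁ : |α * bval m (e s)| ≤ |α| * MV := by
      rw [abs_mul]; exact mul_le_mul_of_nonneg_left (hbe s) (abs_nonneg _)
    have h₂ : |β * d * bval m (ε s)| ≤ |β * d| := by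
      rw [abs_mul]; exact mul_le_of_le_one_right (abs_nonneg _) (hbε s)
    have h₃ : 0 ≤ |α| * (2 * n) := by positivity
    calc |h s| ≤ |α| * MV + |β * d| := (abs_add_le _ _).trans (add_le_add h₁ h₂)
      _ ≤ M := by simp only [M]; linarith
  have hxM : ∀ L s, |bval n (fun k => ((D L s k).1 : ℝ)) - (A L + h s / (m : ℝ) ^ L)| ≤
      M / (n : ℝ) ^ L := by
    intro L s
    have hval := hDx L s
    rw [show ∑' k : ℕ, ((D L s k).1 : ℝ) / (n : ℝ) ^ (k + 1)
      = bval n (fun k => ((D L s k).1 : ℝ)) from rfl] at hval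
    simp only at hval
    rw [← hval, hyP L s, show
      α * bval n (fun k => ((P L s k).1 : ℝ)) + β * (b L +
          (w₀ + ((a₁.2 : ℝ) - a₀.2) * bval m (ε s)) / (m : ℝ) ^ L) + t₁ -
        (α * a L + β * (b L + w₀ / (m : ℝ) ^ L) + t₁ + h s / (m : ℝ) ^ L) =
      α * (bval n (fun k => ((P L s k).1 : ℝ)) - (a L + bval m (e s) / (m : ℝ) ^ L)) by
        simp only [h]; ring, abs_mul]
    calc _ ≤ |α| * (2 * n / (n : ℝ) ^ L) :=
          mul_le_mul_of_nonneg_left (hxP L s) (abs_nonneg _)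
      _ = |α| * (2 * n) / (n : ℝ) ^ L := by ring
      _ ≤ M / (n : ℝ) ^ L := by
        have h₄ : 0 ≤ |α| * MV := by positivity
        gcongr
        simp only [M]; linarith
  have hyM : ∀ L s, |bval m (fun k => ((D L s k).2 : ℝ)) - B L| ≤ M / (m : ℝ) ^ L := by
    intro L s
    have hval := hDy L s
    rw [show ∑' k : ℕ, ((D L s k).2 : ℝ) / (m : ℝ) ^ (k + 1)
      = bval m (fun k => ((D L s k).2 : ℝ)) from rfl] at hval
    simp only at hval
    have h₁ : |bval n (fun k => ((P L s k).1 : ℝ)) - a L| ≤ (2 * n + MV) / (m : ℝ) ^ L := by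
      have h₅ : |bval m (e s) / (m : ℝ) ^ L| ≤ MV / (m : ℝ) ^ L := by
        rw [abs_div, abs_of_pos (by positivity : (0 : ℝ) < (m : ℝ) ^ L)]
        gcongr
        exact hbe s
      have h₆ : 2 * n / (n : ℝ) ^ L ≤ 2 * n / (m : ℝ) ^ L := by gcongr
      have h₇ := abs_le.1 ((hxP L s).trans h₆)
      rw [add_div]
      rw [abs_le] at h₅ ⊢
      constructor <;> linarith [h₇.1, h₇.2, h₅.1, h₅.2]
    have h₂ : |(w₀ + d * bval m (ε s)) / (m : ℝ) ^ L| ≤ (|w₀| + |d|) / (m : ℝ) ^ L := by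
      rw [abs_div, abs_of_pos (by positivity : (0 : ℝ) < (m : ℝ) ^ L)]
      gcongr
      refine (abs_add_le _ _).trans (add_le_add le_rfl ?_)
      rw [abs_mul]
      exact mul_le_of_le_one_right (abs_nonneg _) (hbε s)
    rw [← hval, hyP L s, show
      γ * bval n (fun k => ((P L s k).1 : ℝ)) + δ * (b L +
          (w₀ + ((a₁.2 : ℝ) - a₀.2) * bval m (ε s)) / (m : ℝ) ^ L) + t₂ -
        (γ * a L + δ * b L + t₂) =
      γ * (bval n (fun k => ((P L s k).1 : ℝ)) - a L) +
        δ * ((w₀ + d * bval m (ε s)) / (m : ℝ) ^ L) by simp only [d]; ring]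
    calc _ ≤ |γ| * ((2 * n + MV) / (m : ℝ) ^ L) + |δ| * ((|w₀| + |d|) / (m : ℝ) ^ L) := by
          refine (abs_add_le _ _).trans (add_le_add ?_ ?_) <;> rw [abs_mul]
          · exact mul_le_mul_of_nonneg_left h₁ (abs_nonneg _)
          · exact mul_le_mul_of_nonneg_left h₂ (abs_nonneg _)
      _ = (|γ| * (2 * n + MV) + |δ| * (|w₀| + |d|)) / (m : ℝ) ^ L := by ring
      _ ≤ M / (m : ℝ) ^ L := by
        gcongr
        simp only [M]; linarith
  obtain ⟨c', σ, C, hσ, hcover⟩ := exists_codes hm hnm hΛ hD hM hgM hxM hyM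
  have hclosed : ∀ q : ℤ × ℤ, IsClosed {s : S | C + σ * h s - q.2 ∈ fibre n Λ (c' q.1)} := by
    intro q
    refine (isClosed_fibre hn hΛ (c' q.1)).preimage ?_
    have h₁ : Continuous fun s : S => bval m (e s) :=
      continuous_bval hm (φ := fun w : V × ({0, 1} : Finset ℝ) => (w.1 : ℝ))
        fun w => hMV _ w.1.2
    have h₂ : Continuous fun s : S => bval m (ε s) :=
      continuous_bval hm (φ := fun w : V × ({0, 1} : Finset ℝ) => (w.2 : ℝ))
        fun w => hone _ w.2.2
    simp only [h]
    fun_prop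
  have : Nonempty S := ⟨fun _ => (⟨v₀, hv₀⟩, ⟨0, by simp⟩)⟩
  obtain ⟨q, s₀, hs₀⟩ := nonempty_interior_of_iUnion_of_closed hclosed (by
    refine Set.eq_univ_of_forall fun s => ?_
    obtain ⟨r, z, hrz⟩ := hcover s
    exact Set.mem_iUnion.2 ⟨(r, z), hrz⟩)
  obtain ⟨T, hT⟩ := exists_cylinder_subset hs₀
  refine ⟨c' q.1, C - q.2 + σ * (α * ∑ k ∈ Finset.range T, e s₀ k / (m : ℝ) ^ (k + 1) +
    β * d * ∑ k ∈ Finset.range T, ε s₀ k / (m : ℝ) ^ (k + 1)), σ / (m : ℝ) ^ T,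
    div_ne_zero hσ (by positivity), fun e' ε' he' hε' => ?_⟩
  let s : S := fun k => if k < T then s₀ k else (⟨e' (k - T), he' _⟩, ⟨ε' (k - T), hε' _⟩)
  have hs : C + σ * h s - q.2 ∈ fibre n Λ (c' q.1) := hT s fun k hk => by simp only [s, if_pos hk]
  convert hs using 1
  simp only [h]
  rw [bval_eq_sum_add hm (fun k => hMV _ (he s k)) T,
    bval_eq_sum_add hm (fun k => hone _ (hε s k)) T,
    Finset.sum_congr rfl (f := fun k => e s k / (m : ℝ) ^ (k + 1))
      (g := fun k => e s₀ k / (m : ℝ) ^ (k + 1)) fun k hk => by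
      simp only [e, s, if_pos (Finset.mem_range.1 hk)],
    Finset.sum_congr rfl (f := fun k => ε s k / (m : ℝ) ^ (k + 1))
      (g := fun k => ε s₀ k / (m : ℝ) ^ (k + 1)) fun k hk => by
      simp only [ε, s, if_pos (Finset.mem_range.1 hk)],
    show (fun k => e s (k + T)) = e' by ext k; simp [e, s],
    show (fun k => ε s (k + T)) = ε' by ext k; simp [ε, s]]
  simp only [d]
  ring

lemma exists_pow_comparable {m : ℕ} (hm : 2 ≤ m) {x : ℝ} (hx : 0 < x) :
    ∃ T₁ T₂ : ℕ, x * (m : ℝ) ^ T₁ ≤ (m : ℝ) ^ T₂ ∧ (m : ℝ) ^ T₂ ≤ m * (x * (m : ℝ) ^ T₁) := by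
  have hmR : (1 : ℝ) < m := by exact_mod_cast hm
  rcases le_total 1 x with h | h
  · obtain ⟨k, h₁, h₂⟩ := exists_nat_pow_near h hmR
    refine ⟨0, k + 1, by simpa using h₂.le, ?_⟩
    rw [pow_succ', pow_zero, mul_one]
    gcongr
  · obtain ⟨k, h₁, h₂⟩ := exists_nat_pow_near ((one_le_inv₀ hx).2 h) hmR
    refine ⟨k, 0, ?_, ?_⟩
    · rw [le_inv_comm₀ (by positivity) hx, ← one_div, le_div_iff₀ (by positivity)] at h₁
      simpa using h₁
    · rw [inv_lt_iff_one_lt_mul₀ hx, pow_succ'] at h₂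
      rw [pow_zero]
      linarith

lemma abs_le_or_abs_sub_le {u η ρ : ℝ} (hη : |η| ≤ 2 * ρ) (hu : |u - η / 2| ≤ ρ + |η| / 2) :
    |u| ≤ ρ ∨ |u - η| ≤ ρ := by
  rcases le_or_gt |u| ρ with h | h
  · exact Or.inl h
  · refine Or.inr ?_
    rw [abs_le] at hu ⊢
    rcases le_total 0 η with h₀ | h₀
    · rw [abs_of_nonneg h₀] at hη hu
      rcases lt_abs.1 h with h | h <;> constructor <;> linarith [hu.1, hu.2]
    · rw [abs_of_nonpos h₀] at hη hu
      rcases lt_abs.1 h with h | h <;> constructor <;> linarith [hu.1, hu.2]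

/-- If a fibre contains a sum of two scaled digit sets, then the two scales can be adjusted
independently by powers of `m`. -/
lemma embeds_image_of_sum {n m : ℕ} {Λ : Finset (ℕ × ℕ)} (hm : 2 ≤ m) {V W : Finset ℝ}
    (hV : V.Nonempty) (hW : W.Nonempty) {c : ℕ → ℕ} {C κ η : ℝ}
    (h : ∀ e ε : ℕ → ℝ, (∀ k, e k ∈ V) → (∀ k, ε k ∈ W) →
      C + (κ * bval m e + η * bval m ε) ∈ fibre n Λ c) (T₁ T₂ : ℕ) :
    Embeds n m Λ ((V ×ˢ W).image fun p => κ / (m : ℝ) ^ T₁ * p.1 + η / (m : ℝ) ^ T₂ * p.2) := by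
  obtain ⟨v, hv⟩ := hV
  obtain ⟨w, hw⟩ := hW
  obtain ⟨MV, hMV⟩ := exists_abs_le_of_finset V
  obtain ⟨MW, hMW⟩ := exists_abs_le_of_finset W
  refine ⟨c, C + (κ * ∑ k ∈ Finset.range T₁, v / (m : ℝ) ^ (k + 1) +
    η * ∑ k ∈ Finset.range T₂, w / (m : ℝ) ^ (k + 1)), fun e he => ?_⟩
  choose p hp hpe using fun k => Finset.mem_image.1 (he k)
  have hp₁ : ∀ k, (p k).1 ∈ V := fun k => (Finset.mem_product.1 (hp k)).1
  have hp₂ : ∀ k, (p k).2 ∈ W := fun k => (Finset.mem_product.1 (hp k)).2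
  have key := h (padded T₁ v fun k => (p k).1) (padded T₂ w fun k => (p k).2)
    (padded_mem hv hp₁) (padded_mem hw hp₂)
  rw [bval_padded hm hv hp₁, bval_padded hm hw hp₂] at key
  convert key using 1
  rw [show e = fun k => κ / (m : ℝ) ^ T₁ * (p k).1 + η / (m : ℝ) ^ T₂ * (p k).2 from
      funext fun k => (hpe k).symm,
    bval_add (M := |κ / (m : ℝ) ^ T₁| * MV) (M' := |η / (m : ℝ) ^ T₂| * MW) hm
      (fun k => by rw [abs_mul]; exact mul_le_mul_of_nonneg_left (hMV _ (hp₁ k)) (abs_nonneg _))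
      (fun k => by rw [abs_mul]; exact mul_le_mul_of_nonneg_left (hMW _ (hp₂ k)) (abs_nonneg _)),
    bval_const_mul m (fun k => (p k).1), bval_const_mul m (fun k => (p k).2)]
  ring

lemma exists_embeds_dense {n m : ℕ} {Λ : Finset (ℕ × ℕ)} (hm : 2 ≤ m) (hnm : m < n)
    (hΛ : Λ ⊆ Finset.range n ×ˢ Finset.range m) {α β γ δ t₁ t₂ : ℝ} (hα : α ≠ 0) (hβ : β ≠ 0)
    (hsub : ∀ x y : ℝ, (x, y) ∈ BMCarpet n m Λ →
      (α * x + β * y + t₁, γ * x + δ * y + t₂) ∈ BMCarpet n m Λ)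
    {a₀ a₁ : ℕ × ℕ} (ha₀ : a₀ ∈ Λ) (ha₁ : a₁ ∈ Λ) (hne : a₀.2 ≠ a₁.2) (q : ℕ) :
    ∃ (V : Finset ℝ) (z₀ R G : ℝ), Embeds n m Λ V ∧ 0 < G ∧ (1 + q / m) * G ≤ R ∧
      ∀ z, |z - z₀| ≤ R → ∃ v ∈ V, |z - v| ≤ G := by
  have hmR : (2 : ℝ) ≤ m := by exact_mod_cast hm
  induction q with
  | zero =>
    refine ⟨{0}, 0, 1, 1, ⟨fun _ => a₀.2, bval n fun _ => (a₀.1 : ℝ), fun e he => ?_⟩, one_pos,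
      by simp, fun z hz => ⟨0, by simp, hz⟩⟩
    refine ⟨fun _ => a₀.1, fun _ => ha₀, ?_⟩
    have : e = fun _ => 0 := funext fun k => by simpa using he k
    simp [this, bval]
  | succ q ih =>
    obtain ⟨V, z₀, R, G, hE, hG, hRG, hV⟩ := ih
    have hGR : G ≤ R := by
      have : 0 ≤ (q / m : ℝ) * G := by positivity
      linarith
    have hVne : V.Nonempty := by
      obtain ⟨v, hv, -⟩ := hV z₀ (by simpa using hG.le.trans hGR)
      exact ⟨v, hv⟩
    obtain ⟨c, C, σ, hσ, hc⟩ := exists_sum_embedding hm hnm hΛ hsub ha₀ ha₁ hVne hE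
    set κ₀ := σ * α with hκ₀
    set η₀ := σ * (β * ((a₁.2 : ℝ) - a₀.2)) with hη₀
    have hκ₀ne : κ₀ ≠ 0 := mul_ne_zero hσ hα
    have hη₀ne : η₀ ≠ 0 :=
      mul_ne_zero hσ (mul_ne_zero hβ (sub_ne_zero.2 (by exact_mod_cast hne.symm)))
    have hκ₀pos := abs_pos.2 hκ₀ne
    have hη₀pos := abs_pos.2 hη₀ne
    obtain ⟨T₁, T₂, hT₁, hT₂⟩ :=
      exists_pow_comparable hm (x := |η₀| / (2 * G * |κ₀|)) (by positivity)
    have hE' := embeds_image_of_sum hm hVne (W := {0, 1}) (by simp) (C := C) (κ := κ₀) (η := η₀)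
      (fun e ε he hε => by
        have := hc e ε he hε
        rwa [mul_add, ← mul_assoc, ← mul_assoc] at this) T₁ T₂
    set κ := κ₀ / (m : ℝ) ^ T₁ with hκ
    set η := η₀ / (m : ℝ) ^ T₂ with hη
    have hκne : κ ≠ 0 := div_ne_zero hκ₀ne (by positivity)
    have hκpos := abs_pos.2 hκne
    have hκabs : |κ| = |κ₀| / (m : ℝ) ^ T₁ := by
      rw [hκ, abs_div, abs_of_pos (by positivity : (0 : ℝ) < (m : ℝ) ^ T₁)]
    have hηabs : |η| = |η₀| / (m : ℝ) ^ T₂ := by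
      rw [hη, abs_div, abs_of_pos (by positivity : (0 : ℝ) < (m : ℝ) ^ T₂)]
    have hle : |η| ≤ 2 * (|κ| * G) := by
      rw [hηabs, hκabs, div_le_iff₀ (by positivity)]
      rw [div_mul_eq_mul_div, div_le_iff₀ (by positivity)] at hT₁
      rw [show 2 * (|κ₀| / (m : ℝ) ^ T₁ * G) * (m : ℝ) ^ T₂
        = (m : ℝ) ^ T₂ * (2 * G * |κ₀|) / (m : ℝ) ^ T₁ by ring, le_div_iff₀ (by positivity)]
      exact hT₁
    have hge : 2 * (|κ| * G) ≤ m * |η| := by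
      rw [hηabs, hκabs, ← mul_div_assoc, le_div_iff₀ (by positivity)]
      rw [div_mul_eq_mul_div, ← mul_div_assoc, le_div_iff₀ (by positivity)] at hT₂
      rw [show 2 * (|κ₀| / (m : ℝ) ^ T₁ * G) * (m : ℝ) ^ T₂
        = (m : ℝ) ^ T₂ * (2 * G * |κ₀|) / (m : ℝ) ^ T₁ by ring, div_le_iff₀ (by positivity)]
      linarith
    refine ⟨_, κ * z₀ + η / 2, |κ| * R + |η| / 2, |κ| * G, hE', by positivity, ?_, fun z hz => ?_⟩
    · have h₁ : |κ| * ((1 + q / m) * G) ≤ |κ| * R := by gcongr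
      have h₂ : |κ| * G / m ≤ |η| / 2 := by
        rw [div_le_div_iff₀ (by linarith) two_pos]
        linarith
      push_cast
      calc _ = |κ| * ((1 + q / m) * G) + |κ| * G / m := by ring
        _ ≤ _ := add_le_add h₁ h₂
    · have hscale : ∀ u, |u - κ * z₀| ≤ |κ| * R → ∃ v ∈ V, |u - κ * v| ≤ |κ| * G := by
        intro u hu
        have hfac : ∀ w, u - κ * w = κ * (u / κ - w) := fun w => by field_simp
        rw [hfac, abs_mul, mul_le_mul_iff_right₀ hκpos] at hu
        obtain ⟨v, hv, hvu⟩ := hV _ hu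
        refine ⟨v, hv, ?_⟩
        rw [hfac, abs_mul]
        gcongr
      have hcase := abs_le_or_abs_sub_le (u := z - κ * z₀) (η := η) (ρ := |κ| * R)
        (hle.trans (by gcongr)) (by rwa [sub_sub])
      rcases hcase with hu | hu
      · obtain ⟨v, hv, hvz⟩ := hscale z hu
        refine ⟨_, Finset.mem_image_of_mem _ (Finset.mem_product.2
          ⟨hv, (by simp : ((v, (0 : ℝ)).2 ∈ ({0, 1} : Finset ℝ)))⟩), ?_⟩
        simpa using hvz
      · obtain ⟨v, hv, hvz⟩ := hscale (z - η) (by rwa [sub_right_comm])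
        refine ⟨_, Finset.mem_image_of_mem _ (Finset.mem_product.2
          ⟨hv, (by simp : ((v, (1 : ℝ)).2 ∈ ({0, 1} : Finset ℝ)))⟩), ?_⟩
        simp only [mul_one]
        rwa [← sub_sub, sub_right_comm]

/-- If the digit set is sufficiently dense, then every point of an interval has an expansion. -/
lemma exists_expansion {b : ℕ} (hb : 2 ≤ b) {V : Finset ℝ} {a G : ℝ}
    (h : ∀ z, |z - (b - 1) * a| ≤ b * G → ∃ v ∈ V, |z - v| ≤ G) {x : ℝ} (hx : |x - a| ≤ G) :
    ∃ e : ℕ → ℝ, (∀ k, e k ∈ V) ∧ x = bval b e := by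
  have hbR : (2 : ℝ) ≤ b := by exact_mod_cast hb
  have hstep : ∀ y : {y : ℝ // |y - a| ≤ G}, ∃ v ∈ V, |b * y.1 - v - a| ≤ G := by
    rintro ⟨y, hy⟩
    obtain ⟨v, hv, hvy⟩ := h (b * y - a) (by
      rw [show b * y - a - (b - 1) * a = b * (y - a) by ring, abs_mul, Nat.abs_cast]
      gcongr)
    exact ⟨v, hv, by rwa [sub_right_comm]⟩
  choose v hvV hv using hstep
  let next : {y : ℝ // |y - a| ≤ G} → {y : ℝ // |y - a| ≤ G} := fun y => ⟨b * y.1 - v y, hv y⟩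
  let X : ℕ → {y : ℝ // |y - a| ≤ G} := fun k => next^[k] ⟨x, hx⟩
  have hX : ∀ k, (X (k + 1)).1 = b * (X k).1 - v (X k) := fun k => by
    simp only [X, Function.iterate_succ_apply']
    rfl
  obtain ⟨M, hM⟩ := exists_abs_le_of_finset V
  refine ⟨fun k => v (X k), fun k => hvV _, ?_⟩
  have hsum : ∀ T, ∑ k ∈ Finset.range T, v (X k) / (b : ℝ) ^ (k + 1) = x - (X T).1 / (b : ℝ) ^ T := by
    intro T
    induction T with
    | zero => simp [X]
    | succ T ih =>
      rw [Finset.sum_range_succ, ih, hX, pow_succ]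
      field_simp
      ring
  have hlim := (summable_digits hb fun k => hM _ (hvV (X k))).hasSum.tendsto_sum_nat
  refine tendsto_nhds_unique ?_ hlim
  simp only [hsum]
  have h0 : Filter.Tendsto (fun T => (X T).1 / (b : ℝ) ^ T) Filter.atTop (nhds 0) := by
    have hgeo := (tendsto_pow_atTop_nhds_zero_of_lt_one (r := (b : ℝ)⁻¹) (by positivity)
      (inv_lt_one_of_one_lt₀ (by linarith))).const_mul (G + |a|)
    rw [mul_zero] at hgeo
    refine squeeze_zero_norm (fun T => ?_) hgeo
    rw [Real.norm_eq_abs, abs_div, abs_of_pos (by positivity : (0 : ℝ) < (b : ℝ) ^ T), inv_pow,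
      ← div_eq_mul_inv]
    gcongr
    have h₁ := abs_add_le ((X T).1 - a) a
    rw [sub_add_cancel] at h₁
    exact h₁.trans (add_le_add (X T).2 le_rfl)
  simpa using h0.const_sub x

lemma exists_near_digit {b : ℕ} (hb : 2 ≤ b) (i P : ℕ) (w : ℝ) :
    ∃ (z : ℤ) (y : ℝ), (b : ℝ) ^ (P + 1) * y = b * z + i + 1 / 2 ∧ |y - w| ≤ 1 / (b : ℝ) ^ P := by
  have hbR : (2 : ℝ) ≤ b := by exact_mod_cast hb
  let z : ℤ := ⌊((b : ℝ) ^ (P + 1) * w - i - 1 / 2) / b⌋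
  have h₁ := Int.floor_le (((b : ℝ) ^ (P + 1) * w - i - 1 / 2) / b)
  have h₂ := Int.lt_floor_add_one (((b : ℝ) ^ (P + 1) * w - i - 1 / 2) / b)
  rw [le_div_iff₀ (by linarith)] at h₁
  rw [div_lt_iff₀ (by linarith)] at h₂
  refine ⟨z, (b * z + i + 1 / 2) / (b : ℝ) ^ (P + 1), by field_simp, ?_⟩
  rw [show (b * z + i + 1 / 2) / (b : ℝ) ^ (P + 1) - w
      = (b * z + i + 1 / 2 - (b : ℝ) ^ (P + 1) * w) / (b : ℝ) ^ (P + 1) by field_simp,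
    abs_div, abs_of_pos (by positivity : (0 : ℝ) < (b : ℝ) ^ (P + 1)), pow_succ',
    show 1 / (b : ℝ) ^ P = b / (b * (b : ℝ) ^ P) by field_simp]
  rw [pow_succ'] at h₁ h₂
  gcongr
  rw [abs_le]
  simp only [z, pow_succ']
  constructor <;> linarith

/-- A carpet that misses a digit pair contains no segment that is neither horizontal nor
vertical. -/
lemma not_slanted_segment_subset {n m : ℕ} {Λ : Finset (ℕ × ℕ)} (hm : 2 ≤ m) (hnm : m < n)
    (hΛ : Λ ⊆ Finset.range n ×ˢ Finset.range m) {i j : ℕ} (hi : i < n) (hj : j < m)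
    (hij : (i, j) ∉ Λ) {α γ A B x₀ G : ℝ} (hα : α ≠ 0) (hγ : γ ≠ 0) (hG : 0 < G) :
    ¬ ∀ x, |x - x₀| ≤ G → (α * x + A, γ * x + B) ∈ BMCarpet n m Λ := by
  intro h
  have hn : 2 ≤ n := hm.trans hnm.le
  have hmR : (2 : ℝ) ≤ m := by exact_mod_cast hm
  have hnR : (2 : ℝ) ≤ n := by exact_mod_cast hn
  have hmn : (m : ℝ) < n := by exact_mod_cast hnm
  have hα' := abs_pos.2 hα
  have hγ' := abs_pos.2 hγ
  have geo : ∀ b : ℝ, 2 ≤ b → Filter.Tendsto (fun P : ℕ => 1 / b ^ P) Filter.atTop (nhds 0) := by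
    intro b hb
    simp_rw [← one_div_pow]
    exact tendsto_pow_atTop_nhds_zero_of_lt_one (by positivity)
      ((div_lt_one (by linarith)).2 (by linarith))
  have hratio : Filter.Tendsto (fun P : ℕ => |γ| / |α| * m * ((m : ℝ) / n) ^ P) Filter.atTop
      (nhds 0) := by
    have := (tendsto_pow_atTop_nhds_zero_of_lt_one (r := (m : ℝ) / n) (by positivity)
      ((div_lt_one (by linarith)).2 hmn)).const_mul (|γ| / |α| * m)
    rwa [mul_zero] at this
  obtain ⟨P, h₁, h₂, h₃⟩ := (((geo m hmR).eventually_lt_const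
    (show 0 < |γ| * (G / 2) by positivity)).and (((geo n hnR).eventually_lt_const
    (show 0 < |α| * (G / 2) by positivity)).and (hratio.eventually_lt_const
    (show (0 : ℝ) < 1 / 2 by norm_num)))).exists
  obtain ⟨z', y, hy, hyw⟩ := exists_near_digit hm j P (γ * x₀ + B)
  obtain ⟨x₁, rfl⟩ : ∃ x₁, y = γ * x₁ + B := ⟨(y - B) / γ, by field_simp; ring⟩
  obtain ⟨z, w, hw, hww⟩ := exists_near_digit hn i P (α * x₁ + A)
  obtain ⟨x, rfl⟩ : ∃ x, w = α * x + A := ⟨(w - A) / α, by field_simp; ring⟩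
  rw [add_sub_add_right_eq_sub, ← mul_sub, abs_mul] at hyw hww
  have hx₁ : |x₁ - x₀| < G / 2 := lt_of_mul_lt_mul_left (hyw.trans_lt h₁) hγ'.le
  have hxx₁ : |x - x₁| < G / 2 := lt_of_mul_lt_mul_left (hww.trans_lt h₂) hα'.le
  have hxG : |x - x₀| ≤ G := (abs_sub_le x x₁ x₀).trans (by linarith)
  have hsmall : |(m : ℝ) ^ (P + 1) * (γ * (x - x₁))| < 1 / 2 := by
    refine lt_of_le_of_lt ?_ h₃
    rw [abs_mul, abs_mul, abs_of_pos (by positivity : (0 : ℝ) < (m : ℝ) ^ (P + 1))]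
    rw [← le_div_iff₀' hα'] at hww
    calc (m : ℝ) ^ (P + 1) * (|γ| * |x - x₁|)
        ≤ (m : ℝ) ^ (P + 1) * (|γ| * (1 / (n : ℝ) ^ P / |α|)) := by gcongr
      _ = |γ| / |α| * m * ((m : ℝ) / n) ^ P := by rw [div_pow, pow_succ]; ring
  obtain ⟨D, hD, hDx, hDy⟩ := h x hxG
  have hDx' : α * x + A = bval n fun k => ((D k).1 : ℝ) := hDx
  have hDy' : γ * x + B = bval m fun k => ((D k).2 : ℝ) := hDy
  have hfst := digit_eq_of_half hn (fun k => fst_lt hΛ (hD k)) hi (T := P) (z := z)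
    (by rw [← hDx', hw]; linarith) (by rw [← hDx', hw]; linarith)
  have hy' : (m : ℝ) ^ (P + 1) * (γ * x + B) =
      m * z' + j + 1 / 2 + (m : ℝ) ^ (P + 1) * (γ * (x - x₁)) := by
    rw [← hy]; ring
  rw [abs_lt] at hsmall
  have hsnd := digit_eq_of_half hm (fun k => snd_lt hΛ (hD k)) hj (T := P) (z := z')
    (by rw [← hDy', hy']; linarith [hsmall.1]) (by rw [← hDy', hy']; linarith [hsmall.2])
  exact hij (by rw [← hfst, ← hsnd]; exact hD P)

/-- A similitude of the plane is affine, with linear part proportional to an orthogonal matrix. -/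
lemma IsSimilitude.exists_affine {f : ℝ × ℝ → ℝ × ℝ} {l : ℝ} (hf : IsSimilitude f l)
    (hob : Oblique f) :
    ∃ α β γ δ t₁ t₂ : ℝ, α ≠ 0 ∧ β ≠ 0 ∧ γ ≠ 0 ∧
      ∀ x y, f (x, y) = (α * x + β * y + t₁, γ * x + δ * y + t₂) := by
  have hsq : ∀ p q : ℝ × ℝ, ((f p).1 - (f q).1) ^ 2 + ((f p).2 - (f q).2) ^ 2
      = l ^ 2 * ((p.1 - q.1) ^ 2 + (p.2 - q.2) ^ 2) := fun p q => by
    have := congrArg (· ^ 2) (hf p q)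
    simpa only [mul_pow, Real.sq_sqrt (add_nonneg (sq_nonneg _) (sq_nonneg _))] using this
  obtain ⟨hα, hγ⟩ := hob
  set α := (f (1, 0)).1 - (f (0, 0)).1 with hαdef
  set γ := (f (1, 0)).2 - (f (0, 0)).2 with hγdef
  set β := (f (0, 1)).1 - (f (0, 0)).1 with hβdef
  set δ := (f (0, 1)).2 - (f (0, 0)).2 with hδdef
  have e₁ : α ^ 2 + γ ^ 2 = l ^ 2 := by have := hsq (1, 0) (0, 0); norm_num at this; linarith
  have e₂ : β ^ 2 + δ ^ 2 = l ^ 2 := by have := hsq (0, 1) (0, 0); norm_num at this; linarith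
  have e₃ : α * β + γ * δ = 0 := by
    have := hsq (1, 0) (0, 1)
    norm_num at this
    rw [show (f (1, 0)).1 - (f (0, 1)).1 = α - β by rw [hαdef, hβdef]; ring,
      show (f (1, 0)).2 - (f (0, 1)).2 = γ - δ by rw [hγdef, hδdef]; ring] at this
    nlinarith
  have hl : 0 < l ^ 2 := by rw [← e₁]; positivity
  have e₄ : δ ^ 2 = α ^ 2 := by
    have h₁ : l ^ 2 * (δ ^ 2 - α ^ 2) = 0 := by
      linear_combination (-δ ^ 2) * e₁ + α ^ 2 * e₂ - (α * β - γ * δ) * e₃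
    have := (mul_eq_zero.1 h₁).resolve_left hl.ne'
    linarith
  have e₅ : β ^ 2 = γ ^ 2 := by linarith
  have e₆ : α * γ + β * δ = 0 := by
    have h₁ : α * (α * γ + β * δ) = 0 := by
      linear_combination (-γ) * e₄ + δ * e₃
    exact (mul_eq_zero.1 h₁).resolve_left hα
  have hβ : β ≠ 0 := fun h => hγ ((pow_eq_zero_iff two_ne_zero).1 (by rw [← e₅, h]; ring))
  refine ⟨α, β, γ, δ, (f (0, 0)).1, (f (0, 0)).2, hα, hβ, hγ, fun x y => ?_⟩
  set X := (f (x, y)).1 - (f (0, 0)).1 with hX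
  set Y := (f (x, y)).2 - (f (0, 0)).2 with hY
  have d₀ : X ^ 2 + Y ^ 2 = l ^ 2 * (x ^ 2 + y ^ 2) := by
    have := hsq (x, y) (0, 0); simpa using this
  have d₁ : (X - α) ^ 2 + (Y - γ) ^ 2 = l ^ 2 * ((x - 1) ^ 2 + y ^ 2) := by
    have := hsq (x, y) (1, 0)
    rw [show (f (x, y)).1 - (f (1, 0)).1 = X - α by rw [hX, hαdef]; ring,
      show (f (x, y)).2 - (f (1, 0)).2 = Y - γ by rw [hY, hγdef]; ring] at this
    simpa using this
  have d₂ : (X - β) ^ 2 + (Y - δ) ^ 2 = l ^ 2 * (x ^ 2 + (y - 1) ^ 2) := by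
    have := hsq (x, y) (0, 1)
    rw [show (f (x, y)).1 - (f (0, 1)).1 = X - β by rw [hX, hβdef]; ring,
      show (f (x, y)).2 - (f (0, 1)).2 = Y - δ by rw [hY, hδdef]; ring] at this
    simpa using this
  have i₁ : α * X + γ * Y = l ^ 2 * x := by linarith
  have i₂ : β * X + δ * Y = l ^ 2 * y := by linarith
  have j₁ : X = α * x + β * y := by
    apply mul_left_cancel₀ hl.ne'
    linear_combination α * i₁ + β * i₂ - X * e₁ + X * (-e₅) - Y * e₆
  have j₂ : Y = γ * x + δ * y := by
    apply mul_left_cancel₀ hl.ne'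
    linear_combination γ * i₁ + δ * i₂ - Y * e₁ - Y * e₄ - X * e₆
  ext
  · simp only; linarith
  · simp only; linarith

lemma exists_ne_snd_of_not_onALine {n m : ℕ} {Λ : Finset (ℕ × ℕ)} (hΛ : Λ.Nonempty)
    (h : ¬ OnALine (BMCarpet n m Λ)) : ∃ a₀ ∈ Λ, ∃ a₁ ∈ Λ, a₀.2 ≠ a₁.2 := by
  obtain ⟨a₀, ha₀⟩ := hΛ
  by_contra! hrow
  refine h ⟨0, 1, bval m fun _ => (a₀.2 : ℝ), Or.inr one_ne_zero, ?_⟩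
  rintro p ⟨d, hd, -, hp⟩
  rw [hp, zero_mul, zero_add, one_mul, bval]
  exact tsum_congr fun k => by rw [hrow a₀ ha₀ _ (hd k)]

theorem no_oblique_self_embedding
    (n m : ℕ) (Λ : Finset (ℕ × ℕ))
    (hm : 2 ≤ m) (hnm : m < n)
    (hΛsub : Λ ⊆ Finset.range n ×ˢ Finset.range m)
    (hΛ1 : 1 < Λ.card) (hΛ2 : Λ.card < m * n)
    (hline : ¬ OnALine (BMCarpet n m Λ))
    (f : ℝ × ℝ → ℝ × ℝ) (l : ℝ) (hl : 0 < l)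
    (hf : IsSimilitude f l)
    (hsub : f '' BMCarpet n m Λ ⊆ BMCarpet n m Λ) :
    ¬ Oblique f := by
  intro hob
  have hmR : (2 : ℝ) ≤ m := by exact_mod_cast hm
  obtain ⟨α, β, γ, δ, t₁, t₂, hα, hβ, hγ, haff⟩ := hf.exists_affine hob
  have hmap : ∀ x y : ℝ, (x, y) ∈ BMCarpet n m Λ →
      (α * x + β * y + t₁, γ * x + δ * y + t₂) ∈ BMCarpet n m Λ := fun x y hxy => by
    rw [← haff]
    exact hsub ⟨_, hxy, rfl⟩
  obtain ⟨a₀, ha₀, a₁, ha₁, hne⟩ :=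
    exists_ne_snd_of_not_onALine (Finset.card_pos.1 (zero_lt_one.trans hΛ1)) hline
  obtain ⟨⟨i, j⟩, hijmem, hij⟩ : ∃ a ∈ Finset.range n ×ˢ Finset.range m, a ∉ Λ := by
    refine Finset.exists_mem_notMem_of_card_lt_card ?_
    rwa [Finset.card_product, Finset.card_range, Finset.card_range, mul_comm]
  rw [Finset.mem_product, Finset.mem_range, Finset.mem_range] at hijmem
  obtain ⟨V, z₀, R, G, ⟨c, t, hc⟩, hG, hRG, hV⟩ :=
    exists_embeds_dense hm hnm hΛsub hα hβ hmap ha₀ ha₁ hne (m * m)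
  have hmG : m * G ≤ R := by
    refine le_trans ?_ hRG
    push_cast
    rw [mul_div_assoc, div_self (by positivity), mul_one]
    linarith
  have ha : ((m : ℝ) - 1) * (z₀ / (m - 1)) = z₀ := mul_div_cancel₀ _ (by linarith)
  -- the carpet contains a horizontal segment, whose image under `f` is slanted
  refine not_slanted_segment_subset hm hnm hΛsub hijmem.1 hijmem.2 hij hα hγ hG
    (x₀ := t + z₀ / (m - 1)) (A := β * bval m (fun k => (c k : ℝ)) + t₁)
    (B := δ * bval m (fun k => (c k : ℝ)) + t₂) fun x hx => ?_
  obtain ⟨e, he, hxe⟩ := exists_expansion hm (V := V) (a := z₀ / (m - 1)) (G := G)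
    (fun z hz => hV z (by rw [ha] at hz; exact hz.trans hmG)) (x := x - t) (by rwa [sub_sub])
  obtain ⟨d, hd, hdx⟩ := hc e he
  rw [← hxe, add_sub_cancel] at hdx
  rw [← add_assoc, ← add_assoc]
  refine hmap _ _ ?_
  rw [hdx]
  exact mem_carpet_of_digits (d := fun k => (d k, c k)) hd
end

section
/- Let K = K(n,m,Λ) be a Bedford–McMullen carpet (n > m ≥ 2) with log n / log m rational, and suppose K is not contained in any affine line of ℝ². If f is a similitude on ℝ² with similarity ratio λ > 0 such that f(K) ⊆ K, then log λ / log n is rational. -/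
open scoped BigOperators

namespace BedfordMcMullen

open Set Filter Topology MeasureTheory
open scoped Pointwise

/-- The number `Σ_k d_k b^{-(k+1)}` with base-`b` digit sequence `d`. -/
noncomputable def digitSum (b : ℕ) (d : ℕ → ℕ) : ℝ := ∑' k : ℕ, (d k : ℝ) / (b : ℝ) ^ (k + 1)

/-- The integer whose base-`b` expansion consists of the first `k` digits of `d`. -/
def prefixNat (b : ℕ) (d : ℕ → ℕ) : ℕ → ℕ
  | 0 => 0
  | k + 1 => b * prefixNat b d k + d k

/-- The sequence consisting of the first `k` terms of `d` followed by `e`. -/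
def splice {α : Type*} (k : ℕ) (d e : ℕ → α) : ℕ → α := fun i => if i < k then d i else e (i - k)

/-- The numbers having a base-`b` expansion with digits in `J`. -/
def digitSet (b : ℕ) (J : Finset ℕ) : Set ℝ := {x | ∃ d : ℕ → ℕ, (∀ k, d k ∈ J) ∧ x = digitSum b d}

section DigitSum

variable {b : ℕ} {d : ℕ → ℕ}

lemma digit_term_le (hb : 2 ≤ b) {a : ℕ} (ha : a < b) (k : ℕ) :
    (a : ℝ) / (b : ℝ) ^ (k + 1) ≤ ((1 : ℝ) / b) ^ k := by
  have hb0 : (0 : ℝ) < b := by positivity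
  have : (a : ℝ) ≤ b := by exact_mod_cast ha.le
  rw [div_le_iff₀ (by positivity), one_div, inv_pow, pow_succ, ← mul_assoc,
    inv_mul_cancel₀ (by positivity), one_mul]
  exact this

lemma summable_geometric_base (hb : 2 ≤ b) : Summable fun k : ℕ => ((1 : ℝ) / b) ^ k := by
  have hb0 : (2 : ℝ) ≤ b := by exact_mod_cast hb
  apply summable_geometric_of_lt_one (by positivity)
  rw [div_lt_one (by linarith)]
  linarith

lemma summable_digits (hb : 2 ≤ b) (hd : ∀ k, d k < b) :
    Summable fun k : ℕ => (d k : ℝ) / (b : ℝ) ^ (k + 1) :=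
  Summable.of_nonneg_of_le (fun k => by positivity) (fun k => digit_term_le hb (hd k) k)
    (summable_geometric_base hb)

lemma digitSum_nonneg : 0 ≤ digitSum b d := tsum_nonneg fun k => by positivity

lemma mul_digitSum (hb : 2 ≤ b) (hd : ∀ k, d k < b) :
    (b : ℝ) * digitSum b d = d 0 + digitSum b (fun i => d (i + 1)) := by
  have hb0 : (0 : ℝ) < b := by positivity
  unfold digitSum
  rw [(summable_digits hb hd).tsum_eq_zero_add, mul_add, ← tsum_mul_left]
  congr 1
  · simp only [zero_add, pow_one]
    field_simp
  · congr 1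
    ext k
    rw [pow_succ _ (k + 1)]
    field_simp

lemma digitSum_const_pred (hb : 2 ≤ b) : digitSum b (fun _ => b - 1) = 1 := by
  have h := mul_digitSum (b := b) (d := fun _ => b - 1) hb (fun _ => by omega)
  have hb0 : (2 : ℝ) ≤ b := by exact_mod_cast hb
  rw [Nat.cast_sub (by omega), Nat.cast_one] at h
  have : ((b : ℝ) - 1) * (digitSum b (fun _ => b - 1) - 1) = 0 := by linarith
  rcases mul_eq_zero.mp this with h | h <;> linarith

lemma digitSum_le_one (hb : 2 ≤ b) (hd : ∀ k, d k < b) : digitSum b d ≤ 1 := by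
  rw [← digitSum_const_pred hb]
  refine Summable.tsum_le_tsum (fun k => ?_) (summable_digits hb hd)
    (summable_digits hb (fun _ => by omega))
  have : d k ≤ b - 1 := by have := hd k; omega
  gcongr

lemma pow_mul_digitSum (hb : 2 ≤ b) (hd : ∀ k, d k < b) (k : ℕ) :
    (b : ℝ) ^ k * digitSum b d = prefixNat b d k + digitSum b (fun i => d (i + k)) := by
  induction k with
  | zero => simp [prefixNat]
  | succ k ih =>
    have h := mul_digitSum (b := b) (d := fun i => d (i + k)) hb (fun i => hd _)
    rw [pow_succ', mul_assoc, ih, mul_add, h]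
    simp only [prefixNat, zero_add, add_assoc, add_comm 1 k]
    push_cast
    ring

lemma prefixNat_congr {e : ℕ → ℕ} {k : ℕ} (h : ∀ i < k, d i = e i) :
    prefixNat b d k = prefixNat b e k := by
  induction k with
  | zero => rfl
  | succ k ih => simp only [prefixNat]; rw [ih fun i hi => h i (by omega), h k (by omega)]

lemma prefixNat_inj {e : ℕ → ℕ} (hd : ∀ k, d k < b) (he : ∀ k, e k < b) {k : ℕ}
    (h : prefixNat b d k = prefixNat b e k) : ∀ i < k, d i = e i := by
  induction k with
  | zero => intro i hi; omega
  | succ k ih =>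
    simp only [prefixNat] at h
    have h1 : d k = e k := by
      have := congrArg (· % b) h
      simpa [Nat.mul_add_mod, Nat.mod_eq_of_lt (hd k), Nat.mod_eq_of_lt (he k)] using this
    have h2 : prefixNat b d k = prefixNat b e k := by
      rw [h1] at h
      exact Nat.eq_of_mul_eq_mul_left (Nat.zero_lt_of_lt (hd k)) (Nat.add_right_cancel h)
    intro i hi
    rcases Nat.lt_succ_iff_lt_or_eq.mp hi with hi | rfl
    · exact ih h2 i hi
    · exact h1

lemma splice_mem {α : Type*} {s : Set α} {d e : ℕ → α} (hd : ∀ i, d i ∈ s) (he : ∀ i, e i ∈ s)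
    (k i : ℕ) : splice k d e i ∈ s := by
  unfold splice
  split_ifs
  exacts [hd _, he _]

lemma splice_shift {α : Type*} (k : ℕ) (d e : ℕ → α) : (fun i => splice k d e (i + k)) = e := by
  ext i
  simp [splice]

lemma comp_splice {α β : Type*} (g : α → β) (k : ℕ) (d e : ℕ → α) :
    (fun i => g (splice k d e i)) = splice k (fun i => g (d i)) (fun i => g (e i)) := by
  ext i
  simp only [splice]
  split_ifs <;> rfl

lemma pow_mul_digitSum_splice (hb : 2 ≤ b) {e : ℕ → ℕ} (hd : ∀ k, d k < b) (he : ∀ k, e k < b)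
    (k : ℕ) : (b : ℝ) ^ k * digitSum b (splice k d e) = prefixNat b d k + digitSum b e := by
  rw [pow_mul_digitSum hb (fun i => splice_mem (s := {a | a < b}) hd he k i), splice_shift]
  congr 2
  exact prefixNat_congr fun i hi => by simp [splice, hi]

lemma exists_digits (hb : 2 ≤ b) {x : ℝ} (h0 : 0 ≤ x) (h1 : x ≤ 1) :
    ∃ d : ℕ → ℕ, (∀ k, d k < b) ∧ x = digitSum b d := by
  rcases h1.lt_or_eq with h1 | rfl
  · have : NeZero b := ⟨by omega⟩
    refine ⟨fun k => (Real.digits x b k : ℕ), fun k => (Real.digits x b k).2, ?_⟩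
    conv_lhs => rw [← Real.ofDigits_digits (b := b) (by omega) ⟨h0, h1⟩]
    simp [Real.ofDigits, Real.ofDigitsTerm, digitSum, div_eq_mul_inv]
  · exact ⟨fun _ => b - 1, fun _ => Nat.sub_lt (by omega) one_pos, (digitSum_const_pred hb).symm⟩

lemma continuousOn_digitSum (hb : 2 ≤ b) {α : Type*} [TopologicalSpace α] {s : Set α}
    {g : α → ℕ → ℕ} (hg : ContinuousOn g s) (hs : ∀ a ∈ s, ∀ k, g a k < b) :
    ContinuousOn (fun a => digitSum b (g a)) s := by
  refine continuousOn_tsum (fun i => ?_) (summable_geometric_base hb) fun k a ha => ?_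
  · have h1 : ContinuousOn (fun a => g a i) s := (continuous_apply i).comp_continuousOn hg
    have h2 : ContinuousOn (fun a => ((g a i : ℕ) : ℝ)) s :=
      continuous_of_discreteTopology.comp_continuousOn h1
    exact h2.div_const _
  · rw [Real.norm_of_nonneg (by positivity)]
    exact digit_term_le hb (hs a ha k) k

lemma isCompact_sequences {α : Type*} [TopologicalSpace α] (s : Finset α) :
    IsCompact {d : ℕ → α | ∀ k, d k ∈ s} := by
  have := isCompact_univ_pi (s := fun _ : ℕ => (s : Set α)) fun _ => s.finite_toSet.isCompact
  convert this using 1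
  ext d
  simp [Set.mem_pi]

end DigitSum

section DigitSet

variable {b : ℕ} {J : Finset ℕ}

lemma isCompact_digitSet (hb : 2 ≤ b) (hJ : ∀ j ∈ J, j < b) : IsCompact (digitSet b J) := by
  have := (isCompact_sequences J).image_of_continuousOn
    (continuousOn_digitSum (g := id) hb continuousOn_id fun d hd k => hJ _ (hd k))
  convert this using 1
  ext x
  simp [digitSet, eq_comm]

lemma digitSet_subset_Icc (hb : 2 ≤ b) (hJ : ∀ j ∈ J, j < b) : digitSet b J ⊆ Icc 0 1 := by
  rintro _ ⟨d, hd, rfl⟩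
  exact ⟨digitSum_nonneg, digitSum_le_one hb fun k => hJ _ (hd k)⟩

lemma digitSet_range (hb : 2 ≤ b) : digitSet b (Finset.range b) = Icc 0 1 := by
  refine (digitSet_subset_Icc hb (by simp)).antisymm fun x hx => ?_
  obtain ⟨d, hd, h⟩ := exists_digits hb hx.1 hx.2
  exact ⟨d, by simpa using hd, h⟩

lemma digitSum_const_mul (hb : 2 ≤ b) {j : ℕ} (hj : j < b) :
    digitSum b (fun _ => j) = j / ((b : ℝ) - 1) := by
  have h := mul_digitSum (b := b) (d := fun _ => j) hb (fun _ => hj)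
  have hb0 : (2 : ℝ) ≤ b := by exact_mod_cast hb
  rw [eq_div_iff (by linarith)]
  linarith

/-- The periodic extension of a set of reals. -/
def periodize (s : Set ℝ) : Set ℝ := s + range ((↑) : ℤ → ℝ)

lemma mem_periodize {s : Set ℝ} {x : ℝ} : x ∈ periodize s ↔ ∃ y ∈ s, ∃ z : ℤ, x = y + z := by
  simp [periodize, Set.mem_add, eq_comm]

lemma isClosed_range_intCast : IsClosed (range ((↑) : ℤ → ℝ)) :=
  Int.isClosedEmbedding_coe_real.isClosed_range

lemma isClosed_periodize {s : Set ℝ} (hs : IsCompact s) : IsClosed (periodize s) := by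
  rw [periodize, add_comm]
  exact isClosed_range_intCast.add_right_of_isCompact hs

lemma subset_periodize (s : Set ℝ) : s ⊆ periodize s := fun x hx =>
  mem_periodize.mpr ⟨x, hx, 0, by simp⟩

lemma add_int_mem_periodize {s : Set ℝ} {x : ℝ} (z : ℤ) (hx : x ∈ periodize s) :
    x + z ∈ periodize s := by
  obtain ⟨y, hy, w, rfl⟩ := mem_periodize.mp hx
  exact mem_periodize.mpr ⟨y, hy, w + z, by push_cast; ring⟩

lemma add_int_mem_periodize_iff {s : Set ℝ} {x : ℝ} (z : ℤ) :
    x + z ∈ periodize s ↔ x ∈ periodize s :=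
  ⟨fun h => by simpa using add_int_mem_periodize (-z) h, add_int_mem_periodize z⟩

lemma pow_mul_mem_periodize (hb : 2 ≤ b) (hJ : ∀ j ∈ J, j < b) (k : ℕ) {x : ℝ}
    (hx : x ∈ periodize (digitSet b J)) : (b : ℝ) ^ k * x ∈ periodize (digitSet b J) := by
  obtain ⟨y, ⟨d, hd, rfl⟩, z, rfl⟩ := mem_periodize.mp hx
  refine mem_periodize.mpr ⟨digitSum b fun i => d (i + k), ⟨_, fun i => hd _, rfl⟩,
    prefixNat b d k + b ^ k * z, ?_⟩
  rw [mul_add, pow_mul_digitSum hb (fun k => hJ _ (hd k))]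
  push_cast
  ring

/-- Around each point of `digitSet b J` and at each scale there is a cylinder, i.e. a scaled copy
of the whole set. -/
lemma exists_cylinder (hb : 2 ≤ b) (hJ : ∀ j ∈ J, j < b) (k : ℕ) {x : ℝ} (hx : x ∈ digitSet b J) :
    ∃ z : ℕ, (b : ℝ) ^ k * x - z ∈ digitSet b J ∧
      ∀ y ∈ digitSet b J, (z + y) / (b : ℝ) ^ k ∈ digitSet b J := by
  have hb0 : (0 : ℝ) < b := by positivity
  obtain ⟨d, hd, rfl⟩ := hx
  refine ⟨prefixNat b d k, ⟨fun i => d (i + k), fun i => hd _, ?_⟩, ?_⟩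
  · rw [pow_mul_digitSum hb (fun k => hJ _ (hd k))]
    ring
  · rintro _ ⟨e, he, rfl⟩
    refine ⟨splice k d e, fun i => splice_mem (s := (J : Set ℕ)) hd he k i, ?_⟩
    rw [div_eq_iff (by positivity), mul_comm,
      pow_mul_digitSum_splice hb (fun k => hJ _ (hd k)) (fun k => hJ _ (he k))]

end DigitSet

end BedfordMcMullen

namespace BedfordMcMullen

open Set Filter Topology MeasureTheory
open scoped Pointwise ENNReal

section Hausdorff

variable {b : ℕ} {J : Finset ℕ}

lemma hausdorffMeasure_le_of_cover (hb : 2 ≤ b) {N c : ℕ} {s : ℝ} (hs : 0 ≤ s) {S : Set ℝ}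
    (Z : ℕ → Finset ℤ) (hcard : ∀ k, (Z k).card ≤ c * N ^ k)
    (hS : ∀ k, ∀ x ∈ S, ∃ z ∈ Z k, (z : ℝ) ≤ (b : ℝ) ^ k * x ∧ (b : ℝ) ^ k * x ≤ z + 1) :
    μH[s] S ≤ liminf (fun k : ℕ => (c : ℝ≥0∞) * ENNReal.ofReal ((N / (b : ℝ) ^ s) ^ k)) atTop := by
  have hb0 : (2 : ℝ) ≤ b := by exact_mod_cast hb
  have hbp : (0 : ℝ) < b := by linarith
  have key := Measure.hausdorffMeasure_le_liminf_sum (ι := fun k => ↥(Z k)) s S (l := atTop)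
    (fun k => ENNReal.ofReal ((1 / (b : ℝ)) ^ k))
    (by
      rw [← ENNReal.ofReal_zero]
      refine ENNReal.tendsto_ofReal (tendsto_pow_atTop_nhds_zero_of_lt_one (by positivity) ?_)
      rw [div_lt_one hbp]
      linarith)
    (fun k z => Icc ((z : ℤ) / (b : ℝ) ^ k) (((z : ℤ) + 1) / (b : ℝ) ^ k))
    (Eventually.of_forall fun k z => by
      rw [Real.ediam_Icc]
      apply le_of_eq
      congr 1
      rw [one_div, inv_pow]
      ring)
    (Eventually.of_forall fun k x hx => by
      obtain ⟨z, hz, h1, h2⟩ := hS k x hx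
      refine mem_iUnion.mpr ⟨⟨z, hz⟩, ?_, ?_⟩
      · rw [div_le_iff₀ (by positivity)]
        linarith
      · rw [le_div_iff₀ (by positivity)]
        linarith)
  refine key.trans (liminf_le_liminf (Eventually.of_forall fun k => ?_))
  have h1 : ∀ z : ↥(Z k), Metric.ediam (Icc ((z : ℤ) / (b : ℝ) ^ k) (((z : ℤ) + 1) / (b : ℝ) ^ k)) ^ s
      = ENNReal.ofReal (((b : ℝ) ^ s)⁻¹ ^ k) := by
    intro z
    rw [Real.ediam_Icc, ENNReal.ofReal_rpow_of_nonneg (by rw [← sub_div]; simp) hs]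
    congr 1
    rw [← sub_div, add_sub_cancel_left, one_div, Real.inv_rpow (by positivity), inv_pow,
      ← Real.rpow_natCast, ← Real.rpow_natCast, ← Real.rpow_mul hbp.le, ← Real.rpow_mul hbp.le,
      mul_comm]
  simp only [h1, Finset.sum_const, Finset.card_univ, Fintype.card_coe, nsmul_eq_mul]
  rw [div_eq_mul_inv, mul_pow, ENNReal.ofReal_mul (by positivity), ← mul_assoc]
  gcongr
  rw [ENNReal.ofReal_pow (by positivity), ENNReal.ofReal_natCast]
  exact_mod_cast hcard k

lemma hausdorffMeasure_affine_image {s r : ℝ} (hs : 0 ≤ s) (hr : r ≠ 0) (t : ℝ) (S : Set ℝ) :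
    μH[s] ((fun x => r * x + t) '' S) = ENNReal.ofReal (|r| ^ s) * μH[s] S := by
  have h1 : (fun x => r * x + t) '' S = (fun x => x + t) '' (r • S) := by
    rw [← image_smul, image_image]
    rfl
  have h2 : μH[s] ((fun x => x + t) '' (r • S)) = μH[s] (r • S) :=
    (IsometryEquiv.addRight t).isometry.hausdorffMeasure_image (Or.inl hs) _
  rw [h1, h2, Measure.hausdorffMeasure_smul₀ hs hr, ENNReal.smul_def, smul_eq_mul]
  congr 1
  rw [ENNReal.coe_rpow_of_nonneg _ hs, ← ENNReal.ofReal_rpow_of_nonneg (abs_nonneg _) hs,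
    ← Real.norm_eq_abs]
  congr 1
  exact (ofReal_norm r).symm

/-- The values of the length-`k` words over `J`. -/
def words (b : ℕ) (J : Finset ℕ) : ℕ → Finset ℕ
  | 0 => {0}
  | k + 1 => Finset.image₂ (fun a j => b * a + j) (words b J k) J

lemma card_words_le (b : ℕ) (J : Finset ℕ) (k : ℕ) : (words b J k).card ≤ J.card ^ k := by
  induction k with
  | zero => simp [words]
  | succ k ih =>
    rw [words, pow_succ]
    exact (Finset.card_image₂_le _ _ _).trans (Nat.mul_le_mul_right _ ih)

lemma prefixNat_mem_words {d : ℕ → ℕ} (hd : ∀ k, d k ∈ J) (k : ℕ) :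
    prefixNat b d k ∈ words b J k := by
  induction k with
  | zero => simp [words, prefixNat]
  | succ k ih => exact Finset.mem_image₂_of_mem ih (hd k)

lemma digitSum_mem_Icc_prefix (hb : 2 ≤ b) {d : ℕ → ℕ} (hd : ∀ k, d k < b) (k : ℕ) :
    (prefixNat b d k : ℝ) ≤ (b : ℝ) ^ k * digitSum b d ∧
      (b : ℝ) ^ k * digitSum b d ≤ prefixNat b d k + 1 := by
  rw [pow_mul_digitSum hb hd]
  have h0 := digitSum_nonneg (b := b) (d := fun i => d (i + k))
  have h1 := digitSum_le_one (b := b) (d := fun i => d (i + k)) hb (fun i => hd _)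
  constructor <;> linarith

lemma rpow_logb_card (hb : 2 ≤ b) {N : ℕ} (hN : 0 < N) :
    (b : ℝ) ^ Real.logb b N = N := by
  have hb0 : (2 : ℝ) ≤ b := by exact_mod_cast hb
  exact Real.rpow_logb (by linarith) (by linarith) (by exact_mod_cast hN)

lemma logb_card_nonneg (hb : 2 ≤ b) (N : ℕ) : 0 ≤ Real.logb b N := by
  have hb0 : (2 : ℝ) ≤ b := by exact_mod_cast hb
  exact div_nonneg (Real.log_natCast_nonneg _) (Real.log_natCast_nonneg _)

lemma logb_card_pos (hb : 2 ≤ b) {N : ℕ} (hN : 2 ≤ N) : 0 < Real.logb b N := by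
  have hb0 : (2 : ℝ) ≤ b := by exact_mod_cast hb
  have hN0 : (2 : ℝ) ≤ N := by exact_mod_cast hN
  exact Real.logb_pos (by linarith) (by linarith)

lemma hausdorffMeasure_digitSet_lt_top (hb : 2 ≤ b) (hJ : ∀ j ∈ J, j < b) (hN : 0 < J.card) :
    μH[Real.logb b J.card] (digitSet b J) < ∞ := by
  have h := hausdorffMeasure_le_of_cover (N := J.card) (c := 1) hb (logb_card_nonneg hb J.card)
    (S := digitSet b J) (fun k => (words b J k).map Nat.castEmbedding)
    (fun k => by simpa using card_words_le b J k) (by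
      rintro k _ ⟨d, hd, rfl⟩
      refine ⟨prefixNat b d k, by simpa using prefixNat_mem_words hd k, ?_⟩
      simpa using digitSum_mem_Icc_prefix hb (fun k => hJ _ (hd k)) k)
  refine h.trans_lt ?_
  rw [rpow_logb_card hb hN, div_self (by positivity)]
  simp

lemma hausdorffMeasure_periodize_lt_top (hb : 2 ≤ b) (hJ : ∀ j ∈ J, j < b) (hN : 0 < J.card)
    (R : ℝ) : μH[Real.logb b J.card] (periodize (digitSet b J) ∩ Icc (-R) R) < ∞ := by
  have h : periodize (digitSet b J) ∩ Icc (-R) R ⊆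
      ⋃ z ∈ Finset.Icc (-⌈R⌉ - 1) ⌈R⌉, (fun x : ℝ => 1 * x + (z : ℤ)) '' digitSet b J := by
    rintro x ⟨hx, h1, h2⟩
    obtain ⟨y, hy, z, rfl⟩ := mem_periodize.mp hx
    have hy' := digitSet_subset_Icc hb hJ hy
    refine mem_iUnion₂.mpr ⟨z, ?_, y, hy, by simp⟩
    rw [Finset.mem_Icc]
    have hR := Int.le_ceil R
    constructor
    · have : ((-⌈R⌉ - 1 : ℤ) : ℝ) ≤ z := by push_cast; linarith [hy'.2]
      exact_mod_cast this
    · have : ((z : ℤ) : ℝ) ≤ (⌈R⌉ : ℤ) := by linarith [hy'.1]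
      exact_mod_cast this
  refine (measure_mono h).trans_lt ((measure_biUnion_finset_le _ _).trans_lt ?_)
  refine ENNReal.sum_lt_top.mpr fun z _ => ?_
  rw [hausdorffMeasure_affine_image (logb_card_nonneg hb _) one_ne_zero]
  simpa using hausdorffMeasure_digitSet_lt_top hb hJ hN

/-- The uniform Bernoulli measure on sequences in `J`. -/
noncomputable def bernoulli (J : Finset ℕ) [Nonempty J] : Measure (ℕ → J) :=
  Measure.infinitePi fun _ => (PMF.uniformOfFintype J).toMeasure

instance (J : Finset ℕ) [Nonempty J] : IsProbabilityMeasure (bernoulli J) := by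
  unfold bernoulli; infer_instance

lemma bernoulli_prefix_le [Nonempty J] (hJ : ∀ j ∈ J, j < b) (k : ℕ) (z : ℕ) :
    bernoulli J {ω | prefixNat b (fun i => ω i) k = z} ≤ ((J.card : ℝ≥0∞)⁻¹) ^ k := by
  rcases eq_empty_or_nonempty {ω : ℕ → J | prefixNat b (fun i => ω i) k = z} with h | ⟨w, hw⟩
  · simp [h]
  · have h1 : {ω : ℕ → J | prefixNat b (fun i => ω i) k = z} ⊆
        (Finset.range k : Set ℕ).pi fun i => {w i} := by
      intro ω hω i hi
      have := prefixNat_inj (fun k => hJ _ (ω k).2) (fun k => hJ _ (w k).2)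
        ((hω : _ = z).trans (hw : _ = z).symm) i (by simpa using hi)
      exact Subtype.ext this
    refine (measure_mono h1).trans ?_
    rw [bernoulli, Measure.infinitePi_pi _ (fun i _ => measurableSet_singleton _)]
    simp [PMF.uniformOfFintype_apply]

lemma continuous_coding (hb : 2 ≤ b) (hJ : ∀ j ∈ J, j < b) :
    Continuous fun ω : ℕ → J => digitSum b (fun i => ω i) := by
  rw [← continuousOn_univ]
  refine continuousOn_digitSum hb (Continuous.continuousOn ?_) fun ω _ k => hJ _ (ω k).2
  exact continuous_pi fun i => continuous_subtype_val.comp (continuous_apply i)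

lemma bernoulli_preimage_le [Nonempty J] (hb : 2 ≤ b) (hJ : ∀ j ∈ J, j < b) (k : ℕ) {S : Set ℝ}
    (hS : Metric.ediam S ≤ ENNReal.ofReal (1 / (b : ℝ) ^ k)) :
    bernoulli J ((fun ω : ℕ → J => digitSum b (fun i => ω i)) ⁻¹' S)
      ≤ 4 * ((J.card : ℝ≥0∞)⁻¹) ^ k := by
  have hbp : (0 : ℝ) < b := by positivity
  rcases S.eq_empty_or_nonempty with rfl | ⟨s, hs⟩
  · simp
  have h1 : (fun ω : ℕ → J => digitSum b (fun i => ω i)) ⁻¹' S ⊆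
      ⋃ z ∈ Finset.Icc (⌈(b : ℝ) ^ k * s⌉ - 2) (⌊(b : ℝ) ^ k * s⌋ + 1),
        {ω : ℕ → J | prefixNat b (fun i => ω i) k = z.toNat} := by
    intro ω hω
    obtain ⟨h2, h3⟩ := digitSum_mem_Icc_prefix hb (d := fun i => ω i) (fun k => hJ _ (ω k).2) k
    set x := digitSum b (fun i => ω i) with hx
    have h4 : |x - s| ≤ 1 / (b : ℝ) ^ k := by
      have := (Metric.edist_le_ediam_of_mem (show x ∈ S from hω) hs).trans hS
      rw [edist_dist, ENNReal.ofReal_le_ofReal_iff (by positivity)] at this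
      exact this
    have h5 : |(b : ℝ) ^ k * x - (b : ℝ) ^ k * s| ≤ 1 := by
      rw [← mul_sub, abs_mul, abs_of_pos (by positivity)]
      rw [le_div_iff₀ (by positivity)] at h4
      linarith
    rw [abs_le] at h5
    refine mem_iUnion₂.mpr ⟨(prefixNat b (fun i => ω i) k : ℕ), ?_, by simp⟩
    rw [Finset.mem_Icc]
    constructor
    · rw [sub_le_iff_le_add, Int.ceil_le]
      push_cast
      linarith
    · rw [← sub_le_iff_le_add, Int.le_floor]
      push_cast
      linarith
  refine (measure_mono h1).trans ((measure_biUnion_finset_le _ _).trans ?_)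
  refine (Finset.sum_le_card_nsmul _ _ _ fun z _ => bernoulli_prefix_le hJ k z.toNat).trans ?_
  rw [nsmul_eq_mul]
  gcongr
  have : ⌊(b : ℝ) ^ k * s⌋ ≤ ⌈(b : ℝ) ^ k * s⌉ := Int.floor_le_ceil _
  have h4 : (Finset.Icc (⌈(b : ℝ) ^ k * s⌉ - 2) (⌊(b : ℝ) ^ k * s⌋ + 1)).card ≤ 4 := by
    rw [Int.card_Icc]
    omega
  exact_mod_cast h4

lemma hausdorffMeasure_digitSet_pos (hb : 2 ≤ b) (hJ : ∀ j ∈ J, j < b) (hN : 2 ≤ J.card) :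
    0 < μH[Real.logb b J.card] (digitSet b J) := by
  have hbp : (0 : ℝ) < b := by positivity
  have hb1 : (1 : ℝ) < b := by exact_mod_cast hb
  have hN0 : (0 : ℝ) < J.card := by positivity
  have hβ := logb_card_pos hb hN
  set β := Real.logb b J.card with hβdef
  have hbβ : (b : ℝ) ^ β = J.card := rpow_logb_card hb (by omega)
  have : Nonempty J := (Finset.card_pos.mp (by omega)).to_subtype
  set π := fun ω : ℕ → J => digitSum b (fun i => ω i) with hπ
  have hπm : Measurable π := (continuous_coding hb hJ).measurable
  set ν := (bernoulli J).map π with hν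
  have hνle : ∀ (k : ℕ) (S : Set ℝ), Metric.ediam S ≤ ENNReal.ofReal (1 / (b : ℝ) ^ k) →
      ν S ≤ 4 * ((J.card : ℝ≥0∞)⁻¹) ^ k := by
    intro k S hS
    refine (measure_mono subset_closure).trans ?_
    rw [hν, Measure.map_apply hπm isClosed_closure.measurableSet]
    exact bernoulli_preimage_le hb hJ k (by rwa [Metric.ediam_closure])
  have hcoe : ∀ k : ℕ, ((J.card : ℝ≥0∞)⁻¹) ^ k = ENNReal.ofReal ((1 / (J.card : ℝ)) ^ k) := by
    intro k
    rw [ENNReal.ofReal_pow (by positivity), one_div, ENNReal.ofReal_inv_of_pos hN0,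
      ENNReal.ofReal_natCast]
  have hc0 : (4 * J.card : ℝ≥0∞) ≠ 0 :=
    mul_ne_zero (by norm_num) (by exact_mod_cast (by omega : J.card ≠ 0))
  have hct : (4 * J.card : ℝ≥0∞) ≠ ∞ := ENNReal.mul_ne_top (by norm_num) (ENNReal.natCast_ne_top _)
  have hle : (4 * J.card : ℝ≥0∞)⁻¹ • ν ≤ μH[β] := by
    refine Measure.le_hausdorffMeasure β _ 1 one_pos fun S hS => ?_
    rw [Measure.smul_apply, smul_eq_mul]
    have hfin : Metric.ediam S ≠ ∞ := ne_top_of_le_ne_top ENNReal.one_ne_top hS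
    set δ := (Metric.ediam S).toReal with hδ
    have hδ' : Metric.ediam S = ENNReal.ofReal δ := (ENNReal.ofReal_toReal hfin).symm
    rcases (ENNReal.toReal_nonneg : 0 ≤ δ).eq_or_lt with h0 | h0
    · have : ν S ≤ 0 := by
        have hlim : Tendsto (fun k : ℕ => 4 * ((J.card : ℝ≥0∞)⁻¹) ^ k) atTop (𝓝 (4 * 0)) := by
          refine ENNReal.Tendsto.const_mul ?_ (Or.inr (by simp))
          refine ENNReal.tendsto_pow_atTop_nhds_zero_of_lt_one ?_
          rw [ENNReal.inv_lt_one]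
          exact_mod_cast hN
        rw [mul_zero] at hlim
        refine ge_of_tendsto' hlim fun k => hνle k S ?_
        rw [hδ', show δ = 0 from h0.symm]
        simp
      rw [nonpos_iff_eq_zero.mp this]
      simp
    · have hδ1 : δ ≤ 1 := by
        rw [hδ', ← ENNReal.ofReal_one] at hS
        exact (ENNReal.ofReal_le_ofReal_iff zero_le_one).mp hS
      obtain ⟨k, hk1, hk2⟩ := exists_nat_pow_near (x := 1 / δ) (y := (b : ℝ))
        (by rw [le_div_iff₀ h0]; linarith) hb1
      have h3 := hνle k S (by
        rw [hδ']
        apply ENNReal.ofReal_le_ofReal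
        rw [le_div_iff₀ (by positivity)]
        rw [le_div_iff₀ h0] at hk1
        linarith)
      have h4 : (1 / (J.card : ℝ)) ^ k ≤ J.card * δ ^ β := by
        have h5 : ((1 : ℝ) / (b : ℝ) ^ (k + 1)) ^ β ≤ δ ^ β := by
          refine Real.rpow_le_rpow (by positivity) ?_ hβ.le
          rw [div_le_iff₀ (by positivity)]
          rw [div_lt_iff₀ h0] at hk2
          linarith
        have h6 : ((1 : ℝ) / (b : ℝ) ^ (k + 1)) ^ β = (1 / (J.card : ℝ)) ^ (k + 1) := by
          rw [one_div, one_div, Real.inv_rpow (by positivity), inv_pow, ← hbβ,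
            ← Real.rpow_natCast, ← Real.rpow_natCast, ← Real.rpow_mul hbp.le,
            ← Real.rpow_mul hbp.le, mul_comm]
        rw [h6, pow_succ] at h5
        calc (1 / (J.card : ℝ)) ^ k = J.card * ((1 / (J.card : ℝ)) ^ k * (1 / (J.card : ℝ))) := by
              rw [mul_comm _ (1 / (J.card : ℝ)), ← mul_assoc, mul_one_div_cancel hN0.ne', one_mul]
          _ ≤ _ := mul_le_mul_of_nonneg_left h5 hN0.le
      calc (4 * J.card : ℝ≥0∞)⁻¹ * ν S
          ≤ (4 * J.card : ℝ≥0∞)⁻¹ * (4 * ENNReal.ofReal (J.card * δ ^ β)) := by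
            refine mul_le_mul' le_rfl (h3.trans ?_)
            rw [hcoe]
            exact mul_le_mul' le_rfl (ENNReal.ofReal_le_ofReal h4)
        _ = Metric.ediam S ^ β := by
            rw [ENNReal.ofReal_mul hN0.le, ENNReal.ofReal_natCast, ← mul_assoc, ← mul_assoc,
              mul_assoc _ 4, ENNReal.inv_mul_cancel, one_mul, hδ',
              ENNReal.ofReal_rpow_of_nonneg h0.le hβ.le]
            · exact hc0
            · exact hct
  have h1 : ν (digitSet b J) = 1 := by
    rw [hν, Measure.map_apply hπm (isCompact_digitSet hb hJ).isClosed.measurableSet]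
    have : π ⁻¹' digitSet b J = univ := eq_univ_of_forall fun ω => ⟨_, fun k => (ω k).2, rfl⟩
    rw [this, measure_univ]
  refine lt_of_lt_of_le ?_ (hle (digitSet b J))
  rw [Measure.smul_apply, h1, smul_eq_mul, mul_one]
  exact ENNReal.inv_pos.mpr hct

end Hausdorff

end BedfordMcMullen

namespace BedfordMcMullen

open Set Filter Topology MeasureTheory
open scoped Pointwise ENNReal

section Gaps

variable {b : ℕ} {J : Finset ℕ}

lemma nontrivial_digitSet (hb : 2 ≤ b) (hJ : ∀ j ∈ J, j < b) (hN : 2 ≤ J.card) :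
    ∃ x ∈ digitSet b J, ∃ y ∈ digitSet b J, x < y := by
  obtain ⟨i, hi, j, hj, hij⟩ := Finset.one_lt_card.mp hN
  wlog h : i < j generalizing i j
  · exact this j hj i hi hij.symm (by omega)
  refine ⟨_, ⟨fun _ => i, fun _ => hi, rfl⟩, _, ⟨fun _ => j, fun _ => hj, rfl⟩, ?_⟩
  have hb0 : (2 : ℝ) ≤ b := by exact_mod_cast hb
  have h' : (i : ℝ) < j := by exact_mod_cast h
  rw [digitSum_const_mul hb (hJ i hi), digitSum_const_mul hb (hJ j hj)]
  exact div_lt_div_of_pos_right h' (by linarith)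

lemma first_digit_eq_of_near_midpoint (hb : 2 ≤ b) {d : ℕ → ℕ} (hd : ∀ k, d k < b) {j : ℕ}
    (hj : j < b) {z : ℤ} (h : |digitSum b d - z - ((j : ℝ) + 1 / 2) / b| < 1 / (2 * b)) :
    d 0 = j := by
  have hb0 : (2 : ℝ) ≤ b := by exact_mod_cast hb
  have hbp : (0 : ℝ) < b := by linarith
  have hj' : (j : ℝ) + 1 ≤ b := by exact_mod_cast hj
  have hj0 : (0 : ℝ) ≤ j := by positivity
  obtain ⟨h1, h2⟩ := abs_lt.mp h
  have h3 : ((j : ℝ) + 1 / 2) / b - 1 / (2 * b) = j / b := by field_simp; ring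
  have h4 : ((j : ℝ) + 1 / 2) / b + 1 / (2 * b) = (j + 1) / b := by field_simp; ring
  have h5 : 0 ≤ (j : ℝ) / b := by positivity
  have h6 : ((j : ℝ) + 1) / b ≤ 1 := by rwa [div_le_one hbp]
  have hs0 := digitSum_nonneg (b := b) (d := d)
  have hs1 := digitSum_le_one hb hd
  have hz : z = 0 := by
    have hz1 : ((-1 : ℤ) : ℝ) < z := by push_cast; linarith
    have hz2 : (z : ℝ) < (1 : ℤ) := by push_cast; linarith
    have hz1' : -1 < z := by exact_mod_cast hz1
    have hz2' : z < 1 := by exact_mod_cast hz2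
    omega
  rw [hz, Int.cast_zero, sub_zero] at h1 h2
  have h7 : (j : ℝ) < b * digitSum b d := by
    rw [← div_lt_iff₀' hbp]
    linarith
  have h8 : b * digitSum b d < (j : ℝ) + 1 := by
    rw [← lt_div_iff₀' hbp]
    linarith
  have h9 := mul_digitSum hb hd
  have h10 := digitSum_nonneg (b := b) (d := fun i => d (i + 1))
  have h11 := digitSum_le_one (b := b) (d := fun i => d (i + 1)) hb fun k => hd _
  have h12 : ((d 0 : ℕ) : ℝ) < (j + 1 : ℕ) := by push_cast; linarith
  have h13 : ((j : ℕ) : ℝ) < (d 0 + 1 : ℕ) := by push_cast; linarith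
  have h12' : d 0 < j + 1 := by exact_mod_cast h12
  have h13' : j < d 0 + 1 := by exact_mod_cast h13
  omega

lemma midpoint_notMem_periodize (hb : 2 ≤ b) (hJ : ∀ j ∈ J, j < b) {j : ℕ} (hjb : j < b)
    (hj : j ∉ J) : ((j : ℝ) + 1 / 2) / b ∉ periodize (digitSet b J) := by
  intro h
  obtain ⟨_, ⟨d, hd, rfl⟩, z, h⟩ := mem_periodize.mp h
  have h0 : d 0 = j := first_digit_eq_of_near_midpoint hb (fun k => hJ _ (hd k)) hjb (z := -z) (by
    rw [h, Int.cast_neg, sub_neg_eq_add, sub_self, abs_zero]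
    positivity)
  exact hj (h0 ▸ hd 0)

lemma exists_gap (hb : 2 ≤ b) (hJ : ∀ j ∈ J, j < b) (hN : 2 ≤ J.card) (hlt : J.card < b) :
    ∃ g > 0, (∃ a ∈ digitSet b J, ∀ x ∈ periodize (digitSet b J), a < x → a + g ≤ x) ∧
      ∃ c ∈ digitSet b J, ∀ x ∈ periodize (digitSet b J), x < c → x ≤ c - g := by
  obtain ⟨j, hjb, hj⟩ : ∃ j ∈ Finset.range b, j ∉ J :=
    Finset.exists_mem_notMem_of_card_lt_card (by simpa using hlt)
  have hp := midpoint_notMem_periodize hb hJ (Finset.mem_range.mp hjb) hj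
  set p := ((j : ℝ) + 1 / 2) / b
  have hcl := isClosed_periodize (isCompact_digitSet hb hJ)
  obtain ⟨x0, hx0, -⟩ := nontrivial_digitSet hb hJ hN
  have hx0 := subset_periodize _ hx0
  set E := periodize (digitSet b J) with hE
  have hlow : (E ∩ Iic p).Nonempty := by
    refine ⟨x0 + (-⌈x0 - p⌉ : ℤ), add_int_mem_periodize _ hx0, ?_⟩
    rw [mem_Iic]; push_cast
    linarith [Int.le_ceil (x0 - p)]
  have hup : (E ∩ Ici p).Nonempty := by
    refine ⟨x0 + (⌈p - x0⌉ : ℤ), add_int_mem_periodize _ hx0, ?_⟩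
    rw [mem_Ici]
    linarith [Int.le_ceil (p - x0)]
  have hbl : BddAbove (E ∩ Iic p) := ⟨p, fun x hx => hx.2⟩
  have hbu : BddBelow (E ∩ Ici p) := ⟨p, fun x hx => hx.2⟩
  have h1 := (hcl.inter isClosed_Iic).csSup_mem hlow hbl
  have h2 := (hcl.inter isClosed_Ici).csInf_mem hup hbu
  set s := sSup (E ∩ Iic p) with hs
  set t := sInf (E ∩ Ici p) with ht
  have hsp : s < p := lt_of_le_of_ne h1.2 fun h => hp (h ▸ h1.1)
  have hpt : p < t := lt_of_le_of_ne h2.2 fun h => hp (h ▸ h2.1)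
  have hgap : ∀ x ∈ E, x ≤ s ∨ t ≤ x := fun x hx => by
    rcases le_total x p with h | h
    · exact Or.inl (le_csSup hbl ⟨hx, h⟩)
    · exact Or.inr (csInf_le hbu ⟨hx, h⟩)
  obtain ⟨a, ha, z, hz⟩ := mem_periodize.mp h1.1
  obtain ⟨c, hc, w, hw⟩ := mem_periodize.mp h2.1
  refine ⟨t - s, by linarith, ⟨a, ha, fun x hx hax => ?_⟩, c, hc, fun x hx hxc => ?_⟩
  · rcases hgap _ (add_int_mem_periodize z hx) with h | h <;> linarith
  · rcases hgap _ (add_int_mem_periodize w hx) with h | h <;> linarith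

lemma measure_cylinder_pos (hb : 2 ≤ b) (hJ : ∀ j ∈ J, j < b) (hN : 2 ≤ J.card) {a ε : ℝ}
    (ha : a ∈ digitSet b J) (hε : 0 < ε) :
    ∃ Q ⊆ digitSet b J, IsCompact Q ∧ 0 < μH[Real.logb b J.card] Q ∧ ∀ x ∈ Q, |x - a| < ε := by
  have hb0 : (0 : ℝ) < b := by positivity
  obtain ⟨k, hk⟩ := exists_pow_lt_of_lt_one hε (y := 1 / (b : ℝ)) (by
    rw [div_lt_one hb0]; exact_mod_cast hb)
  obtain ⟨z, hz, hz'⟩ := exists_cylinder hb hJ k ha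
  have himg : (fun y => (1 / (b : ℝ) ^ k) * y + z / (b : ℝ) ^ k) = fun y => (z + y) / (b : ℝ) ^ k := by
    ext y; ring
  refine ⟨(fun y => (1 / (b : ℝ) ^ k) * y + z / (b : ℝ) ^ k) '' digitSet b J, ?_, ?_, ?_, ?_⟩
  · rw [himg]
    rintro _ ⟨y, hy, rfl⟩
    exact hz' y hy
  · exact (isCompact_digitSet hb hJ).image (by fun_prop)
  · rw [hausdorffMeasure_affine_image (logb_card_nonneg hb _) (by positivity)]
    have := hausdorffMeasure_digitSet_pos hb hJ hN
    refine ENNReal.mul_pos ?_ this.ne'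
    rw [ENNReal.ofReal_ne_zero_iff]
    positivity
  · rw [himg]
    rintro _ ⟨y, hy, rfl⟩
    have h1 := digitSet_subset_Icc hb hJ hy
    have h2 := digitSet_subset_Icc hb hJ hz
    have h3 : (z + y) / (b : ℝ) ^ k - a = (y - ((b : ℝ) ^ k * a - z)) / (b : ℝ) ^ k := by
      field_simp
      ring
    have hbk : (0 : ℝ) < (b : ℝ) ^ k := by positivity
    rw [one_div, inv_pow] at hk
    refine lt_of_le_of_lt ?_ hk
    rw [h3, abs_div, abs_of_pos hbk, div_le_iff₀ hbk, inv_mul_cancel₀ hbk.ne', abs_le]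
    constructor <;> linarith [h1.1, h1.2, h2.1, h2.2]

lemma exists_piece_moved_off (hb : 2 ≤ b) (hJ : ∀ j ∈ J, j < b) (hN : 2 ≤ J.card)
    (hlt : J.card < b) :
    ∃ g > 0, ∀ σ : ℝ, (σ = 1 ∨ σ = -1) → ∃ Q ⊆ digitSet b J, IsCompact Q ∧
      0 < μH[Real.logb b J.card] Q ∧ (∀ x ∈ Q, ∀ y ∈ Q, |x - y| < 1) ∧
      ∀ x ∈ Q, ∀ s, g / (3 * b) ≤ σ * s → σ * s < g → x + s ∉ periodize (digitSet b J) := by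
  have hb0 : (2 : ℝ) ≤ b := by exact_mod_cast hb
  obtain ⟨g, hg, ⟨a, ha, hga⟩, c, hc, hgc⟩ := exists_gap hb hJ hN hlt
  have hη : 0 < min (g / (3 * b)) (1 / 2) := by positivity
  have hgb : g / (3 * b) ≤ g := div_le_self hg.le (by linarith)
  refine ⟨g, hg, ?_⟩
  rintro σ (rfl | rfl)
  · obtain ⟨Q, hQ, hQc, hQp, hQd⟩ := measure_cylinder_pos hb hJ hN ha hη
    refine ⟨Q, hQ, hQc, hQp, fun x hx y hy => ?_, fun x hx s h1 h2 hE => ?_⟩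
    · have h1 := abs_lt.mp ((hQd x hx).trans_le (min_le_right _ _))
      have h2 := abs_lt.mp ((hQd y hy).trans_le (min_le_right _ _))
      rw [abs_lt]; constructor <;> linarith
    · have h3 := abs_lt.mp ((hQd x hx).trans_le (min_le_left _ _))
      have h4 : x ≤ a := by
        by_contra! h
        linarith [hga x (subset_periodize _ (hQ hx)) h]
      linarith [hga _ hE (by linarith)]
  · obtain ⟨Q, hQ, hQc, hQp, hQd⟩ := measure_cylinder_pos hb hJ hN hc hη
    refine ⟨Q, hQ, hQc, hQp, fun x hx y hy => ?_, fun x hx s h1 h2 hE => ?_⟩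
    · have h1 := abs_lt.mp ((hQd x hx).trans_le (min_le_right _ _))
      have h2 := abs_lt.mp ((hQd y hy).trans_le (min_le_right _ _))
      rw [abs_lt]; constructor <;> linarith
    · have h3 := abs_lt.mp ((hQd x hx).trans_le (min_le_left _ _))
      have h4 : c ≤ x := by
        by_contra! h
        linarith [hgc x (subset_periodize _ (hQ hx)) h]
      linarith [hgc _ hE (by linarith)]

lemma exists_digits_of_mem_words {k z : ℕ} (hJ' : J.Nonempty) (hz : z ∈ words b J k) :
    ∃ d : ℕ → ℕ, (∀ i, d i ∈ J) ∧ prefixNat b d k = z := by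
  induction k generalizing z with
  | zero =>
    obtain ⟨j, hj⟩ := hJ'
    exact ⟨fun _ => j, fun _ => hj, by simpa [words, prefixNat, eq_comm] using hz⟩
  | succ k ih =>
    obtain ⟨a, ha, j, hj, rfl⟩ := Finset.mem_image₂.mp hz
    obtain ⟨d, hd, rfl⟩ := ih ha
    refine ⟨splice k d fun _ => j, splice_mem (s := (J : Set ℕ)) hd (fun _ => hj) k, ?_⟩
    simp only [prefixNat]
    rw [prefixNat_congr (e := d) fun i hi => by simp [splice, hi]]
    simp [splice]

lemma card_words (hJ : ∀ j ∈ J, j < b) (k : ℕ) :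
    (words b J k).card = J.card ^ k := by
  induction k with
  | zero => simp [words]
  | succ k ih =>
    rw [words, pow_succ, ← ih]
    refine Finset.card_image₂_iff.mpr ?_
    rintro ⟨x, i⟩ ⟨-, hi⟩ ⟨y, j⟩ ⟨-, hj⟩ h
    simp only at h
    have hi' := hJ i hi
    have hj' := hJ j hj
    have h1 : (b * x + i) / b = (b * y + j) / b := by rw [h]
    rw [Nat.mul_add_div (by omega), Nat.mul_add_div (by omega), Nat.div_eq_of_lt hi',
      Nat.div_eq_of_lt hj'] at h1
    have h2 : x = y := by omega
    subst h2
    simp only [Prod.mk.injEq, true_and]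
    omega

lemma word_add_div_mem (hb : 2 ≤ b) (hJ : ∀ j ∈ J, j < b) {k z : ℕ} (hz : z ∈ words b J k)
    {y : ℝ} (hy : y ∈ digitSet b J) : (z + y) / (b : ℝ) ^ k ∈ digitSet b J := by
  have hb0 : (0 : ℝ) < b := by positivity
  obtain ⟨e, he, rfl⟩ := hy
  obtain ⟨d, hd, rfl⟩ := exists_digits_of_mem_words ⟨_, he 0⟩ hz
  refine ⟨splice k d e, splice_mem (s := (J : Set ℕ)) hd he k, ?_⟩
  rw [div_eq_iff (by positivity), ← pow_mul_digitSum_splice hb (fun i => hJ _ (hd i))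
    (fun i => hJ _ (he i)), mul_comm]

lemma measure_moved_off_ge (hb : 2 ≤ b) (hJ : ∀ j ∈ J, j < b) (hN : 2 ≤ J.card)
    (hlt : J.card < b) :
    ∃ c : ℝ≥0∞, 0 < c ∧ ∃ δ > 0, ∀ p q : ℝ, |p| < δ → |q| < δ → (p ≠ 0 ∨ q ≠ 0) →
      c ≤ μH[Real.logb b J.card] {x ∈ digitSet b J | x + (p * x + q) ∉ periodize (digitSet b J)} := by
  have hb0 : (2 : ℝ) ≤ b := by exact_mod_cast hb
  have hbp : (0 : ℝ) < b := by linarith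
  have hN0 : (0 : ℝ) < J.card := by positivity
  obtain ⟨g, hg, hQ⟩ := exists_piece_moved_off hb hJ hN hlt
  obtain ⟨Q₁, hQ₁⟩ := hQ 1 (Or.inl rfl)
  obtain ⟨Q₂, hQ₂⟩ := hQ (-1) (Or.inr rfl)
  obtain ⟨x0, hx0, x1, hx1, h01⟩ := nontrivial_digitSet hb hJ hN
  set β := Real.logb b J.card with hβ
  have hbβ : (b : ℝ) ^ β = J.card := rpow_logb_card hb (by omega)
  obtain ⟨v, hv⟩ := exists_pow_lt_of_lt_one (show 0 < (x1 - x0) / 8 by linarith)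
    (y := 1 / (b : ℝ)) (by rw [div_lt_one hbp]; linarith)
  rw [one_div, inv_pow] at hv
  have hbv : (0 : ℝ) < (b : ℝ) ^ v := by positivity
  refine ⟨ENNReal.ofReal ((1 / (J.card : ℝ)) ^ v) * min (μH[β] Q₁) (μH[β] Q₂), ?_,
    g / (3 * b ^ v), by positivity, fun p q hp hq hpq => ?_⟩
  · refine ENNReal.mul_pos ?_ (lt_min hQ₁.2.2.1 hQ₂.2.2.1).ne'
    rw [ENNReal.ofReal_ne_zero_iff]
    positivity
  obtain ⟨x, hx, hB0, hpB⟩ : ∃ x ∈ digitSet b J, p * x + q ≠ 0 ∧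
      |p| * (x1 - x0) ≤ 2 * |p * x + q| := by
    have habs : |p| * (x1 - x0) ≤ |p * x0 + q| + |p * x1 + q| := by
      rw [← abs_of_pos (show 0 < x1 - x0 by linarith), ← abs_mul]
      have := abs_sub (p * x1 + q) (p * x0 + q)
      rw [show p * (x1 - x0) = (p * x1 + q) - (p * x0 + q) by ring]
      linarith
    have hne : p * x0 + q ≠ 0 ∨ p * x1 + q ≠ 0 := by
      by_contra! h
      have h1 : p * (x1 - x0) = 0 := by linarith [h.1, h.2]
      have h2 : p = 0 := (mul_eq_zero.mp h1).resolve_right (by linarith)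
      have h3 := h.1
      rw [h2, zero_mul, zero_add] at h3
      exact hpq.elim (fun h => h h2) (fun h => h h3)
    rcases le_total |p * x0 + q| |p * x1 + q| with h | h
    · refine ⟨x1, hx1, fun h0 => ?_, by linarith⟩
      rw [h0, abs_zero, abs_nonpos_iff] at h
      exact hne.elim (fun k => k h) (fun k => k h0)
    · refine ⟨x0, hx0, fun h0 => ?_, by linarith⟩
      rw [h0, abs_zero, abs_nonpos_iff] at h
      exact hne.elim (fun k => k h0) (fun k => k h)
  have hx01 := digitSet_subset_Icc hb hJ hx
  set B := |p * x + q| with hB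
  have hBpos : 0 < B := abs_pos.mpr hB0
  have hBlt : B ≤ 2 * (g / (3 * b ^ v)) := by
    have h1 : B ≤ |p * x| + |q| := abs_add_le _ _
    have h2 : |p * x| ≤ |p| := by
      rw [abs_mul, abs_of_nonneg hx01.1]
      exact mul_le_of_le_one_right (abs_nonneg _) hx01.2
    linarith
  obtain ⟨l, hl1, hl2⟩ := exists_nat_pow_near (x := g / (b ^ v * (3 * B / 2))) (y := (b : ℝ))
    (by
      rw [le_div_iff₀ (by positivity), one_mul]
      have : (b : ℝ) ^ v * (3 * (2 * (g / (3 * b ^ v))) / 2) = g := by field_simp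
      calc (b : ℝ) ^ v * (3 * B / 2) ≤ (b : ℝ) ^ v * (3 * (2 * (g / (3 * b ^ v))) / 2) := by gcongr
        _ = g := this) (by linarith)
  rw [le_div_iff₀ (by positivity)] at hl1
  rw [div_lt_iff₀ (by positivity), pow_succ] at hl2
  have hbl : (0 : ℝ) < (b : ℝ) ^ l := by positivity
  obtain ⟨σ, hσ, hσB⟩ : ∃ σ : ℝ, (σ = 1 ∨ σ = -1) ∧ σ * (p * x + q) = B := by
    rcases abs_choice (p * x + q) with h | h
    · exact ⟨1, Or.inl rfl, by rw [one_mul, hB, h]⟩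
    · exact ⟨-1, Or.inr rfl, by rw [hB, h]; ring⟩
  have hσa : |σ| = 1 := by rcases hσ with rfl | rfl <;> simp
  obtain ⟨Q, hQC, hQc, hQm, hQd, hQs⟩ : ∃ Q ⊆ digitSet b J, IsCompact Q ∧
      min (μH[β] Q₁) (μH[β] Q₂) ≤ μH[β] Q ∧ (∀ x ∈ Q, ∀ y ∈ Q, |x - y| < 1) ∧
      ∀ x ∈ Q, ∀ s, g / (3 * b) ≤ σ * s → σ * s < g → x + s ∉ periodize (digitSet b J) := by
    rcases hσ with rfl | rfl
    · exact ⟨Q₁, hQ₁.1, hQ₁.2.1, min_le_left _ _, hQ₁.2.2.2⟩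
    · exact ⟨Q₂, hQ₂.1, hQ₂.2.1, min_le_right _ _, hQ₂.2.2.2⟩
  obtain ⟨z, hz, hz'⟩ := exists_cylinder hb hJ v hx
  set φ : ℕ → ℝ → ℝ := fun w y => (1 / ((b : ℝ) ^ v * b ^ l)) * y + (w / b ^ l + z) / b ^ v with hφ
  have hφ' : ∀ w y, φ w y = (z + (w + y) / b ^ l) / (b : ℝ) ^ v := by
    intro w y
    simp only [hφ]
    field_simp
    ring
  have hφb : ∀ w y, (b : ℝ) ^ (v + l) * φ w y = y + w + b ^ l * z := by
    intro w y
    rw [hφ', pow_add]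
    field_simp
    ring
  have hφi : ∀ w w' : ℕ, ∀ y ∈ Q, ∀ y' ∈ Q, φ w y = φ w' y' → w = w' := by
    intro w w' y hy y' hy' h
    have h1 := hφb w y
    rw [h, hφb] at h1
    have h2 := abs_lt.mp (hQd y hy y' hy')
    have h3 : ((w : ℕ) : ℝ) < (w' + 1 : ℕ) := by push_cast; linarith
    have h4 : ((w' : ℕ) : ℝ) < (w + 1 : ℕ) := by push_cast; linarith
    have h3' : w < w' + 1 := by exact_mod_cast h3
    have h4' : w' < w + 1 := by exact_mod_cast h4
    omega
  have hsub : (⋃ w ∈ words b J l, φ w '' Q) ⊆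
      {x ∈ digitSet b J | x + (p * x + q) ∉ periodize (digitSet b J)} := by
    intro y' hy'
    obtain ⟨w, hw, y, hy, rfl⟩ := mem_iUnion₂.mp hy'
    have hwy := word_add_div_mem hb hJ hw (hQC hy)
    have hmem : φ w y ∈ digitSet b J := by
      rw [hφ']
      exact hz' _ hwy
    refine ⟨hmem, fun hE => ?_⟩
    have h1 := pow_mul_mem_periodize hb hJ (v + l) hE
    rw [mul_add, hφb, add_right_comm, add_right_comm y] at h1
    have h2 : (w : ℝ) + (b : ℝ) ^ l * z = ((w + b ^ l * z : ℤ) : ℝ) := by push_cast; ring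
    rw [add_assoc, h2, add_int_mem_periodize_iff] at h1
    have h3 : |φ w y - x| ≤ (x1 - x0) / 8 := by
      refine le_trans ?_ hv.le
      rw [hφ', show (z + (w + y) / (b : ℝ) ^ l) / (b : ℝ) ^ v - x
        = ((w + y) / (b : ℝ) ^ l - ((b : ℝ) ^ v * x - z)) / (b : ℝ) ^ v by field_simp; ring,
        abs_div, abs_of_pos hbv, div_le_iff₀ hbv, inv_mul_cancel₀ hbv.ne', abs_le]
      have h4 := digitSet_subset_Icc hb hJ hwy
      have h5 := digitSet_subset_Icc hb hJ hz
      constructor <;> linarith [h4.1, h4.2, h5.1, h5.2]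
    have h4 : |p * (φ w y - x)| ≤ B / 4 := by
      rw [abs_mul]
      calc |p| * |φ w y - x| ≤ |p| * ((x1 - x0) / 8) := by gcongr
        _ ≤ B / 4 := by linarith
    have h5 : |σ * (p * (φ w y - x))| ≤ B / 4 := by rwa [abs_mul, hσa, one_mul]
    have h6 : σ * (p * φ w y + q) = B + σ * (p * (φ w y - x)) := by rw [← hσB]; ring
    rw [abs_le] at h5
    have h7 : 3 * B / 4 ≤ σ * (p * φ w y + q) := by linarith [h5.1]
    have h8 : σ * (p * φ w y + q) ≤ 5 * B / 4 := by linarith [h5.2]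
    have hbvl : (0 : ℝ) < (b : ℝ) ^ (v + l) := by positivity
    have hbvl' : (b : ℝ) ^ (v + l) = b ^ v * b ^ l := pow_add _ _ _
    refine hQs y hy _ ?_ ?_ h1
    · rw [div_le_iff₀ (by positivity)]
      have : (b : ℝ) ^ (v + l) * (3 * B / 4) ≤ (b : ℝ) ^ (v + l) * (σ * (p * φ w y + q)) := by gcongr
      have h9 : (b : ℝ) ^ (v + l) * (3 * B / 4) * (3 * b)
          ≤ (b : ℝ) ^ (v + l) * (σ * (p * φ w y + q)) * (3 * b) := by gcongr
      have h10 : 0 < (b : ℝ) ^ (v + l) * B * b := by positivity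
      have h11 : (b : ℝ) ^ l * b * (b ^ v * (3 * B / 2)) = 3 / 2 * ((b : ℝ) ^ (v + l) * B * b) := by
        rw [hbvl']; ring
      linarith
    · have : (b : ℝ) ^ (v + l) * (σ * (p * φ w y + q)) ≤ (b : ℝ) ^ (v + l) * (5 * B / 4) := by gcongr
      have h10 : 0 < (b : ℝ) ^ (v + l) * B := by positivity
      have h11 : (b : ℝ) ^ l * (b ^ v * (3 * B / 2)) = 3 / 2 * ((b : ℝ) ^ (v + l) * B) := by
        rw [hbvl']; ring
      linarith
  refine le_trans ?_ (measure_mono hsub)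
  have hr0 : (0 : ℝ) < 1 / ((b : ℝ) ^ v * b ^ l) := by positivity
  rw [measure_biUnion_finset]
  · have hmeas : ∀ w, μH[β] (φ w '' Q) = ENNReal.ofReal ((1 / (J.card : ℝ)) ^ (v + l)) * μH[β] Q := by
      intro w
      rw [hausdorffMeasure_affine_image (s := β) (logb_card_nonneg hb _) hr0.ne', abs_of_pos hr0, ← pow_add,
        one_div, Real.inv_rpow (by positivity), one_div, inv_pow, ← hbβ, ← Real.rpow_natCast,
        ← Real.rpow_natCast, ← Real.rpow_mul hbp.le, ← Real.rpow_mul hbp.le, mul_comm β]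
    simp only [hmeas]
    rw [Finset.sum_const, card_words hJ, nsmul_eq_mul, ← mul_assoc]
    refine mul_le_mul' (le_of_eq ?_) hQm
    rw [← ENNReal.ofReal_natCast, ← ENNReal.ofReal_mul (by positivity)]
    congr 1
    push_cast
    rw [pow_add, mul_left_comm, ← mul_pow, mul_one_div_cancel hN0.ne', one_pow, mul_one]
  · intro w _ w' _ hww'
    rw [Function.onFun, Set.disjoint_left]
    rintro _ ⟨y, hy, rfl⟩ ⟨y', hy', h⟩
    exact hww' (hφi _ _ y hy y' hy' h.symm)
  · intro w _
    exact (hQc.image (by simp only [hφ]; fun_prop)).isClosed.measurableSet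

end Gaps

end BedfordMcMullen

namespace BedfordMcMullen

open Set Filter Topology MeasureTheory
open scoped Pointwise ENNReal

section Rigidity

variable {b : ℕ} {J : Finset ℕ}

/-- Affine embeddings of a digit set into its periodization do not accumulate anywhere outside
`r = 0`. -/
lemma affine_embedding_isolated (hb : 2 ≤ b) (hJ : ∀ j ∈ J, j < b) (hN : 2 ≤ J.card)
    (hlt : J.card < b) {r t : ℝ} (hr : r ≠ 0) :
    ∃ ε > 0, ∀ r' t' : ℝ, |r' - r| < ε → |t' - t| < ε →
      (∀ x ∈ digitSet b J, r' * x + t' ∈ periodize (digitSet b J)) → r' = r ∧ t' = t := by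
  obtain ⟨c, hc, δ, hδ, hmove⟩ := measure_moved_off_ge hb hJ hN hlt
  have hβ0 := logb_card_nonneg hb J.card
  have hfin := hausdorffMeasure_periodize_lt_top hb hJ (by omega : 0 < J.card) (|r| + |t| + 2)
  set β := Real.logb b J.card
  set C := digitSet b J with hC
  set E := periodize C with hEdef
  set I := Icc (-(|r| + |t| + 2)) (|r| + |t| + 2) with hI
  have hCc : IsCompact C := isCompact_digitSet hb hJ
  set A := (fun x => r * x + t) '' C with hA
  have hAc : IsCompact A := hCc.image (by fun_prop)
  set μ := (μH[β] : Measure ℝ).restrict (E ∩ I) with hμ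
  have : IsFiniteMeasure μ := isFiniteMeasure_restrict.mpr hfin.ne
  have hr2 : 0 < |r| / 2 := by positivity
  have hc' : ENNReal.ofReal ((|r| / 2) ^ β) * c ≠ 0 :=
    (ENNReal.mul_pos (ENNReal.ofReal_ne_zero_iff.mpr (by positivity)) hc.ne').ne'
  obtain ⟨U, hAU, hUo, hU⟩ := A.exists_isOpen_lt_add (measure_ne_top μ A) hc'
  obtain ⟨δ', hδ', hthick⟩ := hAc.exists_thickening_subset_open hUo hAU
  refine ⟨min (min 1 (|r| / 2)) (min (δ * |r|) (δ' / 2)), by positivity, fun r' t' hr' ht' hE' => ?_⟩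
  simp only [lt_min_iff] at hr' ht'
  by_contra hne
  have hr'2 : |r| / 2 ≤ |r'| := by
    have := abs_sub_abs_le_abs_sub r r'
    rw [abs_sub_comm] at this
    linarith [hr'.1.2]
  have hr'0 : r' ≠ 0 := abs_pos.mp (hr2.trans_le hr'2)
  set A' := (fun x => r' * x + t') '' C with hA'
  have hA'c : IsCompact A' := hCc.image (by fun_prop)
  have hdist : ∀ x ∈ C, |r' * x + t' - (r * x + t)| < δ' := by
    intro x hx
    have hx01 := digitSet_subset_Icc hb hJ hx
    have h1 : |(r' - r) * x| ≤ |r' - r| := by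
      rw [abs_mul, abs_of_nonneg hx01.1]
      exact mul_le_of_le_one_right (abs_nonneg _) hx01.2
    have h2 := abs_add_le ((r' - r) * x) (t' - t)
    rw [show r' * x + t' - (r * x + t) = (r' - r) * x + (t' - t) by ring]
    linarith [hr'.2.2, ht'.2.2]
  have hA'U : A' ⊆ U := by
    rintro _ ⟨x, hx, rfl⟩
    refine hthick (Metric.mem_thickening_iff.mpr ⟨_, ⟨x, hx, rfl⟩, ?_⟩)
    rw [Real.dist_eq]
    exact hdist x hx
  have hA'E : A' ⊆ E ∩ I := by
    rintro _ ⟨x, hx, rfl⟩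
    refine ⟨hE' x hx, ?_⟩
    have hx01 := digitSet_subset_Icc hb hJ hx
    have h1 : |r' * x| ≤ |r'| := by
      rw [abs_mul, abs_of_nonneg hx01.1]
      exact mul_le_of_le_one_right (abs_nonneg _) hx01.2
    have h2 := abs_add_le (r' * x) t'
    have h3 := abs_sub_abs_le_abs_sub r' r
    have h4 := abs_sub_abs_le_abs_sub t' t
    exact abs_le.mp (by linarith [hr'.1.1, ht'.1.1])
  have hsplit : μ A + μ (A' \ A) ≤ μ U := by
    rw [← measure_union disjoint_sdiff_right (hA'c.isClosed.measurableSet.diff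
      hAc.isClosed.measurableSet)]
    exact measure_mono (union_subset hAU (sdiff_subset.trans hA'U))
  have hlt' : μ (A' \ A) < ENNReal.ofReal ((|r| / 2) ^ β) * c :=
    lt_of_add_lt_add_left (hsplit.trans_lt hU)
  rw [hμ, Measure.restrict_apply (hA'c.isClosed.measurableSet.diff hAc.isClosed.measurableSet),
    inter_eq_left.mpr (sdiff_subset.trans hA'E)] at hlt'
  have hrp : 0 < |r| := abs_pos.mpr hr
  have hm := hmove ((r' - r) / r) ((t' - t) / r)
    (by rw [abs_div, div_lt_iff₀ hrp]; exact hr'.2.1)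
    (by rw [abs_div, div_lt_iff₀ hrp]; exact ht'.2.1)
    (by
      by_contra! h
      exact hne ⟨sub_eq_zero.mp ((div_eq_zero_iff.mp h.1).resolve_right hr),
        sub_eq_zero.mp ((div_eq_zero_iff.mp h.2).resolve_right hr)⟩)
  refine absurd hlt' (not_lt.mpr ?_)
  calc ENNReal.ofReal ((|r| / 2) ^ β) * c
      ≤ ENNReal.ofReal (|r'| ^ β)
        * μH[β] {x ∈ C | x + ((r' - r) / r * x + (t' - t) / r) ∉ E} := by gcongr
    _ = μH[β] ((fun x => r' * x + t') '' {x ∈ C | x + ((r' - r) / r * x + (t' - t) / r) ∉ E}) :=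
        (hausdorffMeasure_affine_image hβ0 hr'0 _ _).symm
    _ ≤ μH[β] (A' \ A) := by
        apply measure_mono
        rintro _ ⟨x, ⟨hx, hxE⟩, rfl⟩
        refine ⟨⟨x, hx, rfl⟩, ?_⟩
        rintro ⟨y, hy, hxy⟩
        apply hxE
        have : x + ((r' - r) / r * x + (t' - t) / r) = y := by
          simp only at hxy
          field_simp
          linarith
        rw [this]
        exact subset_periodize _ hy

lemma exists_iterate_affine {C : Set ℝ} {r t : ℝ} (h : ∀ x ∈ C, r * x + t ∈ C) (u : ℕ) :
    ∃ t', ∀ x ∈ C, r ^ u * x + t' ∈ C := by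
  induction u with
  | zero => exact ⟨0, fun x hx => by simpa using hx⟩
  | succ u ih =>
    obtain ⟨t', ht'⟩ := ih
    refine ⟨r * t' + t, fun x hx => ?_⟩
    convert h _ (ht' x hx) using 1
    ring

lemma finite_affine_embeddings (hb : 2 ≤ b) (hJ : ∀ j ∈ J, j < b) (hN : 2 ≤ J.card)
    (hlt : J.card < b) :
    {p ∈ Icc (1 : ℝ) b ×ˢ Icc (0 : ℝ) 1 |
      ∀ x ∈ digitSet b J, p.1 * x + p.2 ∈ periodize (digitSet b J)}.Finite := by
  set G := {p ∈ Icc (1 : ℝ) b ×ˢ Icc (0 : ℝ) 1 |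
      ∀ x ∈ digitSet b J, p.1 * x + p.2 ∈ periodize (digitSet b J)} with hG
  have hcl : IsClosed {p : ℝ × ℝ | ∀ x ∈ digitSet b J, p.1 * x + p.2 ∈ periodize (digitSet b J)} := by
    simp only [ofPred_forall]
    refine isClosed_biInter fun x _ => ?_
    exact (isClosed_periodize (isCompact_digitSet hb hJ)).preimage (by fun_prop)
  have hGc : IsCompact G := (isCompact_Icc.prod isCompact_Icc).inter_right hcl
  by_contra hinf
  obtain ⟨p, hp, hacc⟩ := Set.Infinite.exists_accPt_of_subset_isCompact hinf hGc le_rfl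
  have hp1 : p.1 ≠ 0 := by linarith [hp.1.1.1]
  obtain ⟨ε, hε, hiso⟩ := affine_embedding_isolated hb hJ hN hlt (t := p.2) hp1
  obtain ⟨y, ⟨hy, hyG⟩, hyp⟩ := accPt_iff_nhds.mp hacc _ (Metric.ball_mem_nhds p hε)
  rw [Metric.mem_ball, Prod.dist_eq, max_lt_iff, Real.dist_eq, Real.dist_eq] at hy
  obtain ⟨h1, h2⟩ := hiso _ _ hy.1 hy.2 hyG.2
  exact hyp (Prod.ext h1 h2)

lemma exists_rat_of_mul_eq {x y : ℝ} (hy : y ≠ 0) {i : ℤ} {j : ℤ} (hi : i ≠ 0)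
    (h : i * x = j * y) : ∃ q : ℚ, x / y = q := by
  refine ⟨j / i, ?_⟩
  have : (i : ℝ) ≠ 0 := by exact_mod_cast hi
  push_cast
  rw [div_eq_div_iff hy this]
  linarith

/-- An affine self-embedding of a proper digit set has a ratio commensurable with the base. -/
lemma log_ratio_rational_of_digitSet (hb : 2 ≤ b) (hJ : ∀ j ∈ J, j < b) (hN : 2 ≤ J.card)
    (hlt : J.card < b) {r t : ℝ} (hr : 0 < r)
    (h : ∀ x ∈ digitSet b J, r * x + t ∈ digitSet b J) :
    ∃ q : ℚ, Real.log r / Real.log b = q := by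
  have hb1 : (1 : ℝ) < b := by exact_mod_cast hb
  have hb0 : (0 : ℝ) < b := by linarith
  choose T hT using exists_iterate_affine h
  have hr1 : r ≤ 1 := by
    by_contra! hr1
    obtain ⟨x, hx, y, hy, hxy⟩ := nontrivial_digitSet hb hJ hN
    obtain ⟨u, hu⟩ := pow_unbounded_of_one_lt (1 / (y - x)) hr1
    rw [div_lt_iff₀ (by linarith)] at hu
    have h1 := digitSet_subset_Icc hb hJ (hT u x hx)
    have h2 := digitSet_subset_Icc hb hJ (hT u y hy)
    linarith [h1.1, h2.2]
  have hk : ∀ u : ℕ, ∃ k : ℕ, 1 ≤ r ^ u * (b : ℝ) ^ k ∧ r ^ u * (b : ℝ) ^ k ≤ b := by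
    intro u
    have hru : 0 < r ^ u := by positivity
    obtain ⟨k, h1, h2⟩ := exists_nat_pow_near (x := 1 / r ^ u) (y := (b : ℝ))
      (by rw [le_div_iff₀ hru, one_mul]; exact pow_le_one₀ hr.le hr1) hb1
    rw [le_div_iff₀ hru] at h1
    rw [div_lt_iff₀ hru] at h2
    refine ⟨k + 1, by linarith, ?_⟩
    rw [pow_succ]
    nlinarith
  choose κ hκ using hk
  obtain ⟨u, u', huu, heq⟩ := Set.Finite.exists_lt_map_eq_of_forall_mem
    (f := fun u => (r ^ u * (b : ℝ) ^ κ u, Int.fract ((b : ℝ) ^ κ u * T u)))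
    (t := {p ∈ Icc (1 : ℝ) b ×ˢ Icc (0 : ℝ) 1 |
      ∀ x ∈ digitSet b J, p.1 * x + p.2 ∈ periodize (digitSet b J)})
    (fun u => by
      refine ⟨⟨⟨(hκ u).1, (hκ u).2⟩, Int.fract_nonneg _, (Int.fract_lt_one _).le⟩, fun x hx => ?_⟩
      have h1 := pow_mul_mem_periodize hb hJ (κ u) (subset_periodize _ (hT u x hx))
      have h2 := add_int_mem_periodize (-⌊(b : ℝ) ^ κ u * T u⌋) h1
      convert h2 using 1
      rw [← Int.self_sub_floor]
      push_cast
      ring)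
    (finite_affine_embeddings hb hJ hN hlt)
  have h1 : r ^ u * (b : ℝ) ^ κ u = r ^ u' * (b : ℝ) ^ κ u' := (Prod.ext_iff.mp heq).1
  have h2 := congrArg Real.log h1
  rw [Real.log_mul (by positivity) (by positivity), Real.log_mul (by positivity) (by positivity),
    Real.log_pow, Real.log_pow, Real.log_pow, Real.log_pow] at h2
  refine exists_rat_of_mul_eq (Real.log_pos hb1).ne' (i := u' - u) (j := κ u - κ u')
    (by omega) ?_
  push_cast
  linarith

end Rigidity

end BedfordMcMullen

namespace BedfordMcMullen

open Set Filter Topology MeasureTheory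
open scoped Pointwise ENNReal

section Carpet

variable {n m : ℕ} {Λ : Finset (ℕ × ℕ)}

lemma mem_carpet {p : ℝ × ℝ} : p ∈ BMCarpet n m Λ ↔ ∃ d : ℕ → ℕ × ℕ, (∀ k, d k ∈ Λ) ∧
    p.1 = digitSum n (fun k => (d k).1) ∧ p.2 = digitSum m (fun k => (d k).2) := Iff.rfl

lemma isCompact_carpet (hn : 2 ≤ n) (hm : 2 ≤ m) (hΛ : ∀ d ∈ Λ, d.1 < n ∧ d.2 < m) :
    IsCompact (BMCarpet n m Λ) := by
  have h : ContinuousOn (fun d : ℕ → ℕ × ℕ =>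
      (digitSum n (fun k => (d k).1), digitSum m (fun k => (d k).2))) {d | ∀ k, d k ∈ Λ} := by
    refine ContinuousOn.prodMk ?_ ?_
    · exact continuousOn_digitSum hn (Continuous.continuousOn (by fun_prop))
        fun d hd k => (hΛ _ (hd k)).1
    · exact continuousOn_digitSum hm (Continuous.continuousOn (by fun_prop))
        fun d hd k => (hΛ _ (hd k)).2
  convert (isCompact_sequences Λ).image_of_continuousOn h using 1
  ext p
  rw [mem_carpet]
  constructor
  · rintro ⟨d, hd, h1, h2⟩
    exact ⟨d, hd, Prod.ext h1.symm h2.symm⟩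
  · rintro ⟨d, hd, rfl⟩
    exact ⟨d, hd, rfl, rfl⟩

/-- The translates of the carpet by integer vectors. -/
def periodicCarpet (n m : ℕ) (Λ : Finset (ℕ × ℕ)) : Set (ℝ × ℝ) :=
  {p | ∃ z w : ℤ, (p.1 + z, p.2 + w) ∈ BMCarpet n m Λ}

lemma isClosed_periodicCarpet (hn : 2 ≤ n) (hm : 2 ≤ m) (hΛ : ∀ d ∈ Λ, d.1 < n ∧ d.2 < m) :
    IsClosed (periodicCarpet n m Λ) := by
  have h := (isClosed_range_intCast.prod isClosed_range_intCast).add_right_of_isCompact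
    (isCompact_carpet hn hm hΛ)
  convert h using 1
  ext p
  rw [Set.mem_add]
  constructor
  · rintro ⟨z, w, h⟩
    refine ⟨(((-z : ℤ) : ℝ), ((-w : ℤ) : ℝ)), ⟨⟨_, rfl⟩, ⟨_, rfl⟩⟩, _, h, ?_⟩
    ext <;> simp
  · rintro ⟨⟨x, y⟩, ⟨⟨z, rfl⟩, ⟨w, rfl⟩⟩, ⟨q1, q2⟩, hq, rfl⟩
    refine ⟨-z, -w, ?_⟩
    convert hq using 1
    ext <;> simp

lemma add_int_mem_periodicCarpet {x y : ℝ} (z w : ℤ) (h : (x, y) ∈ periodicCarpet n m Λ) :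
    (x + z, y + w) ∈ periodicCarpet n m Λ := by
  obtain ⟨a, c, h⟩ := h
  refine ⟨a - z, c - w, ?_⟩
  convert h using 1
  ext <;> simp

lemma pow_mul_mem_periodicCarpet (hn : 2 ≤ n) (hm : 2 ≤ m) (hΛ : ∀ d ∈ Λ, d.1 < n ∧ d.2 < m)
    (k : ℕ) {x y : ℝ} (h : (x, y) ∈ BMCarpet n m Λ) :
    ((n : ℝ) ^ k * x, (m : ℝ) ^ k * y) ∈ periodicCarpet n m Λ := by
  obtain ⟨d, hd, h1, h2⟩ := mem_carpet.mp h
  simp only at h1 h2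
  refine ⟨-prefixNat n (fun k => (d k).1) k, -prefixNat m (fun k => (d k).2) k,
    mem_carpet.mpr ⟨fun i => d (i + k), fun i => hd _, ?_, ?_⟩⟩
  · rw [h1, pow_mul_digitSum hn fun i => (hΛ _ (hd i)).1]
    push_cast
    ring
  · rw [h2, pow_mul_digitSum hm fun i => (hΛ _ (hd i)).2]
    push_cast
    ring

lemma cylinder_mem_carpet (hn : 2 ≤ n) (hm : 2 ≤ m) (hΛ : ∀ d ∈ Λ, d.1 < n ∧ d.2 < m)
    {d : ℕ → ℕ × ℕ} (hd : ∀ k, d k ∈ Λ) (k : ℕ) {x y : ℝ} (h : (x, y) ∈ BMCarpet n m Λ) :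
    ((prefixNat n (fun i => (d i).1) k + x) / (n : ℝ) ^ k,
      (prefixNat m (fun i => (d i).2) k + y) / (m : ℝ) ^ k) ∈ BMCarpet n m Λ := by
  obtain ⟨e, he, h1, h2⟩ := mem_carpet.mp h
  simp only at h1 h2
  have hn0 : (0 : ℝ) < n := by positivity
  have hm0 : (0 : ℝ) < m := by positivity
  refine mem_carpet.mpr ⟨splice k d e, splice_mem (s := (Λ : Set (ℕ × ℕ))) hd he k, ?_, ?_⟩
  · rw [comp_splice Prod.fst, div_eq_iff (by positivity), mul_comm, pow_mul_digitSum_splice hn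
      (fun i => (hΛ _ (hd i)).1) (fun i => (hΛ _ (he i)).1), h1]
  · rw [comp_splice Prod.snd, div_eq_iff (by positivity), mul_comm, pow_mul_digitSum_splice hm
      (fun i => (hΛ _ (hd i)).2) (fun i => (hΛ _ (he i)).2), h2]

lemma fst_mem_digitSet {x y : ℝ} (h : (x, y) ∈ BMCarpet n m Λ) :
    x ∈ digitSet n (Λ.image Prod.fst) := by
  obtain ⟨d, hd, h1, -⟩ := mem_carpet.mp h
  exact ⟨_, fun k => Finset.mem_image_of_mem _ (hd k), h1⟩

lemma snd_mem_digitSet {x y : ℝ} (h : (x, y) ∈ BMCarpet n m Λ) :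
    y ∈ digitSet m (Λ.image Prod.snd) := by
  obtain ⟨d, hd, -, h2⟩ := mem_carpet.mp h
  exact ⟨_, fun k => Finset.mem_image_of_mem _ (hd k), h2⟩

lemma exists_mem_carpet_of_fst {x : ℝ} (h : x ∈ digitSet n (Λ.image Prod.fst)) :
    ∃ y, (x, y) ∈ BMCarpet n m Λ := by
  obtain ⟨d, hd, rfl⟩ := h
  choose e he hed using fun k => Finset.mem_image.mp (hd k)
  exact ⟨_, mem_carpet.mpr ⟨e, he, by simp only [hed], rfl⟩⟩

lemma exists_sequence_of_snd {y : ℝ} (h : y ∈ digitSet m (Λ.image Prod.snd)) :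
    ∃ d : ℕ → ℕ × ℕ, (∀ k, d k ∈ Λ) ∧ y = digitSum m (fun k => (d k).2) := by
  obtain ⟨d, hd, rfl⟩ := h
  choose e he hed using fun k => Finset.mem_image.mp (hd k)
  exact ⟨e, he, by simp only [hed]⟩

lemma exists_mem_carpet_of_snd {y : ℝ} (h : y ∈ digitSet m (Λ.image Prod.snd)) :
    ∃ x, (x, y) ∈ BMCarpet n m Λ := by
  obtain ⟨d, hd, rfl⟩ := exists_sequence_of_snd h
  exact ⟨_, mem_carpet.mpr ⟨d, hd, rfl, rfl⟩⟩

lemma two_le_card_image_fst (hline : ¬ OnALine (BMCarpet n m Λ)) :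
    2 ≤ (Λ.image Prod.fst).card := by
  by_contra! h
  refine hline ?_
  have h1 := Finset.card_le_one.mp (Nat.lt_succ_iff.mp h)
  rcases Λ.eq_empty_or_nonempty with rfl | ⟨i, hi⟩
  · refine ⟨1, 0, 0, Or.inl one_ne_zero, ?_⟩
    rintro p ⟨d, hd, -⟩
    exact absurd (hd 0) (Finset.notMem_empty _)
  · refine ⟨1, 0, digitSum n fun _ => i.1, Or.inl one_ne_zero, fun p hp => ?_⟩
    obtain ⟨d, hd, h2, -⟩ := mem_carpet.mp hp
    rw [one_mul, zero_mul, add_zero, h2]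
    congr 1
    ext k
    exact h1 _ (Finset.mem_image_of_mem _ (hd k)) _ (Finset.mem_image_of_mem _ hi)

lemma two_le_card_image_snd (hline : ¬ OnALine (BMCarpet n m Λ)) :
    2 ≤ (Λ.image Prod.snd).card := by
  by_contra! h
  refine hline ?_
  have h1 := Finset.card_le_one.mp (Nat.lt_succ_iff.mp h)
  rcases Λ.eq_empty_or_nonempty with rfl | ⟨i, hi⟩
  · refine ⟨1, 0, 0, Or.inl one_ne_zero, ?_⟩
    rintro p ⟨d, hd, -⟩
    exact absurd (hd 0) (Finset.notMem_empty _)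
  · refine ⟨0, 1, digitSum m fun _ => i.2, Or.inr one_ne_zero, fun p hp => ?_⟩
    obtain ⟨d, hd, -, h2⟩ := mem_carpet.mp hp
    rw [one_mul, zero_mul, zero_add, h2]
    congr 1
    ext k
    exact h1 _ (Finset.mem_image_of_mem _ (hd k)) _ (Finset.mem_image_of_mem _ hi)

lemma image_fst_lt (hΛ : ∀ d ∈ Λ, d.1 < n ∧ d.2 < m) : ∀ i ∈ Λ.image Prod.fst, i < n := by
  intro i hi
  obtain ⟨d, hd, rfl⟩ := Finset.mem_image.mp hi
  exact (hΛ d hd).1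

lemma image_snd_lt (hΛ : ∀ d ∈ Λ, d.1 < n ∧ d.2 < m) : ∀ j ∈ Λ.image Prod.snd, j < m := by
  intro i hi
  obtain ⟨d, hd, rfl⟩ := Finset.mem_image.mp hi
  exact (hΛ d hd).2

lemma digitSet_eq_Icc_of_card {b : ℕ} {J : Finset ℕ} (hb : 2 ≤ b) (hJ : ∀ j ∈ J, j < b)
    (hcard : b ≤ J.card) : digitSet b J = Icc 0 1 := by
  rw [← digitSet_range hb, Finset.eq_of_subset_of_card_le (s := J) (t := Finset.range b)
    (fun j hj => Finset.mem_range.mpr (hJ j hj)) (by simpa using hcard)]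

/-- The periodic carpet avoids the vertical bisector of the rectangle of a missing digit pair. -/
lemma notMem_periodicCarpet_of_missing (hn : 2 ≤ n) (hm : 2 ≤ m)
    (hΛ : ∀ d ∈ Λ, d.1 < n ∧ d.2 < m) {i j : ℕ} (hi : i < n) (hj : j < m) (hij : (i, j) ∉ Λ)
    {x y : ℝ} {z w : ℤ} (hx : x = z + ((i : ℝ) + 1 / 2) / n)
    (hy : |y - w - ((j : ℝ) + 1 / 2) / m| < 1 / (2 * m)) : (x, y) ∉ periodicCarpet n m Λ := by
  rintro ⟨a, c, h⟩
  obtain ⟨d, hd, h1, h2⟩ := mem_carpet.mp h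
  simp only at h1 h2
  have hi' : (d 0).1 = i := first_digit_eq_of_near_midpoint hn (d := fun k => (d k).1)
    (fun k => (hΛ _ (hd k)).1) hi (z := z + a) (by
      have : x + a - ((z + a : ℤ) : ℝ) - ((i : ℝ) + 1 / 2) / n = 0 := by
        rw [hx]; push_cast; ring
      rw [← h1, this, abs_zero]
      positivity)
  have hj' : (d 0).2 = j := first_digit_eq_of_near_midpoint hm (d := fun k => (d k).2)
    (fun k => (hΛ _ (hd k)).2) hj (z := w + c) (by
      rw [← h2]
      convert hy using 2
      push_cast
      ring)
  refine hij ?_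
  rw [← hi', ← hj']
  exact hd 0

lemma exists_missing_pair (hcard : Λ.card < m * n) :
    ∃ i < n, ∃ j < m, (i, j) ∉ Λ := by
  obtain ⟨⟨i, j⟩, hij, h⟩ := Finset.exists_mem_notMem_of_card_lt_card (s := Λ)
    (t := Finset.range n ×ˢ Finset.range m) (by simpa [mul_comm] using hcard)
  rw [Finset.mem_product, Finset.mem_range, Finset.mem_range] at hij
  exact ⟨i, hij.1, j, hij.2, h⟩

lemma exists_mul_add_eq_int_add {A : ℝ} (hA : A ≠ 0) (B θ : ℝ) :
    ∃ x ∈ Icc 0 (1 / |A|), ∃ z : ℤ, A * x + B = z + θ := by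
  rcases lt_or_gt_of_ne hA with h | h
  · refine ⟨(⌊B - θ⌋ + θ - B) / A, ⟨?_, ?_⟩, ⌊B - θ⌋, by field_simp; ring⟩
    · exact div_nonneg_of_nonpos (by linarith [Int.floor_le (B - θ)]) h.le
    · rw [abs_of_neg h, ← neg_div_neg_eq]
      gcongr
      · linarith
      · linarith [Int.lt_floor_add_one (B - θ)]
  · refine ⟨(⌈B - θ⌉ + θ - B) / A, ⟨?_, ?_⟩, ⌈B - θ⌉, by field_simp; ring⟩
    · exact div_nonneg (by linarith [Int.le_ceil (B - θ)]) h.le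
    · rw [abs_of_pos h]
      gcongr
      linarith [Int.ceil_lt_add_one (B - θ)]

end Carpet

section Homothety

variable {n m : ℕ} {Λ : Finset (ℕ × ℕ)}

lemma exists_iterate_homothety {K : Set (ℝ × ℝ)} {r s t : ℝ}
    (h : ∀ x y, (x, y) ∈ K → (r * x + s, r * y + t) ∈ K) (u : ℕ) :
    ∃ s' t', ∀ x y, (x, y) ∈ K → (r ^ u * x + s', r ^ u * y + t') ∈ K := by
  induction u with
  | zero => exact ⟨0, 0, fun x y hx => by simpa using hx⟩
  | succ u ih =>
    obtain ⟨s', t', h'⟩ := ih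
    refine ⟨r * s' + s, r * t' + t, fun x y hx => ?_⟩
    convert h _ _ (h' x y hx) using 2 <;> ring

lemma not_contracting_homothety (hm : 2 ≤ m) (hnm : m < n) (hΛ : ∀ d ∈ Λ, d.1 < n ∧ d.2 < m)
    {i j : ℕ} (hi : i < n) (hj : j < m) (hij : (i, j) ∉ Λ)
    (hI : digitSet n (Λ.image Prod.fst) = Icc 0 1) (hJ : digitSet m (Λ.image Prod.snd) = Icc 0 1)
    {r s t : ℝ} (hr : 0 < r) (hr1 : r < 1)
    (h : ∀ x y, (x, y) ∈ BMCarpet n m Λ → (r * x + s, r * y + t) ∈ BMCarpet n m Λ) : False := by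
  have hn : 2 ≤ n := by omega
  have hm0 : (2 : ℝ) ≤ m := by exact_mod_cast hm
  have hmp : (0 : ℝ) < m := by linarith
  have hnm' : (m : ℝ) < n := by exact_mod_cast hnm
  have hnp : (0 : ℝ) < n := by linarith
  obtain ⟨v, hv⟩ := pow_unbounded_of_one_lt (1 / r * (2 * m)) (show (1 : ℝ) < m by linarith)
  obtain ⟨w, hw⟩ := pow_unbounded_of_one_lt ((n : ℝ) ^ v) (show (1 : ℝ) < n / m by
    rwa [lt_div_iff₀ hmp, one_mul])
  obtain ⟨u, hu1, hu2⟩ := exists_nat_pow_near (x := (m : ℝ) ^ w) (y := 1 / r)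
    (one_le_pow₀ (by linarith)) (by rw [lt_div_iff₀ hr]; linarith)
  have hru : 0 < r ^ u := by positivity
  rw [one_div, inv_pow, inv_le_iff_one_le_mul₀ hru] at hu1
  rw [one_div, inv_pow, pow_succ, ← one_div, lt_div_iff₀ (by positivity)] at hu2
  obtain ⟨s', t', h'⟩ := exists_iterate_homothety h u
  set S := (m : ℝ) ^ w * r ^ u with hS
  have hS0 : 0 < S := by linarith
  have hSr : S < 1 / r := by
    rw [lt_div_iff₀ hr]
    linarith
  obtain ⟨y0, hy0, z, hz⟩ := exists_mul_add_eq_int_add hS0.ne' ((m : ℝ) ^ w * t')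
    (((j : ℝ) + 1 / 2) / m)
  have hy01 : y0 ∈ Icc (0 : ℝ) 1 := by
    refine ⟨hy0.1, hy0.2.trans ?_⟩
    rw [abs_of_pos hS0, div_le_one hS0]
    exact hu1
  rw [← hJ] at hy01
  obtain ⟨d, hd, hdy⟩ := exists_sequence_of_snd hy01
  set zx := prefixNat n (fun i => (d i).1) v
  set zy := prefixNat m (fun i => (d i).2) v
  have hnv : (0 : ℝ) < (n : ℝ) ^ v := by positivity
  have hmv : (0 : ℝ) < (m : ℝ) ^ v := by positivity
  have hA1 : 1 ≤ (n : ℝ) ^ w * r ^ u / (n : ℝ) ^ v := by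
    rw [le_div_iff₀ hnv, one_mul]
    rw [div_pow, lt_div_iff₀ (by positivity)] at hw
    have h1 : (n : ℝ) ^ v * S ≤ (n : ℝ) ^ w * r ^ u := by
      rw [hS, ← mul_assoc]
      gcongr
    exact le_trans (le_mul_of_one_le_right hnv.le hu1) h1
  have hA0 : 0 < (n : ℝ) ^ w * r ^ u / (n : ℝ) ^ v := by linarith
  obtain ⟨x, hx, z', hz'⟩ := exists_mul_add_eq_int_add hA0.ne'
    ((n : ℝ) ^ w * (r ^ u * (zx / (n : ℝ) ^ v) + s')) (((i : ℝ) + 1 / 2) / n)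
  have hx01 : x ∈ Icc (0 : ℝ) 1 := by
    refine ⟨hx.1, hx.2.trans ?_⟩
    rw [abs_of_pos hA0, div_le_one hA0]
    exact hA1
  rw [← hI] at hx01
  obtain ⟨y, hxy⟩ := exists_mem_carpet_of_fst (m := m) hx01
  have hmem := pow_mul_mem_periodicCarpet hn hm hΛ w (h' _ _ (cylinder_mem_carpet hn hm hΛ hd v hxy))
  refine notMem_periodicCarpet_of_missing hn hm hΛ hi hj hij (z := z') (w := z) ?_ ?_ hmem
  · rw [← hz']
    ring
  · have h1 := pow_mul_digitSum (b := m) hm (d := fun i => (d i).2) (fun i => (hΛ _ (hd i)).2) v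
    rw [← hdy] at h1
    have h2 : y0 = (zy + digitSum m (fun i => (d (i + v)).2)) / (m : ℝ) ^ v := by
      rw [eq_div_iff hmv.ne', ← h1, mul_comm]
    have h3 := digitSet_subset_Icc hm (image_snd_lt hΛ) (snd_mem_digitSet hxy)
    have h4 := digitSum_nonneg (b := m) (d := fun i => (d (i + v)).2)
    have h5 := digitSum_le_one (b := m) (d := fun i => (d (i + v)).2) hm fun i => (hΛ _ (hd _)).2
    set y' := digitSum m (fun i => (d (i + v)).2)
    have h6 : (m : ℝ) ^ w * (r ^ u * ((zy + y) / (m : ℝ) ^ v) + t') - z - ((j : ℝ) + 1 / 2) / m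
        = S * (y - y') / (m : ℝ) ^ v := by
      rw [sub_sub, ← hz, h2, hS]
      ring
    have h7 : |y - y'| ≤ 1 := abs_le.mpr ⟨by linarith [h3.1], by linarith [h3.2]⟩
    rw [h6, abs_div, abs_mul, abs_of_pos hS0, abs_of_pos hmv, div_lt_div_iff₀ hmv (by positivity)]
    calc S * |y - y'| * (2 * m) ≤ S * 1 * (2 * m) := by gcongr
      _ ≤ 1 / r * (2 * m) := by
        rw [mul_one]
        gcongr
      _ < _ := by linarith

lemma log_ratio_rational_of_homothety (hm : 2 ≤ m) (hnm : m < n)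
    (hΛ : Λ ⊆ Finset.range n ×ˢ Finset.range m) (hcard : Λ.card < m * n)
    (hrat : ∃ q : ℚ, Real.log n / Real.log m = q) (hline : ¬ OnALine (BMCarpet n m Λ))
    {r s t : ℝ} (hr : 0 < r)
    (h : ∀ x y, (x, y) ∈ BMCarpet n m Λ → (r * x + s, r * y + t) ∈ BMCarpet n m Λ) :
    ∃ q : ℚ, Real.log r / Real.log n = q := by
  have hn : 2 ≤ n := by omega
  have hΛ' : ∀ d ∈ Λ, d.1 < n ∧ d.2 < m := fun d hd => by
    simpa [Finset.mem_product] using hΛ hd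
  have h1 := two_le_card_image_fst hline
  have h2 := two_le_card_image_snd hline
  have hx : ∀ x ∈ digitSet n (Λ.image Prod.fst), r * x + s ∈ digitSet n (Λ.image Prod.fst) := by
    intro x hx
    obtain ⟨y, hy⟩ := exists_mem_carpet_of_fst (m := m) hx
    exact fst_mem_digitSet (h x y hy)
  have hy : ∀ y ∈ digitSet m (Λ.image Prod.snd), r * y + t ∈ digitSet m (Λ.image Prod.snd) := by
    intro y hy
    obtain ⟨x, hx⟩ := exists_mem_carpet_of_snd (n := n) hy
    exact snd_mem_digitSet (h x y hx)
  rcases lt_or_ge (Λ.image Prod.fst).card n with hI | hI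
  · exact log_ratio_rational_of_digitSet hn (image_fst_lt hΛ') h1 hI hr hx
  rcases lt_or_ge (Λ.image Prod.snd).card m with hJ | hJ
  · obtain ⟨q, hq⟩ := log_ratio_rational_of_digitSet hm (image_snd_lt hΛ') h2 hJ hr hy
    obtain ⟨q', hq'⟩ := hrat
    have hlm : Real.log m ≠ 0 := (Real.log_pos (by exact_mod_cast hm)).ne'
    refine ⟨q / q', ?_⟩
    push_cast
    rw [← hq, ← hq', div_div_div_cancel_right₀ hlm]
  · have hI' := digitSet_eq_Icc_of_card hn (image_fst_lt hΛ') hI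
    have hJ' := digitSet_eq_Icc_of_card hm (image_snd_lt hΛ') hJ
    have hr1 : r ≤ 1 := by
      rw [hI'] at hx
      have hx0 := hx 0 (by simp)
      have hx1 := hx 1 (by simp)
      linarith [hx0.1, hx1.2]
    rcases hr1.lt_or_eq with hr1 | rfl
    · obtain ⟨i, hi, j, hj, hij⟩ := exists_missing_pair hcard
      exact (not_contracting_homothety hm hnm hΛ' hi hj hij hI' hJ' hr hr1 h).elim
    · exact ⟨0, by simp⟩

end Homothety

section Similitude

lemma similitude_eq_affine {f : ℝ × ℝ → ℝ × ℝ} {l : ℝ} (hf : IsSimilitude f l) :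
    ∃ a₁ b₁ a₂ b₂ t₁ t₂ : ℝ, (∀ x y, f (x, y) = (a₁ * x + b₁ * y + t₁, a₂ * x + b₂ * y + t₂)) ∧
      a₁ ^ 2 + a₂ ^ 2 = l ^ 2 ∧ b₁ ^ 2 + b₂ ^ 2 = l ^ 2 ∧ a₁ * b₁ + a₂ * b₂ = 0 := by
  have hsq : ∀ p q : ℝ × ℝ, ((f p).1 - (f q).1) ^ 2 + ((f p).2 - (f q).2) ^ 2
      = l ^ 2 * ((p.1 - q.1) ^ 2 + (p.2 - q.2) ^ 2) := by
    intro p q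
    have h := congrArg (· ^ 2) (hf p q)
    simp only [mul_pow] at h
    rwa [Real.sq_sqrt (by positivity), Real.sq_sqrt (by positivity)] at h
  have h10 := hsq (1, 0) (0, 0)
  have h01 := hsq (0, 1) (0, 0)
  have h11 := hsq (1, 0) (0, 1)
  refine ⟨(f (1, 0)).1 - (f (0, 0)).1, (f (0, 1)).1 - (f (0, 0)).1, (f (1, 0)).2 - (f (0, 0)).2,
    (f (0, 1)).2 - (f (0, 0)).2, (f (0, 0)).1, (f (0, 0)).2, fun x y => ?_, ?_, ?_, ?_⟩
  · have h0 := hsq (x, y) (0, 0)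
    have h1 := hsq (x, y) (1, 0)
    have h2 := hsq (x, y) (0, 1)
    simp only at h10 h01 h11 h0 h1 h2
    have key : ((f (x, y)).1 - (((f (1, 0)).1 - (f (0, 0)).1) * x + ((f (0, 1)).1 - (f (0, 0)).1) * y
          + (f (0, 0)).1)) ^ 2 + ((f (x, y)).2 - (((f (1, 0)).2 - (f (0, 0)).2) * x
          + ((f (0, 1)).2 - (f (0, 0)).2) * y + (f (0, 0)).2)) ^ 2 = 0 := by
      linear_combination (1 - x - y) * h0 + x * h1 + y * h2 + (x ^ 2 + x * y - x) * h10
        + (y ^ 2 + x * y - y) * h01 - x * y * h11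
    have hk1 := (add_eq_zero_iff_of_nonneg (sq_nonneg _) (sq_nonneg _)).mp key
    exact Prod.ext (sub_eq_zero.mp (pow_eq_zero_iff two_ne_zero |>.mp hk1.1))
      (sub_eq_zero.mp (pow_eq_zero_iff two_ne_zero |>.mp hk1.2))
  · linear_combination h10
  · linear_combination h01
  · linear_combination (h10 + h01 - h11) / 2

end Similitude

end BedfordMcMullen

namespace BedfordMcMullen

open Set Filter Topology MeasureTheory
open scoped Pointwise ENNReal

section Limit

variable {n m : ℕ} {Λ : Finset (ℕ × ℕ)}

lemma exists_pow_eq_pow_of_log_rational (hm : 2 ≤ m) (hnm : m < n)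
    (hrat : ∃ q : ℚ, Real.log n / Real.log m = q) : ∃ p q : ℕ, q < p ∧ n ^ q = m ^ p := by
  obtain ⟨r, hr⟩ := hrat
  have hm0 : (2 : ℝ) ≤ m := by exact_mod_cast hm
  have hnm' : (m : ℝ) < n := by exact_mod_cast hnm
  have hlm : 0 < Real.log m := Real.log_pos (by linarith)
  have hln : 0 < Real.log n := Real.log_pos (by linarith)
  have hr0 : 0 < r := by
    have : (0 : ℝ) < r := hr ▸ div_pos hln hlm
    exact_mod_cast this
  have hnum : ((r.num.toNat : ℤ)) = r.num := Int.toNat_of_nonneg (Rat.num_pos.mpr hr0).le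
  have hnum' : (r.num.toNat : ℝ) = r.num := by exact_mod_cast congrArg (Int.cast (R := ℝ)) hnum
  have hpow : n ^ r.den = m ^ r.num.toNat := by
    have h : (n : ℝ) ^ r.den = (m : ℝ) ^ r.num.toNat := by
      have hnp : (0 : ℝ) < n := by linarith
      have hmp : (0 : ℝ) < m := by linarith
      refine Real.log_injOn_pos (mem_Ioi.mpr (pow_pos hnp _)) (mem_Ioi.mpr (pow_pos hmp _)) ?_
      rw [Real.log_pow, Real.log_pow, hnum']
      rw [Rat.cast_def, div_eq_div_iff hlm.ne' (by exact_mod_cast r.den_nz)] at hr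
      linarith
    exact_mod_cast h
  refine ⟨r.num.toNat, r.den, ?_, hpow⟩
  by_contra! hle
  have h1 : m ^ r.num.toNat ≤ m ^ r.den := Nat.pow_le_pow_right (by omega) hle
  have h2 : m ^ r.den < n ^ r.den := Nat.pow_lt_pow_left hnm r.den_nz
  omega

lemma exists_subseq_tendsto_fract (c c' : ℕ → ℝ) :
    ∃ s t : ℝ, ∃ φ : ℕ → ℕ, StrictMono φ ∧
      Tendsto (fun h => Int.fract (c (φ h))) atTop (𝓝 s) ∧
      Tendsto (fun h => Int.fract (c' (φ h))) atTop (𝓝 t) := by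
  obtain ⟨a, -, φ, hφ, h⟩ := (isCompact_Icc.prod isCompact_Icc :
    IsCompact (Icc (0 : ℝ) 1 ×ˢ Icc (0 : ℝ) 1)).tendsto_subseq
    (x := fun h => (Int.fract (c h), Int.fract (c' h)))
    fun h => ⟨⟨Int.fract_nonneg _, (Int.fract_lt_one _).le⟩,
      ⟨Int.fract_nonneg _, (Int.fract_lt_one _).le⟩⟩
  exact ⟨a.1, a.2, φ, hφ, (continuous_fst.tendsto _).comp h, (continuous_snd.tendsto _).comp h⟩

lemma tendsto_const_mul_pow_subseq {c : ℝ} (h0 : 0 ≤ c) (h1 : c < 1) {φ : ℕ → ℕ} (hφ : StrictMono φ)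
    (a x : ℝ) : Tendsto (fun h => a * c ^ φ h * x) atTop (𝓝 0) := by
  have h := (tendsto_pow_atTop_nhds_zero_of_lt_one h0 h1).comp hφ.tendsto_atTop
  simpa using (h.const_mul a).mul_const x

/-- If a carpet with commensurable bases has an affine image inside itself, then the restriction
of the map to vertical directions embeds the vertical projection into a horizontal slice. -/
lemma exists_slice_embedding (hm : 2 ≤ m) (hnm : m < n) (hΛ : ∀ d ∈ Λ, d.1 < n ∧ d.2 < m)
    (hne : Λ.Nonempty) {p q : ℕ} (hqp : q < p) (hpow : n ^ q = m ^ p) {a₁ b₁ a₂ b₂ t₁ t₂ : ℝ}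
    (h : ∀ x y, (x, y) ∈ BMCarpet n m Λ →
      (a₁ * x + b₁ * y + t₁, a₂ * x + b₂ * y + t₂) ∈ BMCarpet n m Λ) :
    ∃ σ τ : ℝ, ∀ x y, (x, y) ∈ BMCarpet n m Λ → (b₁ * y + σ, τ) ∈ periodicCarpet n m Λ := by
  have hn : 2 ≤ n := by omega
  have hm0 : (2 : ℝ) ≤ m := by exact_mod_cast hm
  have hmp : (0 : ℝ) < m := by linarith
  have hnm' : (m : ℝ) < n := by exact_mod_cast hnm
  have hnp : (0 : ℝ) < n := by linarith
  have hpow' : (n : ℝ) ^ q = (m : ℝ) ^ p := by exact_mod_cast hpow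
  obtain ⟨d, hd⟩ := hne
  have hcyl := fun k {x y : ℝ} => cylinder_mem_carpet hn hm hΛ (d := fun _ => d) (fun _ => hd) k
    (x := x) (y := y)
  set P : ℕ → ℕ := prefixNat n fun _ => d.1
  set R : ℕ → ℕ := prefixNat m fun _ => d.2
  set c₁ := (n : ℝ) ^ q / (n : ℝ) ^ p with hc₁
  set c₂ := (m : ℝ) ^ q / (m : ℝ) ^ p with hc₂
  set c₃ := (m : ℝ) ^ q / (n : ℝ) ^ p with hc₃
  have hc₁1 : c₁ < 1 := by
    rw [div_lt_one (by positivity)]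
    exact pow_lt_pow_right₀ (by linarith) hqp
  have hmqp : (m : ℝ) ^ q < (m : ℝ) ^ p := pow_lt_pow_right₀ (by linarith) hqp
  have hc₂1 : c₂ < 1 := by rwa [div_lt_one (by positivity)]
  have hc₃1 : c₃ < 1 := by
    rw [div_lt_one (by positivity)]
    exact hmqp.trans_le (pow_le_pow_left₀ hmp.le hnm'.le _)
  set s : ℕ → ℝ := fun k => a₁ * c₁ ^ k * P (p * k) + b₁ * R (p * k) + (n : ℝ) ^ (q * k) * t₁
  set t : ℕ → ℝ := fun k =>
    a₂ * c₃ ^ k * P (p * k) + b₂ * c₂ ^ k * R (p * k) + (m : ℝ) ^ (q * k) * t₂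
  obtain ⟨σ, τ, φ, hφ, hσ, hτ⟩ := exists_subseq_tendsto_fract s t
  refine ⟨σ, τ, fun x y hxy => ?_⟩
  have hmem : ∀ k, (b₁ * y + a₁ * c₁ ^ k * x + Int.fract (s k),
      b₂ * c₂ ^ k * y + a₂ * c₃ ^ k * x + Int.fract (t k)) ∈ periodicCarpet n m Λ := by
    intro k
    have h1 := add_int_mem_periodicCarpet (-⌊s k⌋) (-⌊t k⌋)
      (pow_mul_mem_periodicCarpet hn hm hΛ (q * k) (h _ _ (hcyl (p * k) hxy)))
    convert h1 using 2
    · rw [← Int.self_sub_floor, hc₁, div_pow, ← pow_mul, ← pow_mul]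
      have h2 : (n : ℝ) ^ (q * k) = (m : ℝ) ^ (p * k) := by rw [pow_mul, hpow', ← pow_mul]
      have h3 : (n : ℝ) ^ (q * k) * (b₁ * ((R (p * k) + y) / (m : ℝ) ^ (p * k)))
          = b₁ * (R (p * k) + y) := by
        rw [h2]
        field_simp
      simp only [s, hc₁, div_pow, ← pow_mul]
      push_cast
      linear_combination -h3
    · rw [← Int.self_sub_floor]
      simp only [t, hc₂, hc₃, div_pow, ← pow_mul]
      push_cast
      ring
  have hlim : Tendsto (fun k => (b₁ * y + a₁ * c₁ ^ φ k * x + Int.fract (s (φ k)),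
      b₂ * c₂ ^ φ k * y + a₂ * c₃ ^ φ k * x + Int.fract (t (φ k)))) atTop
      (𝓝 (b₁ * y + 0 + σ, 0 + 0 + τ)) :=
    (((tendsto_const_nhds.add (tendsto_const_mul_pow_subseq (by positivity) hc₁1 hφ a₁ x)).add hσ)).prodMk_nhds
      (((tendsto_const_mul_pow_subseq (by positivity) hc₂1 hφ b₂ y).add
        (tendsto_const_mul_pow_subseq (by positivity) hc₃1 hφ a₂ x)).add hτ)
  rw [add_zero, zero_add, zero_add] at hlim
  exact (isClosed_periodicCarpet hn hm hΛ).mem_of_tendsto hlim (Eventually.of_forall fun k => hmem _)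

end Limit

section Slices

variable {n m : ℕ} {Λ : Finset (ℕ × ℕ)}

/-- The first digits of the pairs in `Λ` with second digit `j`. -/
def row (Λ : Finset (ℕ × ℕ)) (j : ℕ) : Finset ℕ := (Λ.filter fun d => d.2 = j).image Prod.fst

lemma mem_row {i j : ℕ} : i ∈ row Λ j ↔ (i, j) ∈ Λ := by
  simp [row]

/-- The values of the first digits of words over `Λ` of length `k` whose second digits have value
`z`. -/
def rowWords (n m : ℕ) (Λ : Finset (ℕ × ℕ)) : ℕ → ℕ → Finset ℕ
  | 0, _ => {0}
  | k + 1, z => Finset.image₂ (fun a i => n * a + i) (rowWords n m Λ k (z / m)) (row Λ (z % m))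

lemma card_rowWords_le {N : ℕ} (hN : ∀ j, (row Λ j).card ≤ N) (k z : ℕ) :
    (rowWords n m Λ k z).card ≤ N ^ k := by
  induction k generalizing z with
  | zero => simp [rowWords]
  | succ k ih =>
    rw [rowWords, pow_succ]
    exact (Finset.card_image₂_le _ _ _).trans (Nat.mul_le_mul (ih _) (hN _))

lemma prefixNat_mem_rowWords (hΛ : ∀ d ∈ Λ, d.1 < n ∧ d.2 < m) {d : ℕ → ℕ × ℕ}
    (hd : ∀ k, d k ∈ Λ) (k : ℕ) :
    prefixNat n (fun i => (d i).1) k ∈ rowWords n m Λ k (prefixNat m (fun i => (d i).2) k) := by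
  induction k with
  | zero => simp [rowWords, prefixNat]
  | succ k ih =>
    have hm := (hΛ _ (hd k)).2
    simp only [rowWords, prefixNat]
    rw [Nat.mul_add_div (by omega), Nat.div_eq_of_lt hm, add_zero, Nat.mul_add_mod,
      Nat.mod_eq_of_lt hm]
    exact Finset.mem_image₂_of_mem ih (mem_row.mpr (hd k))

lemma hausdorffMeasure_slice_eq_zero (hn : 2 ≤ n) (hm : 2 ≤ m) (hΛ : ∀ d ∈ Λ, d.1 < n ∧ d.2 < m)
    {N : ℕ} (hN : ∀ j, (row Λ j).card ≤ N) {s : ℝ} (hs : 0 ≤ s) (hNs : N < (n : ℝ) ^ s) (y : ℝ) :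
    μH[s] {x | (x, y) ∈ BMCarpet n m Λ} = 0 := by
  have hn0 : (0 : ℝ) < n := by positivity
  set W : ℕ → Finset ℕ := fun k => Finset.Icc ⌈(m : ℝ) ^ k * y - 1⌉₊ ⌊(m : ℝ) ^ k * y⌋₊ with hW
  have h := hausdorffMeasure_le_of_cover (N := N) (c := 2) hn hs
    (S := {x | (x, y) ∈ BMCarpet n m Λ})
    (fun k => ((W k).biUnion (rowWords n m Λ k)).map Nat.castEmbedding) (fun k => by
      rw [Finset.card_map]
      refine Finset.card_biUnion_le.trans ((Finset.sum_le_card_nsmul _ _ _ fun z _ =>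
        card_rowWords_le hN k z).trans ?_)
      rw [smul_eq_mul]
      refine Nat.mul_le_mul_right _ ?_
      rw [hW, Nat.card_Icc]
      rcases le_total 0 ((m : ℝ) ^ k * y) with h0 | h0
      · have h1 := Nat.floor_le h0
        have h2 := Nat.le_ceil ((m : ℝ) ^ k * y - 1)
        have h3 : ((⌊(m : ℝ) ^ k * y⌋₊ : ℕ) : ℝ) ≤ (⌈(m : ℝ) ^ k * y - 1⌉₊ + 1 : ℕ) := by
          push_cast
          linarith
        have h3' : ⌊(m : ℝ) ^ k * y⌋₊ ≤ ⌈(m : ℝ) ^ k * y - 1⌉₊ + 1 := by exact_mod_cast h3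
        omega
      · rw [Nat.floor_of_nonpos h0]
        omega) (by
      intro k x hx
      obtain ⟨d, hd, h1, h2⟩ := mem_carpet.mp hx
      simp only at h1 h2
      have h3 := digitSum_mem_Icc_prefix hn (fun i => (hΛ _ (hd i)).1) k
      have h4 := digitSum_mem_Icc_prefix hm (fun i => (hΛ _ (hd i)).2) k
      rw [← h1] at h3
      rw [← h2] at h4
      refine ⟨prefixNat n (fun i => (d i).1) k, ?_, by simpa using h3⟩
      rw [Finset.mem_map]
      refine ⟨_, Finset.mem_biUnion.mpr ⟨_, ?_, prefixNat_mem_rowWords hΛ hd k⟩, rfl⟩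
      rw [hW, Finset.mem_Icc]
      exact ⟨Nat.ceil_le.mpr (by linarith [h4.2]), Nat.le_floor h4.1⟩)
  refine le_antisymm (h.trans (le_of_eq ?_)) zero_le
  refine Tendsto.liminf_eq ?_
  have h1 : Tendsto (fun k : ℕ => (N / (n : ℝ) ^ s) ^ k) atTop (𝓝 0) :=
    tendsto_pow_atTop_nhds_zero_of_lt_one (by positivity) (by rwa [div_lt_one (by positivity)])
  have h2 := ENNReal.Tendsto.const_mul (a := ((2 : ℕ) : ℝ≥0∞)) (ENNReal.tendsto_ofReal h1)
    (Or.inr (ENNReal.natCast_ne_top _))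
  simpa using h2

/-- A horizontal slice of the periodic carpet containing an affine copy of the vertical projection
forces some row to be long. -/
lemma exists_long_row (hn : 2 ≤ n) (hm : 2 ≤ m) (hΛ : ∀ d ∈ Λ, d.1 < n ∧ d.2 < m)
    (hJ : 2 ≤ (Λ.image Prod.snd).card) {r σ τ : ℝ} (hr : r ≠ 0)
    (h : ∀ x y, (x, y) ∈ BMCarpet n m Λ → (r * y + σ, τ) ∈ periodicCarpet n m Λ) :
    ∃ j, (n : ℝ) ^ Real.logb m (Λ.image Prod.snd).card ≤ (row Λ j).card := by
  have hβ := logb_card_nonneg hm (Λ.image Prod.snd).card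
  have hpos := hausdorffMeasure_digitSet_pos hm (image_snd_lt hΛ) hJ
  set β := Real.logb m (Λ.image Prod.snd).card with hβdef
  obtain ⟨j, -, hj⟩ := Finset.exists_max_image (Finset.range m) (fun j => (row Λ j).card)
    ⟨0, Finset.mem_range.mpr (by omega)⟩
  refine ⟨j, ?_⟩
  by_contra! hlt
  have hN : ∀ j', (row Λ j').card ≤ (row Λ j).card := by
    intro j'
    rcases lt_or_ge j' m with h1 | h1
    · exact hj j' (Finset.mem_range.mpr h1)
    · have : row Λ j' = ∅ := by
        rw [Finset.eq_empty_iff_forall_notMem]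
        intro i hi
        have := (hΛ _ (mem_row.mp hi)).2
        simp only at this
        omega
      simp [this]
  have h0 : μH[β] ((fun y => r * y + σ) '' digitSet m (Λ.image Prod.snd)) = 0 := by
    have hsub : (fun y => r * y + σ) '' digitSet m (Λ.image Prod.snd) ⊆
        ⋃ z : ℤ, ⋃ w : ℤ, (fun x => 1 * x + -(z : ℝ)) '' {x | (x, τ + w) ∈ BMCarpet n m Λ} := by
      rintro _ ⟨y, hy, rfl⟩
      obtain ⟨x, hx⟩ := exists_mem_carpet_of_snd (n := n) hy
      obtain ⟨z, w, hzw⟩ := h x y hx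
      exact mem_iUnion₂.mpr ⟨z, w, _, hzw, by ring⟩
    refine measure_mono_null hsub ?_
    rw [measure_iUnion_null_iff]
    intro z
    rw [measure_iUnion_null_iff]
    intro w
    rw [hausdorffMeasure_affine_image hβ one_ne_zero,
      hausdorffMeasure_slice_eq_zero hn hm hΛ hN hβ hlt, mul_zero]
  rw [hausdorffMeasure_affine_image hβ hr, mul_eq_zero, ENNReal.ofReal_eq_zero] at h0
  have hr' : 0 < |r| ^ β := by positivity
  rcases h0 with h0 | h0
  · linarith
  · exact hpos.ne' h0

end Slices

section Oblique

variable {n m : ℕ} {Λ : Finset (ℕ × ℕ)}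

/-- A carpet with a missing digit pair contains no oblique segment. -/
lemma no_oblique_segment (hm : 2 ≤ m) (hnm : m < n) (hΛ : ∀ d ∈ Λ, d.1 < n ∧ d.2 < m)
    (hcard : Λ.card < m * n) {a₁ a₂ t₁ t₂ : ℝ} (ha₁ : a₁ ≠ 0) (ha₂ : a₂ ≠ 0)
    (h : ∀ x ∈ Icc (0 : ℝ) 1, (a₁ * x + t₁, a₂ * x + t₂) ∈ BMCarpet n m Λ) : False := by
  have hn : 2 ≤ n := by omega
  have hm0 : (2 : ℝ) ≤ m := by exact_mod_cast hm
  have hmp : (0 : ℝ) < m := by linarith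
  have hnm' : (m : ℝ) < n := by exact_mod_cast hnm
  have hnp : (0 : ℝ) < n := by linarith
  have ha₁' : 0 < |a₁| := abs_pos.mpr ha₁
  have ha₂' : 0 < |a₂| := abs_pos.mpr ha₂
  obtain ⟨i, hi, j, hj, hij⟩ := exists_missing_pair hcard
  have e1 := (tendsto_pow_atTop_atTop_of_one_lt (show (1 : ℝ) < m by linarith)).eventually_gt_atTop
    (2 / |a₂|)
  have e2 := (tendsto_pow_atTop_atTop_of_one_lt (show (1 : ℝ) < n by linarith)).eventually_gt_atTop
    (2 / |a₁|)
  have e3 := (tendsto_pow_atTop_atTop_of_one_lt (show (1 : ℝ) < n / m by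
    rwa [lt_div_iff₀ hmp, one_mul])).eventually_gt_atTop (|a₂| * (2 * m) / |a₁|)
  obtain ⟨w, h1, h2, h3⟩ := (e1.and (e2.and e3)).exists
  rw [div_lt_iff₀ ha₂'] at h1
  rw [div_lt_iff₀ ha₁'] at h2
  rw [div_pow, div_lt_div_iff₀ ha₁' (by positivity)] at h3
  have hmw : (0 : ℝ) < (m : ℝ) ^ w := by positivity
  have hnw : (0 : ℝ) < (n : ℝ) ^ w := by positivity
  obtain ⟨x₀, hx₀, z, hz⟩ := exists_mul_add_eq_int_add (mul_ne_zero hmw.ne' ha₂)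
    ((m : ℝ) ^ w * t₂) (((j : ℝ) + 1 / 2) / m)
  obtain ⟨x, hx, z', hz'⟩ := exists_mul_add_eq_int_add (mul_ne_zero hnw.ne' ha₁)
    ((n : ℝ) ^ w * (a₁ * x₀ + t₁)) (((i : ℝ) + 1 / 2) / n)
  rw [abs_mul, abs_of_pos hmw] at hx₀
  rw [abs_mul, abs_of_pos hnw] at hx
  have hx₀2 : x₀ ≤ 1 / 2 := hx₀.2.trans (one_div_le_one_div_of_le two_pos h1.le)
  have hx2 : x ≤ 1 / 2 := hx.2.trans (one_div_le_one_div_of_le two_pos h2.le)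
  have hmem := pow_mul_mem_periodicCarpet hn hm hΛ w
    (h (x₀ + x) ⟨add_nonneg hx₀.1 hx.1, by linarith⟩)
  refine notMem_periodicCarpet_of_missing hn hm hΛ hi hj hij (z := z') (w := z) ?_ ?_ hmem
  · rw [← hz']
    ring
  · have h4 : (m : ℝ) ^ w * (a₂ * (x₀ + x) + t₂) - z - ((j : ℝ) + 1 / 2) / m
        = (m : ℝ) ^ w * a₂ * x := by
      rw [sub_sub, ← hz]
      ring
    rw [h4, abs_mul, abs_mul, abs_of_pos hmw, abs_of_nonneg hx.1]
    calc (m : ℝ) ^ w * |a₂| * x ≤ (m : ℝ) ^ w * |a₂| * (1 / ((n : ℝ) ^ w * |a₁|)) := by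
          gcongr
          exact hx.2
      _ < 1 / (2 * m) := by
          rw [mul_one_div, div_lt_div_iff₀ (by positivity) (by positivity)]
          linarith

lemma digitSum_update {b : ℕ} (hb : 2 ≤ b) {d : ℕ → ℕ} (hd : ∀ k, d k < b) (s a : ℕ) :
    digitSum b (Function.update d s a) = digitSum b d + ((a : ℝ) - d s) / (b : ℝ) ^ (s + 1) := by
  have h := (summable_digits hb hd).hasSum.update s ((a : ℝ) / (b : ℝ) ^ (s + 1))
  have h1 : Function.update (fun k => (d k : ℝ) / (b : ℝ) ^ (k + 1)) s ((a : ℝ) / (b : ℝ) ^ (s + 1))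
      = fun k => ((Function.update d s a k : ℕ) : ℝ) / (b : ℝ) ^ (k + 1) := by
    ext k
    rcases eq_or_ne k s with rfl | hk
    · simp
    · simp [hk]
  rw [h1] at h
  rw [digitSum, h.tsum_eq, digitSum]
  ring

lemma modified_cylinder_mem_carpet (hn : 2 ≤ n) (hm : 2 ≤ m) (hΛ : ∀ d ∈ Λ, d.1 < n ∧ d.2 < m)
    {i i' j : ℕ} (hi : (i, j) ∈ Λ) (hi' : (i', j) ∈ Λ) {s k : ℕ} (hs : s < k) {x y : ℝ}
    (h : (x, y) ∈ BMCarpet n m Λ) :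
    ((prefixNat n (fun _ => i) k + x) / (n : ℝ) ^ k + ((i' : ℝ) - i) / (n : ℝ) ^ (s + 1),
      (prefixNat m (fun _ => j) k + y) / (m : ℝ) ^ k) ∈ BMCarpet n m Λ := by
  obtain ⟨e, he, h1, h2⟩ := mem_carpet.mp h
  simp only at h1 h2
  have hn0 : (0 : ℝ) < n := by positivity
  have hm0 : (0 : ℝ) < m := by positivity
  have hmem : ∀ r, splice k (fun _ => (i, j)) e r ∈ Λ :=
    splice_mem (s := (Λ : Set (ℕ × ℕ))) (fun _ => hi) he k
  have hs' : splice k (fun _ => (i, j)) e s = (i, j) := by simp [splice, hs]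
  refine mem_carpet.mpr ⟨Function.update (splice k (fun _ => (i, j)) e) s (i', j), fun r => ?_, ?_, ?_⟩
  · rcases eq_or_ne r s with rfl | hr
    · simpa using hi'
    · simpa [hr] using hmem r
  · have h3 : (fun r => (Function.update (splice k (fun _ => (i, j)) e) s (i', j) r).1)
        = Function.update (fun r => (splice k (fun _ => (i, j)) e r).1) s i' := by
      ext r
      rcases eq_or_ne r s with rfl | hr
      · simp
      · simp [hr]
    rw [h3, digitSum_update hn fun r => (hΛ _ (hmem r)).1, hs', comp_splice Prod.fst]
    simp only
    congr 1
    rw [div_eq_iff (by positivity), mul_comm, pow_mul_digitSum_splice hn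
      (fun _ => (hΛ _ hi).1) (fun r => (hΛ _ (he r)).1), h1]
  · have h3 : (fun r => (Function.update (splice k (fun _ => (i, j)) e) s (i', j) r).2)
        = fun r => (splice k (fun _ => (i, j)) e r).2 := by
      ext r
      rcases eq_or_ne r s with rfl | hr
      · simp [hs']
      · simp [hr]
    rw [h3, comp_splice Prod.snd, div_eq_iff (by positivity), mul_comm, pow_mul_digitSum_splice hm
      (fun _ => (hΛ _ hi).2) (fun r => (hΛ _ (he r)).2), h2]

/-- Two digit pairs in one row make the limiting embedding of the vertical projection non-isolated,
which is impossible if some row is empty. -/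
lemma no_oblique_embedding_of_two_in_row (hm : 2 ≤ m) (hnm : m < n)
    (hΛ : ∀ d ∈ Λ, d.1 < n ∧ d.2 < m) (hJ2 : 2 ≤ (Λ.image Prod.snd).card)
    (hJm : (Λ.image Prod.snd).card < m) {p q : ℕ} (hqp : q < p) (hpow : n ^ q = m ^ p)
    {i i' j : ℕ} (hi : (i, j) ∈ Λ) (hi' : (i', j) ∈ Λ) (hii' : i ≠ i') {a₂ b₂ t₂ : ℝ} (ha₂ : a₂ ≠ 0)
    (hb₂ : b₂ ≠ 0)
    (h : ∀ x y, (x, y) ∈ BMCarpet n m Λ → a₂ * x + b₂ * y + t₂ ∈ digitSet m (Λ.image Prod.snd)) :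
    False := by
  have hn : 2 ≤ n := by omega
  have hm0 : (2 : ℝ) ≤ m := by exact_mod_cast hm
  have hnm' : (m : ℝ) < n := by exact_mod_cast hnm
  have hnp : (0 : ℝ) < n := by linarith
  have hmp : (0 : ℝ) < m := by linarith
  have hpow' : (n : ℝ) ^ q = (m : ℝ) ^ p := by exact_mod_cast hpow
  have hJ := image_snd_lt hΛ
  have hcl := isClosed_periodize (isCompact_digitSet hm hJ)
  set E := periodize (digitSet m (Λ.image Prod.snd)) with hE
  set P : ℕ → ℕ := prefixNat n fun _ => i with hP
  set R : ℕ → ℕ := prefixNat m fun _ => j with hR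
  set c := (n : ℝ) ^ q / (n : ℝ) ^ p with hc
  have hc1 : c < 1 := by
    rw [div_lt_one (by positivity)]
    exact pow_lt_pow_right₀ (by linarith) hqp
  set t : ℕ → ℝ := fun k => a₂ * c ^ k * P (p * k) + b₂ * R (p * k) + (m : ℝ) ^ (p * k) * t₂ with ht
  obtain ⟨-, τ, φ, hφ, -, hτ⟩ := exists_subseq_tendsto_fract t t
  have hmem : ∀ e k : ℕ, e < k → ∀ x y, (x, y) ∈ BMCarpet n m Λ →
      b₂ * y + a₂ * c ^ k * x + (Int.fract (t k) + a₂ * (i' - i) / (n : ℝ) ^ (e + 1)) ∈ E := by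
    intro e k hek x y hxy
    have hlt : q * k + e < p * k := by nlinarith
    have h1 := add_int_mem_periodize (-⌊t k⌋) (pow_mul_mem_periodize hm hJ (p * k)
      (subset_periodize _ (h _ _ (modified_cylinder_mem_carpet hn hm hΛ hi hi' hlt hxy))))
    convert h1 using 1
    have h2 : (m : ℝ) ^ (p * k) = (n : ℝ) ^ (q * k) := by rw [pow_mul, ← hpow', ← pow_mul]
    have h3 : (m : ℝ) ^ (p * k) * (b₂ * ((R (p * k) + y) / (m : ℝ) ^ (p * k)))
        = b₂ * (R (p * k) + y) := by
      field_simp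
    have h4 : (m : ℝ) ^ (p * k) * (a₂ * (((i' : ℝ) - i) / (n : ℝ) ^ (q * k + e + 1)))
        = a₂ * (i' - i) / (n : ℝ) ^ (e + 1) := by
      rw [h2, add_assoc, pow_add _ (q * k)]
      field_simp
    have h5 : (m : ℝ) ^ (p * k) * (a₂ * ((P (p * k) + x) / (n : ℝ) ^ (p * k)))
        = a₂ * c ^ k * (P (p * k) + x) := by
      rw [h2, hc, div_pow, ← pow_mul, ← pow_mul]
      ring
    rw [← Int.self_sub_floor]
    simp only [ht]
    push_cast
    linear_combination -h3 - h4 - h5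
  have hlim : ∀ e : ℕ, ∀ y ∈ digitSet m (Λ.image Prod.snd),
      b₂ * y + (τ + a₂ * (i' - i) / (n : ℝ) ^ (e + 1)) ∈ E := by
    intro e y hy
    obtain ⟨x, hxy⟩ := exists_mem_carpet_of_snd (n := n) hy
    have hl : Tendsto (fun k => b₂ * y + a₂ * c ^ φ k * x
        + (Int.fract (t (φ k)) + a₂ * (i' - i) / (n : ℝ) ^ (e + 1))) atTop
        (𝓝 (b₂ * y + 0 + (τ + a₂ * (i' - i) / (n : ℝ) ^ (e + 1)))) :=
      (tendsto_const_nhds.add (tendsto_const_mul_pow_subseq (by positivity) hc1 hφ a₂ x)).add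
        (hτ.add tendsto_const_nhds)
    rw [add_zero] at hl
    refine hcl.mem_of_tendsto hl ?_
    filter_upwards [hφ.tendsto_atTop.eventually_gt_atTop e] with k hk
    exact hmem e _ hk x y hxy
  obtain ⟨ε, hε, hiso⟩ := affine_embedding_isolated hm hJ hJ2 hJm (t := τ) hb₂
  have hsmall : Tendsto (fun e : ℕ => a₂ * (i' - i) / (n : ℝ) ^ (e + 1)) atTop (𝓝 0) :=
    ((tendsto_pow_atTop_atTop_of_one_lt (show (1 : ℝ) < n by linarith)).comp
      (tendsto_add_atTop_nat 1)).const_div_atTop _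
  obtain ⟨e, he⟩ := (hsmall.eventually (Metric.ball_mem_nhds 0 hε)).exists
  rw [dist_zero_right, Real.norm_eq_abs] at he
  have h1 := (hiso b₂ _ (by simpa using hε) (by rwa [add_sub_cancel_left]) (hlim e)).2
  have h2 : a₂ * ((i' : ℝ) - i) / (n : ℝ) ^ (e + 1) = 0 := by linarith
  have h3 : (i' : ℝ) - i ≠ 0 := sub_ne_zero.mpr (by exact_mod_cast hii'.symm)
  exact div_ne_zero (mul_ne_zero ha₂ h3) (by positivity) h2

lemma no_oblique_self_embedding (hm : 2 ≤ m) (hnm : m < n)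
    (hΛ : ∀ d ∈ Λ, d.1 < n ∧ d.2 < m) (hcard : Λ.card < m * n)
    (hrat : ∃ q : ℚ, Real.log n / Real.log m = q) (hline : ¬ OnALine (BMCarpet n m Λ))
    {a₁ b₁ a₂ b₂ t₁ t₂ : ℝ} (ha₁ : a₁ ≠ 0) (hb₁ : b₁ ≠ 0) (ha₂ : a₂ ≠ 0) (hb₂ : b₂ ≠ 0)
    (h : ∀ x y, (x, y) ∈ BMCarpet n m Λ →
      (a₁ * x + b₁ * y + t₁, a₂ * x + b₂ * y + t₂) ∈ BMCarpet n m Λ) : False := by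
  have hn : 2 ≤ n := by omega
  have hJ2 := two_le_card_image_snd hline
  have hne : Λ.Nonempty := by
    have h0 : 0 < (Λ.image Prod.snd).card := by omega
    exact Finset.image_nonempty.mp (Finset.card_pos.mp h0)
  obtain ⟨p, q, hqp, hpow⟩ := exists_pow_eq_pow_of_log_rational hm hnm hrat
  obtain ⟨σ, τ, hστ⟩ := exists_slice_embedding hm hnm hΛ hne hqp hpow h
  obtain ⟨j, hj⟩ := exists_long_row hn hm hΛ hJ2 hb₁ hστ
  have hm1 : (1 : ℝ) < m := by exact_mod_cast hm
  have hn1 : (1 : ℝ) < n := by exact_mod_cast hn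
  rcases lt_or_ge (Λ.image Prod.snd).card m with hJ | hJ
  · have h1 : (1 : ℝ) < (row Λ j).card :=
      (Real.one_lt_rpow hn1 (logb_card_pos hm hJ2)).trans_le hj
    obtain ⟨i, hi, i', hi', hii'⟩ := Finset.one_lt_card.mp (by exact_mod_cast h1)
    exact no_oblique_embedding_of_two_in_row hm hnm hΛ hJ2 hJ hqp hpow (mem_row.mp hi)
      (mem_row.mp hi') hii' ha₂ hb₂ fun x y hxy => snd_mem_digitSet (h x y hxy)
  · have hJ' : (Λ.image Prod.snd).card = m := by
      refine le_antisymm ?_ hJ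
      simpa using Finset.card_le_card (t := Finset.range m)
        fun j hj => Finset.mem_range.mpr (image_snd_lt hΛ j hj)
    rw [hJ', Real.logb_self_eq_one hm1, Real.rpow_one] at hj
    have hrow : digitSet n (row Λ j) = Icc 0 1 :=
      digitSet_eq_Icc_of_card hn (fun i hi => (hΛ _ (mem_row.mp hi)).1) (by exact_mod_cast hj)
    refine no_oblique_segment hm hnm hΛ hcard ha₁ ha₂ (t₁ := b₁ * digitSum m (fun _ => j) + t₁)
      (t₂ := b₂ * digitSum m (fun _ => j) + t₂) fun x hx => ?_
    rw [← hrow] at hx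
    obtain ⟨d, hd, rfl⟩ := hx
    have := h (digitSum n d) (digitSum m fun _ => j)
      (mem_carpet.mpr ⟨fun k => (d k, j), fun k => mem_row.mp (hd k), rfl, rfl⟩)
    convert this using 2 <;> ring

end Oblique

end BedfordMcMullen

theorem log_commensurability_of_self_embedding
    (n m : ℕ) (Λ : Finset (ℕ × ℕ))
    (hm : 2 ≤ m) (hnm : m < n)
    (hΛsub : Λ ⊆ Finset.range n ×ˢ Finset.range m)
    (hΛ1 : 1 < Λ.card) (hΛ2 : Λ.card < m * n)
    (hrat : ∃ q : ℚ, Real.log n / Real.log m = (q : ℝ))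
    (hline : ¬ OnALine (BMCarpet n m Λ))
    (f : ℝ × ℝ → ℝ × ℝ) (l : ℝ) (hl : 0 < l)
    (hf : IsSimilitude f l)
    (hsub : f '' BMCarpet n m Λ ⊆ BMCarpet n m Λ) :
    ∃ q : ℚ, Real.log l / Real.log n = (q : ℝ) := by
  obtain ⟨a₁, b₁, a₂, b₂, t₁, t₂, hfe, ha, hb, hab⟩ := BedfordMcMullen.similitude_eq_affine hf
  have h : ∀ x y, (x, y) ∈ BMCarpet n m Λ →
      (a₁ * x + b₁ * y + t₁, a₂ * x + b₂ * y + t₂) ∈ BMCarpet n m Λ := fun x y hxy =>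
    hfe x y ▸ hsub (Set.mem_image_of_mem f hxy)
  have hΛ : ∀ d ∈ Λ, d.1 < n ∧ d.2 < m := fun d hd => by
    simpa using hΛsub hd
  have hl2 : 0 < l ^ 2 := by positivity
  have hcases : (b₁ = 0 ∧ a₂ = 0) ∨ (a₁ = 0 ∧ b₂ = 0) := by
    by_contra hcon
    have ha₁ : a₁ ≠ 0 := by
      rintro rfl
      have h0 : a₂ ≠ 0 := by rintro rfl; norm_num at ha; linarith
      exact hcon (Or.inr ⟨rfl, by simpa [h0] using hab⟩)
    have ha₂ : a₂ ≠ 0 := by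
      rintro rfl
      exact hcon (Or.inl ⟨by simpa [ha₁] using hab, rfl⟩)
    have hb₁ : b₁ ≠ 0 := by
      rintro rfl
      have h0 : b₂ = 0 := by simpa [ha₂] using hab
      rw [h0] at hb
      norm_num at hb
      linarith
    have hb₂ : b₂ ≠ 0 := by
      rintro rfl
      simp [ha₁, hb₁] at hab
    exact BedfordMcMullen.no_oblique_self_embedding hm hnm hΛ hΛ2 hrat hline ha₁ hb₁ ha₂ hb₂ h
  have hhom : ∃ s t : ℝ, ∀ x y, (x, y) ∈ BMCarpet n m Λ →
      (l ^ 4 * x + s, l ^ 4 * y + t) ∈ BMCarpet n m Λ := by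
    rcases hcases with ⟨rfl, rfl⟩ | ⟨rfl, rfl⟩
    · refine ⟨(a₁ ^ 3 + a₁ ^ 2 + a₁ + 1) * t₁, (b₂ ^ 3 + b₂ ^ 2 + b₂ + 1) * t₂, fun x y hxy => ?_⟩
      convert h _ _ (h _ _ (h _ _ (h _ _ hxy))) using 2
      · linear_combination -(x * (a₁ ^ 2 + l ^ 2)) * ha
      · linear_combination -(y * (b₂ ^ 2 + l ^ 2)) * hb
    · refine ⟨(b₁ * a₂ + 1) * (b₁ * t₂ + t₁), (a₂ * b₁ + 1) * (a₂ * t₁ + t₂), fun x y hxy => ?_⟩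
      convert h _ _ (h _ _ (h _ _ (h _ _ hxy))) using 2
      · linear_combination -(x * b₁ ^ 2) * ha - x * l ^ 2 * hb
      · linear_combination -(y * b₁ ^ 2) * ha - y * l ^ 2 * hb
  obtain ⟨s, t, hst⟩ := hhom
  obtain ⟨q, hq⟩ := BedfordMcMullen.log_ratio_rational_of_homothety hm hnm hΛsub hΛ2 hrat hline
    (by positivity) hst
  refine ⟨q / 4, ?_⟩
  rw [Real.log_pow] at hq
  push_cast at hq ⊢
  rw [← hq]
  ring
end
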